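/- arXiv:math/0507567 — 9 statements merged into one kernel-verified Lean document; each statement's English description precedes it below -/
import Mathlib

section
/- Let n ≥ 1 and let O ⊆ ℝⁿ be an open set. Let h₁, h₂ : O → ℝⁿ be smooth vector fields such that L_{h₂}L_{h₁}^i y₁ = 0 on O for every i = 0,…,n−2 and L_{h₂}L_{h₁}^{n−1} y₁(y) ≠ 0 for every y ∈ O. Define S : O → ℝⁿ by S(y) = (y₁, L_{h₁} y₁(y), …, L_{h₁}^{n−1} y₁(y)) and F : O → GL(2,ℝ) by F(y) = [[1, 0], [L_{h₁}^n y₁(y), L_{h₂}L_{h₁}^{n−1} y₁(y)]]. Suppose y : I → O is C¹ on an interval I and u = (u₁,u₂) : I → ℝ² is continuous with ẏ(t) = u₁(t) h₁(y(t)) + u₂(t) h₂(y(t)) for all t ∈ I. Put s(t) = S(y(t)) and v(t) = F(y(t)) u(t). Then s₁(t) = y₁(t), v₁(t) = u₁(t), and for all t ∈ I: ṡᵢ(t) = v₁(t) s_{i+1}(t) for i = 1,…,n−1, and ṡₙ(t) = v₂(t). -/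
open Set

/-- Lie derivative of a scalar function `φ` along a vector field `h` on `ℝⁿ`. -/
noncomputable def lieDeriv {n : ℕ} (h : EuclideanSpace ℝ (Fin n) → EuclideanSpace ℝ (Fin n))
    (φ : EuclideanSpace ℝ (Fin n) → ℝ) : EuclideanSpace ℝ (Fin n) → ℝ :=
  fun y => fderiv ℝ φ y (h y)

/-- Repeated Lie derivatives: `lieIter h φ 0 = φ`, `lieIter h φ (i+1) = L_h (lieIter h φ i)`. -/
noncomputable def lieIter {n : ℕ} (h : EuclideanSpace ℝ (Fin n) → EuclideanSpace ℝ (Fin n))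
    (φ : EuclideanSpace ℝ (Fin n) → ℝ) : ℕ → EuclideanSpace ℝ (Fin n) → ℝ
  | 0 => φ
  | (i + 1) => lieDeriv h (lieIter h φ i)

/-- Iterated Lie derivatives of a smooth function along a smooth vector field are smooth. -/
theorem contDiffOn_lieIter {n : ℕ} {O : Set (EuclideanSpace ℝ (Fin n))} (hO : IsOpen O)
    {h : EuclideanSpace ℝ (Fin n) → EuclideanSpace ℝ (Fin n)}
    (hh : ContDiffOn ℝ (⊤ : ℕ∞) h O) {φ : EuclideanSpace ℝ (Fin n) → ℝ}
    (hφ : ContDiffOn ℝ (⊤ : ℕ∞) φ O) (i : ℕ) :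
    ContDiffOn ℝ (⊤ : ℕ∞) (lieIter h φ i) O := by
  induction i with
  | zero => exact hφ
  | succ i ih => exact (ih.fderiv_of_isOpen hO (by simp)).clm_apply hh

/-- The derivative of an iterated Lie derivative along a trajectory of the control system
`ẏ = a h₁(y) + b h₂(y)`. -/
theorem hasDerivAt_lieIter_comp {n : ℕ} {O : Set (EuclideanSpace ℝ (Fin n))} (hO : IsOpen O)
    {h₁ : EuclideanSpace ℝ (Fin n) → EuclideanSpace ℝ (Fin n)}
    (h₂ : EuclideanSpace ℝ (Fin n) → EuclideanSpace ℝ (Fin n))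
    (hh₁ : ContDiffOn ℝ (⊤ : ℕ∞) h₁ O) {φ : EuclideanSpace ℝ (Fin n) → ℝ}
    (hφ : ContDiffOn ℝ (⊤ : ℕ∞) φ O) {y : ℝ → EuclideanSpace ℝ (Fin n)} {t a b : ℝ}
    (hyO : y t ∈ O) (hy : HasDerivAt y (a • h₁ (y t) + b • h₂ (y t)) t) (i : ℕ) :
    HasDerivAt (fun τ => lieIter h₁ φ i (y τ))
      (a * lieIter h₁ φ (i + 1) (y t) + b * lieDeriv h₂ (lieIter h₁ φ i) (y t)) t := by
  have hd : DifferentiableAt ℝ (lieIter h₁ φ i) (y t) :=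
    ((contDiffOn_lieIter hO hh₁ hφ i).contDiffAt (hO.mem_nhds hyO)).differentiableAt (by simp)
  simpa [lieIter, lieDeriv, Function.comp_def] using hd.hasFDerivAt.comp_hasDerivAt t hy

theorem stmt0 {n : ℕ} (hn : 1 ≤ n)
    (O : Set (EuclideanSpace ℝ (Fin n))) (hO : IsOpen O)
    (h₁ h₂ : EuclideanSpace ℝ (Fin n) → EuclideanSpace ℝ (Fin n))
    (hh₁ : ContDiffOn ℝ (⊤ : ℕ∞) h₁ O) (hh₂ : ContDiffOn ℝ (⊤ : ℕ∞) h₂ O)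
    -- `y₁` is the first coordinate function
    (y₁ : EuclideanSpace ℝ (Fin n) → ℝ) (hy₁ : ∀ y, y₁ y = y ⟨0, hn⟩)
    -- `L_{h₂} L_{h₁}^i y₁ = 0` on `O` for `i = 0, …, n-2`
    (hzero : ∀ i < n - 1, ∀ y ∈ O, lieDeriv h₂ (lieIter h₁ y₁ i) y = 0)
    -- `L_{h₂} L_{h₁}^{n-1} y₁ ≠ 0` on `O`
    (hnz : ∀ y ∈ O, lieDeriv h₂ (lieIter h₁ y₁ (n - 1)) y ≠ 0)
    (I : Set ℝ) (y : ℝ → EuclideanSpace ℝ (Fin n)) (u : ℝ → ℝ × ℝ)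
    (hy : ∀ t ∈ I, HasDerivAt y ((u t).1 • h₁ (y t) + (u t).2 • h₂ (y t)) t)
    (hyO : ∀ t ∈ I, y t ∈ O)
    (hu : ContinuousOn u I)
    -- `s(t) = S(y(t))`, components `s_i = L_{h₁}^{i-1} y₁`, 0-indexed here
    (s : ℝ → ℕ → ℝ) (hs : ∀ t i, s t i = lieIter h₁ y₁ i (y t))
    -- `v(t) = F(y(t)) u(t)`
    (v : ℝ → ℝ × ℝ)
    (hv : ∀ t, v t = ((u t).1,
      lieIter h₁ y₁ n (y t) * (u t).1 + lieDeriv h₂ (lieIter h₁ y₁ (n - 1)) (y t) * (u t).2)) :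
    (∀ t, s t 0 = y₁ (y t)) ∧ (∀ t, (v t).1 = (u t).1) ∧
    (∀ t ∈ I, ∀ i < n - 1, HasDerivAt (fun τ => s τ i) ((v t).1 * s t (i + 1)) t) ∧
    (∀ t ∈ I, HasDerivAt (fun τ => s τ (n - 1)) ((v t).2) t) := by
  have hφ : ContDiffOn ℝ (⊤ : ℕ∞) y₁ O := by
    rw [funext hy₁]
    fun_prop
  have key := fun t (ht : t ∈ I) =>
    hasDerivAt_lieIter_comp hO h₂ hh₁ hφ (hyO t ht) (hy t ht)
  refine ⟨fun t => hs t 0, fun t => by rw [hv], fun t ht i hi => ?_, fun t ht => ?_⟩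
  · simpa [hs, hv, hzero i hi _ (hyO t ht)] using key t ht i
  · have := key t ht (n - 1)
    rw [Nat.sub_add_cancel hn] at this
    simpa [hs, hv, mul_comm] using this
end

section
/- Let n ≥ 1, let x^D ∈ C^{n+1}([0,∞), ℝ²) satisfy inf_{t≥0} |ẋ^D(t)| > 0, and let ε ∈ {−1, 1}. Then there exist s^D ∈ C¹([0,∞), ℝⁿ) and a continuous v^D = (v₁^D, v₂^D) : [0,∞) → ℝ² with v₁^D(t) = ε·|ẋ^D(t)| for all t, such that for all t ≥ 0: ẋ₁^D(t) = v₁^D(t) cos s₁^D(t), ẋ₂^D(t) = v₁^D(t) sin s₁^D(t), ṡᵢ^D(t) = v₁^D(t) s_{i+1}^D(t) for i = 1,…,n−1, and ṡₙ^D(t) = v₂^D(t). -/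
open Set

/-- A continuous function on `[0,∞)` has a primitive there with any prescribed initial value. -/
theorem exists_primitive_Ici {g : ℝ → ℝ} (hg : ContinuousOn g (Ici 0)) (c : ℝ) :
    ∃ F : ℝ → ℝ, F 0 = c ∧ ∀ t ∈ Ici (0 : ℝ), HasDerivWithinAt F (g t) (Ici 0) t := by
  have hG : Continuous fun t : ℝ => g (max t 0) :=
    hg.comp_continuous (by fun_prop) fun t => le_max_right t 0
  refine ⟨fun t => c + ∫ τ in (0 : ℝ)..t, g (max τ 0), by simp, fun t ht => ?_⟩
  have h := (hG.integral_hasStrictDerivAt 0 t).hasDerivAt.const_add c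
  rw [max_eq_left (mem_Ici.1 ht)] at h
  exact h.hasDerivWithinAt

/-- A function on `[0,∞)` whose derivative vanishes is constant. -/
theorem eq_apply_zero_of_hasDerivWithinAt_zero_Ici {f : ℝ → ℝ}
    (hf : ∀ t ∈ Ici (0 : ℝ), HasDerivWithinAt f 0 (Ici 0) t) {t : ℝ} (ht : t ∈ Ici (0 : ℝ)) :
    f t = f 0 := by
  have h := (convex_Ici (0 : ℝ)).norm_image_sub_le_of_norm_hasDerivWithin_le (C := 0) hf
    (by simp) self_mem_Ici ht
  rw [zero_mul] at h
  exact sub_eq_zero.1 (norm_le_zero_iff.1 h)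

/-- A `C^n` curve on `[0,∞)` in the unit circle has a `C^n` angle function, for `n ≥ 1`. -/
theorem exists_contDiffOn_angle {n : ℕ} (hn : 1 ≤ n) {a b : ℝ → ℝ}
    (ha : ContDiffOn ℝ n a (Ici 0)) (hb : ContDiffOn ℝ n b (Ici 0))
    (hab : ∀ t ∈ Ici (0 : ℝ), a t ^ 2 + b t ^ 2 = 1) :
    ∃ θ : ℝ → ℝ, ContDiffOn ℝ n θ (Ici 0) ∧
      ∀ t ∈ Ici (0 : ℝ), a t = Real.cos (θ t) ∧ b t = Real.sin (θ t) := by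
  obtain ⟨m, rfl⟩ := Nat.exists_eq_add_of_le' hn
  have hu := uniqueDiffOn_Ici (0 : ℝ)
  push_cast at ha hb ⊢
  obtain ⟨ha₁, -, ha₂⟩ := (contDiffOn_succ_iff_derivWithin hu).1 ha
  obtain ⟨hb₁, -, hb₂⟩ := (contDiffOn_succ_iff_derivWithin hu).1 hb
  set a' := derivWithin a (Ici 0)
  set b' := derivWithin b (Ici 0)
  have hda : ∀ t ∈ Ici (0 : ℝ), HasDerivWithinAt a (a' t) (Ici 0) t :=
    fun t ht => (ha₁ t ht).hasDerivWithinAt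
  have hdb : ∀ t ∈ Ici (0 : ℝ), HasDerivWithinAt b (b' t) (Ici 0) t :=
    fun t ht => (hb₁ t ht).hasDerivWithinAt
  have hg : ContDiffOn ℝ m (fun t => a t * b' t - b t * a' t) (Ici 0) :=
    ((ha.of_le (by simp)).mul hb₂).sub ((hb.of_le (by simp)).mul ha₂)
  obtain ⟨θ, hθ₀, hθ⟩ := exists_primitive_Ici hg.continuousOn (Complex.arg ⟨a 0, b 0⟩)
  have horth : ∀ t ∈ Ici (0 : ℝ), a t * a' t + b t * b' t = 0 := by
    intro t ht
    have h := ((hda t ht).pow 2).add ((hdb t ht).pow 2)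
    have h' : HasDerivWithinAt (a ^ 2 + b ^ 2) 0 (Ici 0) t :=
      (hasDerivWithinAt_const t (Ici 0) (1 : ℝ)).congr hab (hab t ht)
    have := (hu t ht).eq_deriv _ h h'
    norm_num at this
    linarith
  have hinit : a 0 = Real.cos (θ 0) ∧ b 0 = Real.sin (θ 0) := by
    have hz : ‖(⟨a 0, b 0⟩ : ℂ)‖ = 1 := by
      rw [Complex.norm_def, Complex.normSq_mk, ← sq, ← sq, hab 0 self_mem_Ici, Real.sqrt_one]
    have h₁ := Complex.norm_mul_cos_arg ⟨a 0, b 0⟩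
    have h₂ := Complex.norm_mul_sin_arg ⟨a 0, b 0⟩
    rw [hz, one_mul] at h₁ h₂
    rw [hθ₀]
    exact ⟨h₁.symm, h₂.symm⟩
  refine ⟨θ, ?_, fun t ht => ?_⟩
  · refine (contDiffOn_succ_iff_derivWithin hu).2
      ⟨fun t ht => (hθ t ht).differentiableWithinAt, by simp, ?_⟩
    exact hg.congr fun t ht => (hθ t ht).derivWithin (hu t ht)
  · have hp := eq_apply_zero_of_hasDerivWithinAt_zero_Ici
      (f := fun t => a t * Real.cos (θ t) + b t * Real.sin (θ t)) (fun τ hτ => by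
        refine (((hda τ hτ).mul (hθ τ hτ).cos).add ((hdb τ hτ).mul (hθ τ hτ).sin)).congr_deriv ?_
        linear_combination (-(a' τ) * Real.cos (θ τ) - b' τ * Real.sin (θ τ)) * hab τ hτ
          + (a τ * Real.cos (θ τ) + b τ * Real.sin (θ τ)) * horth τ hτ) ht
    have hq := eq_apply_zero_of_hasDerivWithinAt_zero_Ici
      (f := fun t => b t * Real.cos (θ t) - a t * Real.sin (θ t)) (fun τ hτ => by
        refine (((hdb τ hτ).mul (hθ τ hτ).cos).sub ((hda τ hτ).mul (hθ τ hτ).sin)).congr_deriv ?_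
        linear_combination (-(b' τ) * Real.cos (θ τ) + a' τ * Real.sin (θ τ)) * hab τ hτ
          + (b τ * Real.cos (θ τ) - a τ * Real.sin (θ τ)) * horth τ hτ) ht
    simp only [hinit.1, hinit.2] at hp hq
    have h₀ := Real.cos_sq_add_sin_sq (θ 0)
    have h := Real.cos_sq_add_sin_sq (θ t)
    constructor
    · linear_combination Real.cos (θ t) * hp - Real.sin (θ t) * hq - a t * h
        + Real.cos (θ t) * h₀
    · linear_combination Real.sin (θ t) * hp + Real.cos (θ t) * hq - b t * h
        + Real.sin (θ t) * h₀

/-- The successive derivatives of `θ` on `[0,∞)` with respect to the arc length whose speed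
is `w`. -/
noncomputable def arcDeriv (w θ : ℝ → ℝ) : ℕ → ℝ → ℝ
  | 0 => θ
  | k + 1 => fun t => derivWithin (arcDeriv w θ k) (Ici 0) t / w t

theorem contDiffOn_arcDeriv {w θ : ℝ → ℝ} (hw : ∀ t ∈ Ici (0 : ℝ), w t ≠ 0) (j k : ℕ)
    (hwd : ContDiffOn ℝ ((j + k : ℕ) : WithTop ℕ∞) w (Ici 0))
    (hθ : ContDiffOn ℝ ((j + k : ℕ) : WithTop ℕ∞) θ (Ici 0)) :
    ContDiffOn ℝ j (arcDeriv w θ k) (Ici 0) := by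
  induction k generalizing j with
  | zero => exact hθ
  | succ k ih =>
    have hjk : j + 1 + k = j + (k + 1) := by omega
    have h := ih (j + 1) (hjk ▸ hwd) (hjk ▸ hθ)
    exact (h.derivWithin (uniqueDiffOn_Ici 0) (by simp)).div
      (hwd.of_le (by exact_mod_cast Nat.le_add_right _ _)) hw

/-- Maneuverability of the chained-form kinematic system: any `C^{n+1}` planar
trajectory with speed bounded away from zero can be exactly reproduced, with
longitudinal speed of prescribed sign `ε`. -/
theorem stmt1 {n : ℕ} (hn : 1 ≤ n)
    (xD xD' : ℝ → EuclideanSpace ℝ (Fin 2))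
    -- `xD` is `C^{n+1}` on `[0,∞)`: it has derivative `xD'` which is `C^n`
    (hxD' : ∀ t ∈ Ici (0:ℝ), HasDerivWithinAt xD (xD' t) (Ici 0) t)
    (hxDsmooth : ContDiffOn ℝ n xD' (Ici 0))
    -- `inf_{t ≥ 0} |ẋᴰ(t)| > 0`
    (hinf : ∃ c > 0, ∀ t ∈ Ici (0:ℝ), c ≤ ‖xD' t‖)
    (ε : ℝ) (hε : ε = 1 ∨ ε = -1) :
    ∃ sD : ℝ → Fin n → ℝ, ∃ vD : ℝ → ℝ × ℝ,
      (∀ i : Fin n, ContinuousOn (fun t => sD t i) (Ici 0)) ∧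
      ContinuousOn vD (Ici 0) ∧
      (∀ t ∈ Ici (0:ℝ), (vD t).1 = ε * ‖xD' t‖) ∧
      (∀ t ∈ Ici (0:ℝ),
        xD' t 0 = (vD t).1 * Real.cos (sD t ⟨0, hn⟩) ∧
        xD' t 1 = (vD t).1 * Real.sin (sD t ⟨0, hn⟩)) ∧
      (∀ t ∈ Ici (0:ℝ), ∀ i : ℕ, ∀ h : i + 1 < n,
        HasDerivWithinAt (fun τ => sD τ ⟨i, by omega⟩)
          ((vD t).1 * sD t ⟨i + 1, h⟩) (Ici 0) t) ∧
      (∀ t ∈ Ici (0:ℝ),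
        HasDerivWithinAt (fun τ => sD τ ⟨n - 1, by omega⟩) ((vD t).2) (Ici 0) t) := by
  obtain ⟨c, hc, hcx⟩ := hinf
  have hne : ∀ t ∈ Ici (0 : ℝ), xD' t ≠ 0 := fun t ht =>
    norm_pos_iff.1 (hc.trans_le (hcx t ht))
  have hε₂ : ε ^ 2 = 1 := by rcases hε with rfl | rfl <;> norm_num
  have hε₀ : ε ≠ 0 := by rintro rfl; norm_num at hε₂
  set w : ℝ → ℝ := fun t => ε * ‖xD' t‖ with hw_def
  have hw : ∀ t ∈ Ici (0 : ℝ), w t ≠ 0 := fun t ht =>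
    mul_ne_zero hε₀ (norm_ne_zero_iff.2 (hne t ht))
  have hwd : ContDiffOn ℝ n w (Ici 0) := contDiffOn_const.mul (hxDsmooth.norm ℝ hne)
  have hcoord := contDiffOn_euclidean.1 hxDsmooth
  obtain ⟨θ, hθ, hangle⟩ := exists_contDiffOn_angle hn ((hcoord 0).div hwd hw)
    ((hcoord 1).div hwd hw) (fun t ht => by
      have h : w t ^ 2 = xD' t 0 ^ 2 + xD' t 1 ^ 2 := by
        simp [hw_def, mul_pow, hε₂, EuclideanSpace.norm_sq_eq, Fin.sum_univ_two]
      rw [Pi.div_apply, Pi.div_apply, div_pow, div_pow, ← add_div, ← h, div_self (pow_ne_zero 2 (hw t ht))])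
  have hs : ∀ k < n, ContDiffOn ℝ 1 (arcDeriv w θ k) (Ici 0) := fun k hk => by
    have hle : ((1 + k : ℕ) : WithTop ℕ∞) ≤ n := by
      exact_mod_cast (by omega : 1 + k ≤ n)
    exact_mod_cast contDiffOn_arcDeriv hw 1 k (hwd.of_le hle) (hθ.of_le hle)
  have hd : ∀ k < n, ∀ t ∈ Ici (0 : ℝ), HasDerivWithinAt (arcDeriv w θ k)
      (derivWithin (arcDeriv w θ k) (Ici 0) t) (Ici 0) t := fun k hk t ht =>
    ((hs k hk).differentiableOn one_ne_zero t ht).hasDerivWithinAt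
  refine ⟨fun t i => arcDeriv w θ i t,
    fun t => (w t, derivWithin (arcDeriv w θ (n - 1)) (Ici 0) t),
    fun i => (hs i i.2).continuousOn, ?_, fun t _ => rfl, fun t ht => ?_, fun t ht i h => ?_,
    hd (n - 1) (by omega)⟩
  · exact hwd.continuousOn.prodMk
      ((hs (n - 1) (by omega)).continuousOn_derivWithin (uniqueDiffOn_Ici 0) le_rfl)
  · obtain ⟨h₁, h₂⟩ := hangle t ht
    exact ⟨((div_eq_iff (hw t ht)).1 h₁).trans (mul_comm _ _),
      ((div_eq_iff (hw t ht)).1 h₂).trans (mul_comm _ _)⟩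
  · refine (hd i (by omega) t ht).congr_deriv ?_
    exact (mul_div_cancel₀ _ (hw t ht)).symm
end

section
/- Let x ∈ C²([0,∞), ℝ²) with |ẋ(t)| > 0 for all t ≥ 0, let ε ∈ {−1, 1}, and set v₁(t) = ε·|ẋ(t)|. Suppose s₁ : [0,∞) → ℝ is differentiable and satisfies the differential equation ṡ₁(t) = (ẍ₂(t) cos s₁(t) − ẍ₁(t) sin s₁(t)) / v₁(t) for all t ≥ 0, together with the initial compatibility condition ẋ(0) = v₁(0)·(cos s₁(0), sin s₁(0)). Then ẋ(t) = v₁(t)·(cos s₁(t), sin s₁(t)) for all t ≥ 0. -/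
/-- Differentiability of the norm of a nonvanishing curve in a Euclidean inner product space. -/
theorem hasDerivWithinAt_norm_of_ne_zero {E : Type*} [NormedAddCommGroup E]
    [InnerProductSpace ℝ E] {f : ℝ → E} {f' : E} {s : Set ℝ} {t : ℝ}
    (hf : HasDerivWithinAt f f' s t) (h0 : f t ≠ 0) :
    HasDerivWithinAt (fun u => ‖f u‖) (inner ℝ (f t) f' / ‖f t‖) s t := by
  have h := hf.norm_sq.sqrt (by simpa using h0)
  simp only [Real.sqrt_sq (norm_nonneg _)] at h
  convert h using 1
  field_simp

/-- The unit vector with heading angle `θ`. -/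
noncomputable def headingVec (θ : ℝ) : EuclideanSpace ℝ (Fin 2) :=
  !₂[Real.cos θ, Real.sin θ]

theorem norm_headingVec (θ : ℝ) : ‖headingVec θ‖ = 1 := by
  simp [headingVec, EuclideanSpace.norm_eq, Fin.sum_univ_two]

theorem hasDerivWithinAt_headingVec {θ : ℝ → ℝ} {θ' : ℝ} {s : Set ℝ} {t : ℝ}
    (h : HasDerivWithinAt θ θ' s t) :
    HasDerivWithinAt (fun u => headingVec (θ u))
      (θ' • !₂[-Real.sin (θ t), Real.cos (θ t)]) s t := by
  rw [hasDerivWithinAt_iff_hasFDerivWithinAt, hasFDerivWithinAt_euclidean]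
  intro i
  fin_cases i
  · refine h.cos.hasFDerivWithinAt.congr_fderiv ?_
    ext
    simp [mul_comm]
  · refine h.sin.hasFDerivWithinAt.congr_fderiv ?_
    ext
    simp [mul_comm]

open Set

/-- The heading-angle ODE, started compatibly, reconstructs the direction of the
velocity of a planar `C²` curve with nonvanishing velocity, for all time. -/
theorem stmt2
    (x x' x'' : ℝ → EuclideanSpace ℝ (Fin 2))
    -- `x` is `C²` on `[0,∞)` with first derivative `x'` and second derivative `x''`
    (hx' : ∀ t ∈ Ici (0:ℝ), HasDerivWithinAt x (x' t) (Ici 0) t)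
    (hx'' : ∀ t ∈ Ici (0:ℝ), HasDerivWithinAt x' (x'' t) (Ici 0) t)
    (hx''c : ContinuousOn x'' (Ici 0))
    -- `|ẋ(t)| > 0` for all `t ≥ 0`
    (hpos : ∀ t ∈ Ici (0:ℝ), 0 < ‖x' t‖)
    (ε : ℝ) (hε : ε = 1 ∨ ε = -1)
    (v₁ : ℝ → ℝ) (hv₁ : ∀ t, v₁ t = ε * ‖x' t‖)
    (s₁ : ℝ → ℝ)
    -- the heading-angle differential equation
    (hs₁ : ∀ t ∈ Ici (0:ℝ), HasDerivWithinAt s₁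
      ((x'' t 1 * Real.cos (s₁ t) - x'' t 0 * Real.sin (s₁ t)) / v₁ t) (Ici 0) t)
    -- initial compatibility condition
    (hinit : x' 0 0 = v₁ 0 * Real.cos (s₁ 0) ∧ x' 0 1 = v₁ 0 * Real.sin (s₁ 0)) :
    ∀ t ∈ Ici (0:ℝ),
      x' t 0 = v₁ t * Real.cos (s₁ t) ∧ x' t 1 = v₁ t * Real.sin (s₁ t) := by
  intro T hT
  have hx'c : ContinuousOn x' (Ici 0) := fun t ht => (hx'' t ht).continuousWithinAt
  have hε2 : ε * ε = 1 := by rcases hε with rfl | rfl <;> norm_num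
  have hεabs : |ε| = 1 := by rcases hε with rfl | rfl <;> norm_num
  have hv0 : ∀ t ∈ Ici (0:ℝ), v₁ t ≠ 0 := fun t ht h => by
    have h1 := hpos t ht
    rw [hv₁] at h
    rcases mul_eq_zero.1 h with h | h
    · simp [h] at hε2
    · exact h1.ne' h
  have hvabs : ∀ t, |v₁ t| = ‖x' t‖ := fun t => by
    rw [hv₁, abs_mul, hεabs, one_mul, abs_norm]
  have hv' : ∀ t ∈ Ici (0:ℝ),
      HasDerivWithinAt v₁ (inner ℝ (x' t) (x'' t) / v₁ t) (Ici 0) t := fun t ht => by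
    have h := (hasDerivWithinAt_norm_of_ne_zero (hx'' t ht) (norm_pos_iff.1 (hpos t ht))).const_mul ε
    rw [show v₁ = fun u => ε * ‖x' u‖ from funext hv₁]
    refine h.congr_deriv ?_
    have h1 := (hpos t ht).ne'
    have h2 : ε ≠ 0 := left_ne_zero_of_mul (hε2 ▸ one_ne_zero)
    field_simp
    linear_combination inner ℝ (x' t) (x'' t) * hε2
  set e : ℝ → EuclideanSpace ℝ (Fin 2) := fun t => x' t - v₁ t • headingVec (s₁ t) with he
  have he' : ∀ t ∈ Ici (0:ℝ), HasDerivWithinAt e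
      (-(inner ℝ (x'' t) (e t) / v₁ t) • headingVec (s₁ t)) (Ici 0) t := fun t ht => by
    have h := HasDerivWithinAt.sub (hx'' t ht)
      ((hv' t ht).smul (hasDerivWithinAt_headingVec (hs₁ t ht)))
    refine HasDerivWithinAt.congr_deriv h ?_
    have h1 := hv0 t ht
    have h2 := Real.sin_sq_add_cos_sq (s₁ t)
    ext i
    fin_cases i
    · simp [he, headingVec, PiLp.inner_apply, Fin.sum_univ_two]
      field_simp
      linear_combination (-x'' t 0 * v₁ t) * h2
    · simp [he, headingVec, PiLp.inner_apply, Fin.sum_univ_two]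
      field_simp
      linear_combination (-x'' t 1 * v₁ t) * h2
  have hsub : Icc 0 T ⊆ Ici (0:ℝ) := Icc_subset_Ici_self
  obtain ⟨K, hK⟩ := isCompact_Icc.exists_bound_of_continuousOn (s := Icc 0 T)
    (f := fun t => ‖x'' t‖ / ‖x' t‖)
    ((hx''c.norm.div hx'c.norm fun t ht => (hpos t ht).ne').mono hsub)
  have hzero : ∀ t ∈ Icc 0 T, e t = 0 := by
    refine eq_zero_of_abs_deriv_le_mul_abs_self_of_eq_zero_right (K := K)
      (f' := fun t => -(inner ℝ (x'' t) (e t) / v₁ t) • headingVec (s₁ t))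
      (fun t ht => ((he' t (hsub ht)).mono hsub).continuousWithinAt)
      (fun t ht => (he' t ht.1).mono (Ici_subset_Ici.2 ht.1)) ?_ ?_
    · ext i
      fin_cases i
      · simp [he, headingVec, hinit.1]
      · simp [he, headingVec, hinit.2]
    · intro t ht
      have h1 := hK t (Ico_subset_Icc_self ht)
      rw [Real.norm_of_nonneg (by positivity)] at h1
      rw [norm_smul, norm_headingVec, mul_one, norm_neg, norm_div, Real.norm_eq_abs (v₁ t), hvabs]
      calc ‖inner ℝ (x'' t) (e t)‖ / ‖x' t‖ ≤ ‖x'' t‖ * ‖e t‖ / ‖x' t‖ := by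
            gcongr
            exact norm_inner_le_norm _ _
        _ = ‖x'' t‖ / ‖x' t‖ * ‖e t‖ := by ring
        _ ≤ K * ‖e t‖ := by gcongr
  have h := sub_eq_zero.1 (hzero T ⟨hT, le_rfl⟩)
  exact ⟨by simp [h, headingVec], by simp [h, headingVec]⟩
end

section
/- Let k_z, k_p, k_r ≥ 1, let V : ℝ^{k_z} × ℝ^{k_p} × ℝ^{k_r} → ℝ be continuous and satisfy the positivity conditions (P1)–(P3), let α : ℝ^{k_z} × ℝ^{k_r} → ℝ be continuous with α(0, r) = 0 for all r ∈ ℝ^{k_r}, and let δ > 0. Define V̂ : ℝ^{k_z} × ℝ × ℝ^{k_p} × ℝ^{k_r} → ℝ by V̂(z, ζ, p, r) = V(z, p, r) + δ(ζ − α(z, r))²/2. Then V̂, viewed as a function of ẑ = (z, ζ) ∈ ℝ^{k_z+1} and (p, r), satisfies the positivity conditions (P1)–(P3) with ẑ in place of z; that is: V̂(0, 0, p, r) = 0 for all p, r; V̂(z, ζ, p, r) > 0 whenever (z, ζ) ≠ 0; and for all ε > 0 and E > 0, inf{ V̂(z, ζ, p, r) : |(z, ζ)| > ε, max(|p|, |r|)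 < E } > 0. -/
open Set

/-- A continuous function vanishing on `{0} × Y` is uniformly small near `0`, over compact sets. -/
theorem exists_abs_lt_of_isCompact {X Y : Type*} [SeminormedAddCommGroup X] [TopologicalSpace Y]
    {α : X → Y → ℝ} (hα : Continuous fun x : X × Y => α x.1 x.2) (hα0 : ∀ r, α 0 r = 0)
    {K : Set Y} (hK : IsCompact K) {η : ℝ} (hη : 0 < η) :
    ∃ ρ > 0, ∀ z r, ‖z‖ < ρ → r ∈ K → |α z r| < η := by
  have h : ∀ᶠ z in nhds (0 : X), ∀ r ∈ K, |α z r| < η := by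
    refine hK.eventually_forall_of_forall_eventually fun r _ => ?_
    exact hα.abs.continuousAt.eventually_lt continuousAt_const (by simpa [hα0] using hη)
  obtain ⟨ρ, hρ, hball⟩ := Metric.eventually_nhds_iff.1 h
  exact ⟨ρ, hρ, fun z r hz hr => hball (by simpa using hz) r hr⟩

/-- The augmented Lyapunov function `V̂(z,ζ,p,r) = V(z,p,r) + δ(ζ − α(z,r))²/2`
inherits the positivity conditions (P1)–(P3), with `ẑ = (z,ζ)` in place of `z`. -/
theorem stmt3 {kz kp kr : ℕ} (hkz : 1 ≤ kz) (hkp : 1 ≤ kp) (hkr : 1 ≤ kr)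
    (V : EuclideanSpace ℝ (Fin kz) → EuclideanSpace ℝ (Fin kp) →
      EuclideanSpace ℝ (Fin kr) → ℝ)
    (hVc : Continuous fun x : EuclideanSpace ℝ (Fin kz) × EuclideanSpace ℝ (Fin kp) ×
      EuclideanSpace ℝ (Fin kr) => V x.1 x.2.1 x.2.2)
    -- (P1)
    (hP1 : ∀ p r, V 0 p r = 0)
    -- (P2)
    (hP2 : ∀ z p r, z ≠ 0 → 0 < V z p r)
    -- (P3)
    (hP3 : ∀ εa Ea : ℝ, 0 < εa → 0 < Ea → ∃ c > 0, ∀ z p r,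
      εa < ‖z‖ → max ‖p‖ ‖r‖ < Ea → c ≤ V z p r)
    (α : EuclideanSpace ℝ (Fin kz) → EuclideanSpace ℝ (Fin kr) → ℝ)
    (hαc : Continuous fun x : EuclideanSpace ℝ (Fin kz) × EuclideanSpace ℝ (Fin kr) =>
      α x.1 x.2)
    (hα0 : ∀ r, α 0 r = 0)
    (δ : ℝ) (hδ : 0 < δ)
    (Vhat : EuclideanSpace ℝ (Fin kz) → ℝ → EuclideanSpace ℝ (Fin kp) →
      EuclideanSpace ℝ (Fin kr) → ℝ)
    (hVhat : ∀ z ζ p r, Vhat z ζ p r = V z p r + δ * (ζ - α z r) ^ 2 / 2) :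
    -- (P1) for `V̂`
    (∀ p r, Vhat 0 0 p r = 0) ∧
    -- (P2) for `V̂`
    (∀ z ζ p r, ¬(z = 0 ∧ ζ = 0) → 0 < Vhat z ζ p r) ∧
    -- (P3) for `V̂`, with `|ẑ| = √(|z|² + ζ²)` the Euclidean norm of `(z, ζ)`
    (∀ εa Ea : ℝ, 0 < εa → 0 < Ea → ∃ c > 0, ∀ z ζ p r,
      εa < Real.sqrt (‖z‖ ^ 2 + ζ ^ 2) → max ‖p‖ ‖r‖ < Ea → c ≤ Vhat z ζ p r) := by
  have hV0 : ∀ z p r, 0 ≤ V z p r := by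
    intro z p r
    rcases eq_or_ne z 0 with rfl | hz
    · exact (hP1 p r).ge
    · exact (hP2 z p r hz).le
  refine ⟨fun p r => by simp [hVhat, hP1, hα0], fun z ζ p r h => ?_, fun ε E hε hE => ?_⟩
  · rw [hVhat]
    rcases eq_or_ne z 0 with rfl | hz
    · have hζ : ζ ≠ 0 := fun hζ => h ⟨rfl, hζ⟩
      rw [hP1, hα0, sub_zero, zero_add]
      positivity
    · have := hP2 z p r hz
      positivity
  · obtain ⟨ρ, hρ, hα⟩ := exists_abs_lt_of_isCompact hαc hα0
      (isCompact_closedBall (0 : EuclideanSpace ℝ (Fin kr)) E) (show 0 < ε / 4 by positivity)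
    obtain ⟨c, hc, hV⟩ := hP3 (min (ρ / 2) (ε / 2)) E (by positivity) hE
    refine ⟨min c (δ * (ε / 4) ^ 2 / 2), by positivity, fun z ζ p r hz hpr => ?_⟩
    rw [hVhat]
    rcases lt_or_ge (min (ρ / 2) (ε / 2)) ‖z‖ with hlarge | hsmall
    · refine (min_le_left _ _).trans ?_
      have := hV z p r hlarge hpr
      have : 0 ≤ δ * (ζ - α z r) ^ 2 / 2 := by positivity
      linarith
    · refine (min_le_right _ _).trans ?_
      obtain ⟨hzρ, hzε⟩ := le_min_iff.1 hsmall
      have hαz : |α z r| < ε / 4 :=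
        hα z r (by linarith) (by simpa using ((le_max_right _ _).trans_lt hpr).le)
      have hsq : ε ^ 2 < ‖z‖ ^ 2 + ζ ^ 2 := (Real.lt_sqrt hε.le).1 hz
      have hζ : ε / 2 < |ζ| := by
        refine lt_of_pow_lt_pow_left₀ 2 (abs_nonneg ζ) ?_
        have : ‖z‖ ^ 2 ≤ (ε / 2) ^ 2 := by gcongr
        rw [sq_abs]
        nlinarith
      have hdiff : ε / 4 ≤ |ζ - α z r| := by
        linarith [abs_sub_abs_le_abs_sub ζ (α z r)]
      have hsqdiff : (ε / 4) ^ 2 ≤ (ζ - α z r) ^ 2 := by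
        rw [← sq_abs (ζ - α z r)]
        gcongr
      have : δ * (ε / 4) ^ 2 / 2 ≤ δ * (ζ - α z r) ^ 2 / 2 := by gcongr
      linarith [hV0 z p r]
end

section
/- Let k_z, k_p, k_r ≥ 1 and γ, δ > 0. Let B : ℝ^{k_z} × ℝ × ℝ^{k_p} → ℝ^{k_z} be continuous with continuous partial derivative ∂B/∂ζ in its scalar argument ζ; let b, β : ℝ^{k_z} × ℝ × ℝ^{k_p} → ℝ be continuous with β(z, ζ, p) ≠ 0 everywhere; let V : ℝ^{k_z} × ℝ^{k_p} × ℝ^{k_r} → ℝ and α : ℝ^{k_z} × ℝ^{k_r} → ℝ be C¹; and let p ∈ C¹([0,∞), ℝ^{k_p}), r ∈ C¹([0,∞), ℝ^{k_r}). Suppose that for every τ ≥ 0 and every z ∈ ℝ^{k_z}: (∂V/∂z)(z, p(τ), r(τ))·B(z, α(z, r(τ)), p(τ)) + (∂V/∂p)(z, p(τ), r(τ))·p'(τ) + (∂V/∂r)(z, p(τ), r(τ))·r'(τ) ≤ −2γ V(z, p(τ), r(τ)). Then for every C¹ solution (z, ζ) : [0,∞) → ℝ^{k_z} × ℝ of the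 closed-loop system z'(τ) = B(z(τ), ζ(τ), p(τ)), ζ'(τ) = b(z(τ), ζ(τ), p(τ)) + β(z(τ), ζ(τ), p(τ))·α̂(z(τ), ζ(τ), p(τ), r(τ), r'(τ)), the function g(τ) = V̂(z(τ), ζ(τ), p(τ), r(τ)) is differentiable and satisfies g'(τ) ≤ −2γ g(τ) for all τ ≥ 0. -/
open Set

section PartialDerivatives

variable {E F G H : Type*} [NormedAddCommGroup E] [NormedSpace ℝ E]
  [NormedAddCommGroup F] [NormedSpace ℝ F] [NormedAddCommGroup G] [NormedSpace ℝ G]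
  [NormedAddCommGroup H] [NormedSpace ℝ H]

/-- Chain rule along a curve for a function of two vector variables, in terms of partial
Fréchet derivatives. -/
theorem hasDerivWithinAt_comp_partial₂ {f : E → F → H} {x : ℝ → E} {y : ℝ → F}
    {x' : E} {y' : F} {s : Set ℝ} {t : ℝ}
    (hf : DifferentiableAt ℝ (fun w : E × F => f w.1 w.2) (x t, y t))
    (hx : HasDerivWithinAt x x' s t) (hy : HasDerivWithinAt y y' s t) :
    HasDerivWithinAt (fun σ => f (x σ) (y σ))
      (fderiv ℝ (fun u => f u (y t)) (x t) x' + fderiv ℝ (fun v => f (x t) v) (y t) y') s t := by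
  have h := hf.hasFDerivAt
  have h₁ : HasFDerivAt (fun u => f u (y t)) _ (x t) :=
    HasFDerivAt.comp (f := fun u => (u, y t)) (x t) h (hasFDerivAt_prodMk_left (x t) (y t))
  have h₂ : HasFDerivAt (fun v => f (x t) v) _ (y t) :=
    HasFDerivAt.comp (f := fun v => (x t, v)) (y t) h (hasFDerivAt_prodMk_right (x t) (y t))
  rw [h₁.fderiv, h₂.fderiv]
  have hc := h.comp_hasDerivWithinAt (f := fun σ => (x σ, y σ)) t (hx.prodMk hy)
  refine hc.congr_deriv ?_
  simp [← map_add]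

/-- Chain rule along a curve for a function of three vector variables, in terms of partial
Fréchet derivatives. -/
theorem hasDerivWithinAt_comp_partial₃ {f : E → F → G → H} {x : ℝ → E} {y : ℝ → F} {w : ℝ → G}
    {x' : E} {y' : F} {w' : G} {s : Set ℝ} {t : ℝ}
    (hf : DifferentiableAt ℝ (fun v : E × F × G => f v.1 v.2.1 v.2.2) (x t, y t, w t))
    (hx : HasDerivWithinAt x x' s t) (hy : HasDerivWithinAt y y' s t)
    (hw : HasDerivWithinAt w w' s t) :
    HasDerivWithinAt (fun σ => f (x σ) (y σ) (w σ))
      (fderiv ℝ (fun u => f u (y t) (w t)) (x t) x' +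
        fderiv ℝ (fun v => f (x t) v (w t)) (y t) y' +
        fderiv ℝ (fun v => f (x t) (y t) v) (w t) w') s t := by
  have hg : DifferentiableAt ℝ (fun v : F × G => f (x t) v.1 v.2) (y t, w t) :=
    DifferentiableAt.comp (f := fun v : F × G => (x t, v)) (y t, w t) hf (by fun_prop)
  have h₁ := hasDerivWithinAt_comp_partial₂ (f := fun u (v : F × G) => f u v.1 v.2)
    (y := fun σ => (y σ, w σ)) hf hx (hy.prodMk hw)
  have hg' := hg.hasFDerivAt
  have hy₁ : HasFDerivAt (fun v => f (x t) v (w t)) _ (y t) :=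
    HasFDerivAt.comp (f := fun v => (v, w t)) (y t) hg' (hasFDerivAt_prodMk_left (y t) (w t))
  have hw₁ : HasFDerivAt (fun v => f (x t) (y t) v) _ (w t) :=
    HasFDerivAt.comp (f := fun v => (y t, v)) (w t) hg' (hasFDerivAt_prodMk_right (y t) (w t))
  refine h₁.congr_deriv ?_
  rw [hy₁.fderiv, hw₁.fderiv, add_assoc]
  simp [← map_add]

end PartialDerivatives

/-- One step of backstepping: if `V` decays at rate `2γ` along the `z`-subsystem with
virtual control `ζ = α(z, r(τ))`, then the augmented Lyapunov function
`V̂ = V + δ(ζ − α)²/2` decays at rate `2γ` along the closed-loop `(z, ζ)`-system with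
the backstepping feedback `α̂`. -/
theorem stmt5 {kz kp kr : ℕ} (hkz : 1 ≤ kz) (hkp : 1 ≤ kp) (hkr : 1 ≤ kr)
    (γ δ : ℝ) (hγ : 0 < γ) (hδ : 0 < δ)
    (B Bζ : EuclideanSpace ℝ (Fin kz) → ℝ → EuclideanSpace ℝ (Fin kp) →
      EuclideanSpace ℝ (Fin kz))
    (hBc : Continuous fun x : EuclideanSpace ℝ (Fin kz) × ℝ × EuclideanSpace ℝ (Fin kp) =>
      B x.1 x.2.1 x.2.2)
    (hBζ : ∀ z ζ p, HasDerivAt (fun ξ => B z ξ p) (Bζ z ζ p) ζ)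
    (hBζc : Continuous fun x : EuclideanSpace ℝ (Fin kz) × ℝ × EuclideanSpace ℝ (Fin kp) =>
      Bζ x.1 x.2.1 x.2.2)
    (b β : EuclideanSpace ℝ (Fin kz) → ℝ → EuclideanSpace ℝ (Fin kp) → ℝ)
    (hbc : Continuous fun x : EuclideanSpace ℝ (Fin kz) × ℝ × EuclideanSpace ℝ (Fin kp) =>
      b x.1 x.2.1 x.2.2)
    (hβc : Continuous fun x : EuclideanSpace ℝ (Fin kz) × ℝ × EuclideanSpace ℝ (Fin kp) =>
      β x.1 x.2.1 x.2.2)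
    (hβne : ∀ z ζ p, β z ζ p ≠ 0)
    (V : EuclideanSpace ℝ (Fin kz) → EuclideanSpace ℝ (Fin kp) →
      EuclideanSpace ℝ (Fin kr) → ℝ)
    (hV : ContDiff ℝ 1 fun x : EuclideanSpace ℝ (Fin kz) × EuclideanSpace ℝ (Fin kp) ×
      EuclideanSpace ℝ (Fin kr) => V x.1 x.2.1 x.2.2)
    (α : EuclideanSpace ℝ (Fin kz) → EuclideanSpace ℝ (Fin kr) → ℝ)
    (hα : ContDiff ℝ 1 fun x : EuclideanSpace ℝ (Fin kz) × EuclideanSpace ℝ (Fin kr) =>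
      α x.1 x.2)
    (p p' : ℝ → EuclideanSpace ℝ (Fin kp)) (r r' : ℝ → EuclideanSpace ℝ (Fin kr))
    (hp : ∀ τ ∈ Ici (0:ℝ), HasDerivWithinAt p (p' τ) (Ici 0) τ)
    (hp' : ContinuousOn p' (Ici 0))
    (hr : ∀ τ ∈ Ici (0:ℝ), HasDerivWithinAt r (r' τ) (Ici 0) τ)
    (hr' : ContinuousOn r' (Ici 0))
    -- the Lyapunov decay hypothesis for the `z`-subsystem with `ζ = α(z, r(τ))`
    (hLyap : ∀ τ ∈ Ici (0:ℝ), ∀ z,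
      fderiv ℝ (fun z' => V z' (p τ) (r τ)) z (B z (α z (r τ)) (p τ)) +
      fderiv ℝ (fun q => V z q (r τ)) (p τ) (p' τ) +
      fderiv ℝ (fun q => V z (p τ) q) (r τ) (r' τ) ≤ -(2 * γ) * V z (p τ) (r τ))
    -- the extended difference quotient `D`
    (D : EuclideanSpace ℝ (Fin kz) → ℝ → ℝ → EuclideanSpace ℝ (Fin kp) →
      EuclideanSpace ℝ (Fin kz))
    (hD : ∀ z ζ η q, D z ζ η q =
      if ζ = η then Bζ z ζ q else (ζ - η)⁻¹ • (B z ζ q - B z η q))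
    -- the backstepping feedback `α̂`
    (αhat : EuclideanSpace ℝ (Fin kz) → ℝ → EuclideanSpace ℝ (Fin kp) →
      EuclideanSpace ℝ (Fin kr) → EuclideanSpace ℝ (Fin kr) → ℝ)
    (hαhat : ∀ z ζ q ρ ρ₁, αhat z ζ q ρ ρ₁ = (β z ζ q)⁻¹ *
      (fderiv ℝ (fun z' => α z' ρ) z (B z ζ q) + fderiv ℝ (fun ρ' => α z ρ') ρ ρ₁
        - δ⁻¹ * fderiv ℝ (fun z' => V z' q ρ) z (D z ζ (α z ρ) q)
        - b z ζ q - γ * (ζ - α z ρ)))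
    -- the augmented Lyapunov function `V̂`
    (Vhat : EuclideanSpace ℝ (Fin kz) → ℝ → EuclideanSpace ℝ (Fin kp) →
      EuclideanSpace ℝ (Fin kr) → ℝ)
    (hVhat : ∀ z ζ q ρ, Vhat z ζ q ρ = V z q ρ + δ * (ζ - α z ρ) ^ 2 / 2)
    -- a `C¹` solution of the closed-loop system
    (z : ℝ → EuclideanSpace ℝ (Fin kz)) (ζ : ℝ → ℝ)
    (hz : ∀ τ ∈ Ici (0:ℝ), HasDerivWithinAt z (B (z τ) (ζ τ) (p τ)) (Ici 0) τ)
    (hζ : ∀ τ ∈ Ici (0:ℝ), HasDerivWithinAt ζ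
      (b (z τ) (ζ τ) (p τ) +
        β (z τ) (ζ τ) (p τ) * αhat (z τ) (ζ τ) (p τ) (r τ) (r' τ)) (Ici 0) τ) :
    ∀ τ ∈ Ici (0:ℝ), ∃ g',
      HasDerivWithinAt (fun σ => Vhat (z σ) (ζ σ) (p σ) (r σ)) g' (Ici 0) τ ∧
      g' ≤ -(2 * γ) * Vhat (z τ) (ζ τ) (p τ) (r τ) := by
  intro τ hτ
  have hVd := hasDerivWithinAt_comp_partial₃ (f := V)
    ((hV.differentiable one_ne_zero) _) (hz τ hτ) (hp τ hτ) (hr τ hτ)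
  have hαd := hasDerivWithinAt_comp_partial₂ (f := α)
    ((hα.differentiable one_ne_zero) _) (hz τ hτ) (hr τ hτ)
  have hquad := ((((hζ τ hτ).sub hαd).pow 2).const_mul δ).div_const 2
  have hfun : (fun σ => Vhat (z σ) (ζ σ) (p σ) (r σ)) =
      fun σ => V (z σ) (p σ) (r σ) + δ * (ζ σ - α (z σ) (r σ)) ^ 2 / 2 :=
    funext fun σ => hVhat _ _ _ _
  rw [hfun]
  refine ⟨_, hVd.add hquad, ?_⟩
  have hmulD : (ζ τ - α (z τ) (r τ)) • D (z τ) (ζ τ) (α (z τ) (r τ)) (p τ) =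
      B (z τ) (ζ τ) (p τ) - B (z τ) (α (z τ) (r τ)) (p τ) := by
    rw [hD]
    split_ifs with h
    · simp [← h]
    · rw [smul_inv_smul₀ (sub_ne_zero.mpr h)]
  have hVD := congrArg (fderiv ℝ (fun z' => V z' (p τ) (r τ)) (z τ)) hmulD
  rw [map_smul, map_sub, smul_eq_mul] at hVD
  have hL := hLyap τ hτ (z τ)
  rw [hVhat, hαhat, mul_inv_cancel_left₀ (hβne _ _ _)]
  have hδD := mul_inv_cancel_left₀ hδ.ne'
    (fderiv ℝ (fun z' => V z' (p τ) (r τ)) (z τ) (D (z τ) (ζ τ) (α (z τ) (r τ)) (p τ)))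
  simp only [Pi.sub_apply, Nat.cast_ofNat, Nat.add_one_sub_one, pow_one]
  linear_combination hL - hVD - (ζ τ - α (z τ) (r τ)) * hδD
end

section
/- Let k_z, k_p, k_r ≥ 1 and γ, δ > 0. Let B : ℝ^{k_z} × ℝ × ℝ^{k_p} → ℝ^{k_z} be continuous with continuous partial derivative ∂B/∂ζ; let b, β : ℝ^{k_z} × ℝ × ℝ^{k_p} → ℝ be continuous with β nowhere zero; let α : ℝ^{k_z} × ℝ^{k_r} → ℝ be C¹ with α(0, r) = 0 for all r; let V : ℝ^{k_z} × ℝ^{k_p} × ℝ^{k_r} → ℝ be C¹ with V(0, p, r) = 0 and V(z, p, r) ≥ 0 for all z, p, r. Suppose B(0, 0, p) = 0 and b(0, 0, p) = 0 for all p ∈ ℝ^{k_p}. Then the backstepping feedback α̂ satisfies α̂(0, 0, p, r, r₁) = 0 for all p ∈ ℝ^{k_p} and r, r₁ ∈ ℝ^{k_r}. -/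
open Set

/-- The backstepping feedback `α̂` vanishes at the origin: if `B(0,0,p) = 0` and
`b(0,0,p) = 0` for all `p`, then `α̂(0, 0, p, r, r₁) = 0` for all `p, r, r₁`. -/
theorem stmt7 {kz kp kr : ℕ} (hkz : 1 ≤ kz) (hkp : 1 ≤ kp) (hkr : 1 ≤ kr)
    (γ δ : ℝ) (hγ : 0 < γ) (hδ : 0 < δ)
    (B Bζ : EuclideanSpace ℝ (Fin kz) → ℝ → EuclideanSpace ℝ (Fin kp) →
      EuclideanSpace ℝ (Fin kz))
    (hBc : Continuous fun x : EuclideanSpace ℝ (Fin kz) × ℝ × EuclideanSpace ℝ (Fin kp) =>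
      B x.1 x.2.1 x.2.2)
    (hBζ : ∀ z ζ p, HasDerivAt (fun ξ => B z ξ p) (Bζ z ζ p) ζ)
    (hBζc : Continuous fun x : EuclideanSpace ℝ (Fin kz) × ℝ × EuclideanSpace ℝ (Fin kp) =>
      Bζ x.1 x.2.1 x.2.2)
    (b β : EuclideanSpace ℝ (Fin kz) → ℝ → EuclideanSpace ℝ (Fin kp) → ℝ)
    (hbc : Continuous fun x : EuclideanSpace ℝ (Fin kz) × ℝ × EuclideanSpace ℝ (Fin kp) =>
      b x.1 x.2.1 x.2.2)
    (hβc : Continuous fun x : EuclideanSpace ℝ (Fin kz) × ℝ × EuclideanSpace ℝ (Fin kp) =>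
      β x.1 x.2.1 x.2.2)
    (hβne : ∀ z ζ p, β z ζ p ≠ 0)
    (α : EuclideanSpace ℝ (Fin kz) → EuclideanSpace ℝ (Fin kr) → ℝ)
    (hα : ContDiff ℝ 1 fun x : EuclideanSpace ℝ (Fin kz) × EuclideanSpace ℝ (Fin kr) =>
      α x.1 x.2)
    (hα0 : ∀ r, α 0 r = 0)
    (V : EuclideanSpace ℝ (Fin kz) → EuclideanSpace ℝ (Fin kp) →
      EuclideanSpace ℝ (Fin kr) → ℝ)
    (hV : ContDiff ℝ 1 fun x : EuclideanSpace ℝ (Fin kz) × EuclideanSpace ℝ (Fin kp) ×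
      EuclideanSpace ℝ (Fin kr) => V x.1 x.2.1 x.2.2)
    (hV0 : ∀ p r, V 0 p r = 0)
    (hVnn : ∀ z p r, 0 ≤ V z p r)
    -- `B(0,0,p) = 0` and `b(0,0,p) = 0`
    (hB0 : ∀ p, B 0 0 p = 0)
    (hb0 : ∀ p, b 0 0 p = 0)
    -- the extended difference quotient `D`
    (D : EuclideanSpace ℝ (Fin kz) → ℝ → ℝ → EuclideanSpace ℝ (Fin kp) →
      EuclideanSpace ℝ (Fin kz))
    (hD : ∀ z ζ η q, D z ζ η q =
      if ζ = η then Bζ z ζ q else (ζ - η)⁻¹ • (B z ζ q - B z η q))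
    -- the backstepping feedback `α̂`
    (αhat : EuclideanSpace ℝ (Fin kz) → ℝ → EuclideanSpace ℝ (Fin kp) →
      EuclideanSpace ℝ (Fin kr) → EuclideanSpace ℝ (Fin kr) → ℝ)
    (hαhat : ∀ z ζ q ρ ρ₁, αhat z ζ q ρ ρ₁ = (β z ζ q)⁻¹ *
      (fderiv ℝ (fun z' => α z' ρ) z (B z ζ q) + fderiv ℝ (fun ρ' => α z ρ') ρ ρ₁
        - δ⁻¹ * fderiv ℝ (fun z' => V z' q ρ) z (D z ζ (α z ρ) q)
        - b z ζ q - γ * (ζ - α z ρ))) :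
    ∀ (p : EuclideanSpace ℝ (Fin kp)) (r r₁ : EuclideanSpace ℝ (Fin kr)),
      αhat 0 0 p r r₁ = 0 := by
  intro p r r₁
  have hVfderiv : fderiv ℝ (fun z' => V z' p r) 0 = 0 := by
    apply IsLocalMin.fderiv_eq_zero
    exact Filter.Eventually.of_forall fun z => by simpa only [hV0] using hVnn z p r
  have hαfderiv : fderiv ℝ (fun ρ' => α 0 ρ') r = 0 := by
    simp only [hα0, fderiv_fun_const, Pi.zero_apply]
  rw [hαhat, hVfderiv, hαfderiv, hB0, hb0, hα0]
  simp
end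

section
/- Let γ > 0 and define e : ℝ² → ℝ² by e(ξ) = −(tanh(γ|ξ|)/|ξ|)·ξ for ξ ≠ 0 and e(0) = 0, and V₀ : ℝ² → ℝ by V₀(ξ) = sinh²(γ|ξ|). If x : [0,∞) → ℝ² is differentiable and satisfies x'(τ) = e(x(τ)) for all τ ≥ 0, then V₀(x(τ)) = V₀(x(0))·exp(−2γτ) for all τ ≥ 0; in particular x(τ) → 0 as τ → ∞. -/
open Set Filter

/-- If the velocity of `x` is the radial vector field of profile `-φ(|ξ|)`, with `φ 0 = 0`,
then `|x|` is differentiable, also at the zeros of `x`, and satisfies `|x|' = -φ(|x|)`. -/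
theorem HasDerivWithinAt.norm_of_radial {E : Type*} [NormedAddCommGroup E]
    [InnerProductSpace ℝ E] {φ : ℝ → ℝ} (hφ : φ 0 = 0) {x : ℝ → E} {v : E} {s : Set ℝ} {t : ℝ}
    (hx : HasDerivWithinAt x v s t) (hv : v = -(φ ‖x t‖ / ‖x t‖) • x t) :
    HasDerivWithinAt (fun τ => ‖x τ‖) (-φ ‖x t‖) s t := by
  by_cases h : x t = 0
  · have hv0 : v = 0 := by simp [hv, h]
    rw [hasDerivWithinAt_iff_isLittleO] at hx ⊢
    simpa [h, hφ, hv0] using hx.norm_left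
  · have hn : ‖x t‖ ≠ 0 := norm_ne_zero_iff.mpr h
    have hsqrt := hx.norm_sq.sqrt (pow_ne_zero 2 hn)
    simp only [Real.sqrt_sq (norm_nonneg _)] at hsqrt
    convert hsqrt using 1
    rw [hv, real_inner_smul_right, real_inner_self_eq_norm_sq]
    field_simp

theorem eqOn_exp_of_hasDerivWithinAt_Ici {f : ℝ → ℝ} {c : ℝ}
    (hf : ∀ t ∈ Ici (0 : ℝ), HasDerivWithinAt f (c * f t) (Ici 0) t) :
    EqOn f (fun t => f 0 * Real.exp (c * t)) (Ici 0) := by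
  intro t ht
  have hg : ∀ τ ∈ Ici (0 : ℝ),
      HasDerivWithinAt (fun τ => f τ * Real.exp (-(c * τ))) 0 (Ici 0) τ := by
    intro τ hτ
    have hexp := ((hasDerivAt_id τ).const_mul c).neg.exp.hasDerivWithinAt (s := Ici 0)
    refine ((hf τ hτ).mul hexp).congr_deriv ?_
    simp only [Pi.neg_apply, id_eq]
    ring
  have hconst := constant_of_has_deriv_right_zero (a := 0) (b := t)
    (fun τ hτ => ((hg τ hτ.1).continuousWithinAt).mono Icc_subset_Ici_self)
    (fun τ hτ => (hg τ hτ.1).mono (Ici_subset_Ici.mpr hτ.1)) t ⟨ht, le_rfl⟩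
  simp only [mul_zero, neg_zero, Real.exp_zero, mul_one] at hconst
  simp only [← hconst, mul_assoc, ← Real.exp_add, neg_add_cancel, Real.exp_zero, mul_one]

/-- Exact exponential decay of the Lyapunov function `V₀(ξ) = sinh²(γ|ξ|)` along
solutions of `x' = e(x)`, where `e(ξ) = −(tanh(γ|ξ|)/|ξ|)·ξ`; in particular the
solution converges to the origin. -/
theorem stmt9 (γ : ℝ) (hγ : 0 < γ)
    (e : EuclideanSpace ℝ (Fin 2) → EuclideanSpace ℝ (Fin 2))
    (he : ∀ ξ, ξ ≠ 0 → e ξ = -(Real.tanh (γ * ‖ξ‖) / ‖ξ‖) • ξ)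
    (he0 : e 0 = 0)
    (V₀ : EuclideanSpace ℝ (Fin 2) → ℝ)
    (hV₀ : ∀ ξ, V₀ ξ = Real.sinh (γ * ‖ξ‖) ^ 2)
    (x : ℝ → EuclideanSpace ℝ (Fin 2))
    (hx : ∀ τ ∈ Ici (0:ℝ), HasDerivWithinAt x (e (x τ)) (Ici 0) τ) :
    (∀ τ ∈ Ici (0:ℝ), V₀ (x τ) = V₀ (x 0) * Real.exp (-(2 * γ) * τ)) ∧
    Tendsto x atTop (nhds 0) := by
  have he' : ∀ ξ, e ξ = -(Real.tanh (γ * ‖ξ‖) / ‖ξ‖) • ξ := by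
    intro ξ
    by_cases h : ξ = 0
    · simp [h, he0]
    · exact he ξ h
  have hderiv : ∀ τ ∈ Ici (0 : ℝ),
      HasDerivWithinAt (fun t => V₀ (x t)) (-(2 * γ) * V₀ (x τ)) (Ici 0) τ := by
    intro τ hτ
    have hr := (hx τ hτ).norm_of_radial (φ := fun r => Real.tanh (γ * r)) (by simp) (he' _)
    simp only [hV₀]
    refine ((hr.const_mul γ).sinh.pow 2).congr_deriv ?_
    rw [Real.tanh_eq_sinh_div_cosh]
    have := (Real.cosh_pos (γ * ‖x τ‖)).ne'
    field_simp
    ring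
  have hV : ∀ τ ∈ Ici (0 : ℝ), V₀ (x τ) = V₀ (x 0) * Real.exp (-(2 * γ) * τ) :=
    eqOn_exp_of_hasDerivWithinAt_Ici hderiv
  refine ⟨hV, ?_⟩
  have hlim : Tendsto (fun τ => V₀ (x 0) * Real.exp (-(2 * γ) * τ)) atTop (nhds 0) := by
    have := (Real.tendsto_exp_atBot.comp
      (tendsto_id.const_mul_atTop_of_neg (show -(2 * γ) < 0 by linarith))).const_mul (V₀ (x 0))
    simpa using this
  have hsqrt := (hlim.sqrt).div_const γ
  rw [Real.sqrt_zero, zero_div] at hsqrt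
  refine squeeze_zero_norm' ?_ hsqrt
  filter_upwards [eventually_ge_atTop 0] with τ hτ
  have hnonneg : 0 ≤ γ * ‖x τ‖ := by positivity
  rw [← hV τ hτ, hV₀, Real.sqrt_sq (Real.sinh_nonneg_iff.mpr hnonneg), le_div_iff₀ hγ, mul_comm]
  exact Real.self_le_sinh_iff.mpr hnonneg
end

section
/- Let γ > 0, s̄₁ ∈ ℝ, w̄₁ ∈ {−1, 1}, and let e ∈ ℝ² with |e| < 1. Let G(θ) denote the rotation matrix [[cos θ, −sin θ], [sin θ, cos θ]], and set c = G(s̄₁)⁻¹ e + w̄₁·(1, 0). Then w̄₁·c₁ > 0 (in particular c₁ ≠ 0 and sign c₁ = w̄₁); and defining w₁ = w̄₁·|c| and s̃₁ = arctan(c₂/c₁), one has |s̃₁| < π/2, w₁·(cos s̃₁, sin s̃₁) = c, and −w̄₁·(cos s̄₁, sin s̄₁) + w₁·G(s̄₁)·(cos s̃₁, sin s̃₁) = e. -/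
/-- The polar form of a point of the open right or left half-plane, with angle `arctan (y / x)`
and with the radius carrying the sign `σ` of `x`. -/
theorem signed_polar_arctan {σ x y : ℝ} (hσ : σ ^ 2 = 1) (hx : 0 < σ * x) :
    σ * Real.sqrt (x ^ 2 + y ^ 2) * Real.cos (Real.arctan (y / x)) = x ∧
      σ * Real.sqrt (x ^ 2 + y ^ 2) * Real.sin (Real.arctan (y / x)) = y := by
  have hx0 : x ≠ 0 := right_ne_zero_of_mul hx.ne'
  have hpos : 0 < Real.sqrt (1 + (y / x) ^ 2) := Real.sqrt_pos.mpr (by positivity)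
  have hsqrt : Real.sqrt (x ^ 2 + y ^ 2) = σ * x * Real.sqrt (1 + (y / x) ^ 2) := by
    have hsq : x ^ 2 + y ^ 2 = (σ * x) ^ 2 * (1 + (y / x) ^ 2) := by
      rw [mul_pow, hσ]
      field_simp
    rw [hsq, Real.sqrt_mul (sq_nonneg _), Real.sqrt_sq hx.le]
  have hcos : σ * Real.sqrt (x ^ 2 + y ^ 2) * Real.cos (Real.arctan (y / x)) = x := by
    rw [hsqrt, Real.cos_arctan]
    calc σ * (σ * x * Real.sqrt (1 + (y / x) ^ 2)) * (1 / Real.sqrt (1 + (y / x) ^ 2))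
        = σ ^ 2 * x * (Real.sqrt (1 + (y / x) ^ 2) / Real.sqrt (1 + (y / x) ^ 2)) := by ring
      _ = x := by rw [hσ, div_self hpos.ne', one_mul, mul_one]
  refine ⟨hcos, ?_⟩
  have hsin := Real.tan_mul_cos (Real.cos_arctan_pos (y / x)).ne'
  rw [Real.tan_arctan] at hsin
  rw [← hsin, mul_left_comm, hcos, div_mul_cancel₀ y hx0]

/-- Algebraic solvability of the position-subsystem feedback equation: given `|e| < 1`,
setting `c = G(s̄₁)⁻¹ e + w̄₁·(1,0)`, one has `w̄₁ c₁ > 0`, and the explicit choices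
`w₁ = w̄₁|c|`, `s̃₁ = arctan(c₂/c₁)` satisfy `|s̃₁| < π/2`, `w₁(cos s̃₁, sin s̃₁) = c` and
`−w̄₁(cos s̄₁, sin s̄₁) + w₁ G(s̄₁)(cos s̃₁, sin s̃₁) = e`. -/
theorem stmt10 (γ : ℝ) (hγ : 0 < γ) (sb₁ wb₁ : ℝ) (hw : wb₁ = 1 ∨ wb₁ = -1)
    (e₁ e₂ : ℝ) (he : Real.sqrt (e₁ ^ 2 + e₂ ^ 2) < 1)
    (c₁ c₂ : ℝ)
    -- `c = G(s̄₁)⁻¹ e + w̄₁ (1, 0)`, with `G(θ)⁻¹ = [[cos θ, sin θ], [−sin θ, cos θ]]`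
    (hc₁ : c₁ = Real.cos sb₁ * e₁ + Real.sin sb₁ * e₂ + wb₁)
    (hc₂ : c₂ = -Real.sin sb₁ * e₁ + Real.cos sb₁ * e₂)
    (w₁ st₁ : ℝ)
    (hw₁ : w₁ = wb₁ * Real.sqrt (c₁ ^ 2 + c₂ ^ 2))
    (hst₁ : st₁ = Real.arctan (c₂ / c₁)) :
    0 < wb₁ * c₁ ∧ c₁ ≠ 0 ∧
    |st₁| < Real.pi / 2 ∧
    (w₁ * Real.cos st₁ = c₁ ∧ w₁ * Real.sin st₁ = c₂) ∧
    (-wb₁ * Real.cos sb₁ +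
        w₁ * (Real.cos sb₁ * Real.cos st₁ - Real.sin sb₁ * Real.sin st₁) = e₁ ∧
      -wb₁ * Real.sin sb₁ +
        w₁ * (Real.sin sb₁ * Real.cos st₁ + Real.cos sb₁ * Real.sin st₁) = e₂) := by
  have hwsq : wb₁ ^ 2 = 1 := by rcases hw with rfl | rfl <;> norm_num
  have htrig := Real.sin_sq_add_cos_sq sb₁
  have hnorm : e₁ ^ 2 + e₂ ^ 2 < 1 := by
    simpa using (Real.sqrt_lt' one_pos).mp he
  have hrot : (c₁ - wb₁) ^ 2 + c₂ ^ 2 = e₁ ^ 2 + e₂ ^ 2 := by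
    rw [hc₁, hc₂]
    linear_combination (e₁ ^ 2 + e₂ ^ 2) * htrig
  have hpos : 0 < wb₁ * c₁ := by nlinarith [sq_nonneg c₁, sq_nonneg c₂]
  obtain ⟨hcos, hsin⟩ : w₁ * Real.cos st₁ = c₁ ∧ w₁ * Real.sin st₁ = c₂ := by
    rw [hw₁, hst₁]
    exact signed_polar_arctan hwsq hpos
  refine ⟨hpos, right_ne_zero_of_mul hpos.ne', ?_, ⟨hcos, hsin⟩, ?_, ?_⟩
  · rw [hst₁]
    exact abs_lt.mpr ⟨Real.neg_pi_div_two_lt_arctan _, Real.arctan_lt_pi_div_two _⟩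
  · linear_combination Real.cos sb₁ * (hcos + hc₁) - Real.sin sb₁ * (hsin + hc₂) + e₁ * htrig
  · linear_combination Real.sin sb₁ * (hcos + hc₁) + Real.cos sb₁ * (hsin + hc₂) + e₂ * htrig
end

section
/- Let n ≥ 1, let Ǒ ⊆ ℝ^{n−1} be open and O = ℝ × Ǒ ⊆ ℝⁿ. Let h₁, h₂ : O → ℝⁿ be smooth vector fields that do not depend on the first coordinate y₁, such that L_{h₂}L_{h₁}^i y₁ = 0 on O for i = 0,…,n−2, L_{h₂}L_{h₁}^{n−1} y₁(y) ≠ 0 for all y ∈ O, and such that S = (y₁, L_{h₁}y₁, …, L_{h₁}^{n−1}y₁) maps O bijectively onto ℝⁿ. Then there exists a continuous feedback map Φ : (ℝ² × O) × (ℝ² × O) × { u ∈ ℝ² : u₁ ≠ 0 } → ℝ² with the following property: for every strongly admissible x^D and every ε ∈ {−1, 1} there exist y^D ∈ C¹([0,∞), O) and a bounded continuous u^D : [0,∞) → ℝ² with sign u₁^D(t) = ε satisfying ẋ^D(t) = u₁^D(t)·(cos y₁^D(t), sin y₁^D(t)) and ẏ^D(t) = u₁^D(t) h₁(y^D(t))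 + u₂^D(t) h₂(y^D(t)), such that for every initial state (x(0), y(0)) ∈ ℝ² × O the closed-loop solution of ẋ(t) = u₁(t)·(cos y₁(t), sin y₁(t)), ẏ(t) = u₁(t) h₁(y(t)) + u₂(t) h₂(y(t)), u(t) = Φ((x(t), y(t)), (x^D(t), y^D(t)), u^D(t)) exists for all t ≥ 0, remains in ℝ² × O, has bounded input u, and satisfies x(t) − x^D(t) → 0, y(t) − y^D(t) → 0 (componentwise), and u(t) − u^D(t) → 0 as t → ∞. -/
open Set Filter

open scoped Topology NNReal

lemma hasDerivWithinAt_euclidean {n : ℕ} {z : ℝ → EuclideanSpace ℝ (Fin n)}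
    {z' : EuclideanSpace ℝ (Fin n)} {s : Set ℝ} {t : ℝ} :
    HasDerivWithinAt z z' s t ↔ ∀ i, HasDerivWithinAt (fun τ => z τ i) (z' i) s t := by
  simp only [hasDerivWithinAt_iff_hasFDerivWithinAt]
  rw [hasFDerivWithinAt_euclidean]
  refine forall_congr' fun i => ?_
  congr! 1

lemma lieDeriv_contDiffOn {n : ℕ} {O : Set (EuclideanSpace ℝ (Fin n))} (hO : IsOpen O)
    {h : EuclideanSpace ℝ (Fin n) → EuclideanSpace ℝ (Fin n)}
    {φ : EuclideanSpace ℝ (Fin n) → ℝ} (hh : ContDiffOn ℝ (⊤ : ℕ∞) h O)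
    (hφ : ContDiffOn ℝ (⊤ : ℕ∞) φ O) : ContDiffOn ℝ (⊤ : ℕ∞) (lieDeriv h φ) O :=
  (hφ.fderiv_of_isOpen hO (by simp)).clm_apply hh

lemma lieIter_contDiffOn {n : ℕ} {O : Set (EuclideanSpace ℝ (Fin n))} (hO : IsOpen O)
    {h : EuclideanSpace ℝ (Fin n) → EuclideanSpace ℝ (Fin n)}
    {φ : EuclideanSpace ℝ (Fin n) → ℝ} (hh : ContDiffOn ℝ (⊤ : ℕ∞) h O)
    (hφ : ContDiffOn ℝ (⊤ : ℕ∞) φ O) (i : ℕ) :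
    ContDiffOn ℝ (⊤ : ℕ∞) (lieIter h φ i) O := by
  induction i with
  | zero => exact hφ
  | succ i ih => exact lieDeriv_contDiffOn hO hh ih

/-- Iterated Lie brackets `ad_h^j g`. -/
noncomputable def adIter {n : ℕ} (h g : EuclideanSpace ℝ (Fin n) → EuclideanSpace ℝ (Fin n)) :
    ℕ → EuclideanSpace ℝ (Fin n) → EuclideanSpace ℝ (Fin n)
  | 0 => g
  | (j + 1) => VectorField.lieBracket ℝ h (adIter h g j)

lemma adIter_contDiffOn {n : ℕ} {O : Set (EuclideanSpace ℝ (Fin n))} (hO : IsOpen O)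
    {h g : EuclideanSpace ℝ (Fin n) → EuclideanSpace ℝ (Fin n)}
    (hh : ContDiffOn ℝ (⊤ : ℕ∞) h O) (hg : ContDiffOn ℝ (⊤ : ℕ∞) g O) (j : ℕ) :
    ContDiffOn ℝ (⊤ : ℕ∞) (adIter h g j) O := by
  induction j with
  | zero => exact hg
  | succ j ih =>
    intro y hy
    exact ((hh.contDiffAt (hO.mem_nhds hy)).lieBracket_vectorField
      (ih.contDiffAt (hO.mem_nhds hy)) (by simp)).contDiffWithinAt

/-- If `L_g L_h^i φ` vanishes for `i < m` and not for `i = m`, then the pairing of `ad_h^j g` with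
`L_h^i φ` vanishes below the antidiagonal `i + j = m` and not on it. -/
lemma lieDeriv_adIter {n : ℕ} {O : Set (EuclideanSpace ℝ (Fin n))} (hO : IsOpen O)
    {h g : EuclideanSpace ℝ (Fin n) → EuclideanSpace ℝ (Fin n)}
    {φ : EuclideanSpace ℝ (Fin n) → ℝ}
    (hh : ContDiffOn ℝ (⊤ : ℕ∞) h O) (hg : ContDiffOn ℝ (⊤ : ℕ∞) g O)
    (hφ : ContDiffOn ℝ (⊤ : ℕ∞) φ O) {m : ℕ}
    (hzero : ∀ i < m, ∀ y ∈ O, lieDeriv g (lieIter h φ i) y = 0)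
    (hnz : ∀ y ∈ O, lieDeriv g (lieIter h φ m) y ≠ 0) (j : ℕ) :
    (∀ i, i + j < m → ∀ y ∈ O, lieDeriv (adIter h g j) (lieIter h φ i) y = 0) ∧
    (∀ i, i + j = m → ∀ y ∈ O, lieDeriv (adIter h g j) (lieIter h φ i) y ≠ 0) := by
  induction j with
  | zero =>
    refine ⟨fun i hi => hzero i (by simpa using hi), fun i hi => ?_⟩
    obtain rfl : i = m := by simpa using hi
    exact hnz
  | succ j ih =>
    have key : ∀ i, i + j < m → ∀ y ∈ O, lieDeriv (adIter h g (j + 1)) (lieIter h φ i) y =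
        - lieDeriv (adIter h g j) (lieIter h φ (i + 1)) y := by
      intro i hi y hy
      have h1 : fderiv ℝ (lieDeriv (adIter h g j) (lieIter h φ i)) y = 0 := by
        have : lieDeriv (adIter h g j) (lieIter h φ i) =ᶠ[𝓝 y] fun _ => (0 : ℝ) := by
          filter_upwards [hO.mem_nhds hy] with z hz using ih.1 i hi z hz
        rw [this.fderiv_eq]; simp
      have h2 := VectorField.fderiv_apply_lieBracket (𝕜 := ℝ) (V := h) (W := adIter h g j)
        ((lieIter_contDiffOn hO hh hφ i).contDiffAt (hO.mem_nhds hy))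
        (by simpa using (WithTop.coe_le_coe.2 (le_top : (2 : ℕ∞) ≤ ⊤)))
        (((adIter_contDiffOn hO hh hg j).contDiffAt (hO.mem_nhds hy)).differentiableAt (by simp))
        ((hh.contDiffAt (hO.mem_nhds hy)).differentiableAt (by simp))
      change fderiv ℝ (lieIter h φ i) y (VectorField.lieBracket ℝ h (adIter h g j) y) =
        - fderiv ℝ (fun z => fderiv ℝ (lieIter h φ i) z (h z)) y (adIter h g j y)
      rw [h2]
      change fderiv ℝ (lieDeriv (adIter h g j) (lieIter h φ i)) y (h y) - _ = _
      rw [h1]; simp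
    refine ⟨fun i hi y hy => ?_, fun i hi y hy => ?_⟩
    · rw [key i (by omega) y hy, ih.1 (i + 1) (by omega) y hy, neg_zero]
    · rw [key i (by omega) y hy]
      exact neg_ne_zero.2 (ih.2 (i + 1) (by omega) y hy)

/-- The differential of the coordinate map `(φ, L_h φ, …, L_h^{n-1} φ)` is bijective. -/
lemma fderiv_flatCoordinates_bijective {n : ℕ} (hn : 1 ≤ n)
    {O : Set (EuclideanSpace ℝ (Fin n))} (hO : IsOpen O)
    {h g : EuclideanSpace ℝ (Fin n) → EuclideanSpace ℝ (Fin n)}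
    {φ : EuclideanSpace ℝ (Fin n) → ℝ}
    (hh : ContDiffOn ℝ (⊤ : ℕ∞) h O) (hg : ContDiffOn ℝ (⊤ : ℕ∞) g O)
    (hφ : ContDiffOn ℝ (⊤ : ℕ∞) φ O)
    (hzero : ∀ i < n - 1, ∀ y ∈ O, lieDeriv g (lieIter h φ i) y = 0)
    (hnz : ∀ y ∈ O, lieDeriv g (lieIter h φ (n - 1)) y ≠ 0)
    {L : EuclideanSpace ℝ (Fin n) →L[ℝ] EuclideanSpace ℝ (Fin n)}
    {y : EuclideanSpace ℝ (Fin n)} (hy : y ∈ O)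
    (hL : ∀ v (i : Fin n), L v i = fderiv ℝ (lieIter h φ i) y v) :
    Function.Bijective L := by
  have hsurj : Function.Surjective L := by
    let M : Matrix (Fin n) (Fin n) ℝ :=
      fun i k => L (adIter h g (n - 1 - k) y) i
    have hM : ∀ i k, M i k = lieDeriv (adIter h g (n - 1 - k)) (lieIter h φ i) y :=
      fun i k => hL _ i
    have hlow : M.IsLowerTriangular := by
      intro i k hik
      have hik : i < k := hik
      rw [hM]
      refine (lieDeriv_adIter hO hh hg hφ hzero hnz _).1 _ ?_ y hy
      have := k.2
      have : (i : ℕ) < k := hik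
      omega
    have hdet : IsUnit M.det := by
      rw [Matrix.det_of_isLowerTriangular M hlow, isUnit_iff_ne_zero, Finset.prod_ne_zero_iff]
      intro i _
      rw [hM]
      refine (lieDeriv_adIter hO hh hg hφ hzero hnz _).2 _ ?_ y hy
      have := i.2
      omega
    intro v
    obtain ⟨c, hc⟩ : ∃ c, M.mulVec c = fun i => v i :=
      ⟨M⁻¹.mulVec (fun i => v i), by
        rw [Matrix.mulVec_mulVec, Matrix.mul_nonsing_inv _ hdet, Matrix.one_mulVec]⟩
    refine ⟨∑ k, c k • adIter h g (n - 1 - k) y, ?_⟩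
    ext i
    have := congrFun hc i
    rw [← this]
    simp [Matrix.mulVec, dotProduct, M, mul_comm]
  exact ⟨(LinearMap.injective_iff_surjective (f := L.toLinearMap)).2 hsurj, hsurj⟩

/-- `S` is inverted by `R` on the open set `O`; both commute with translations of the first
coordinate, and in the coordinates `z = S y` the system `ẏ = u₁ h₁(y) + u₂ h₂(y)` reads
`żᵢ = u₁ zᵢ₊₁` for `i < n - 1`, `żₙ₋₁ = u₁ α(z) + u₂ β(z)`. -/
structure IsFlatInverse {n : ℕ} (hn : 1 ≤ n) (O : Set (EuclideanSpace ℝ (Fin n)))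
    (h₁ h₂ S R : EuclideanSpace ℝ (Fin n) → EuclideanSpace ℝ (Fin n))
    (α β : EuclideanSpace ℝ (Fin n) → ℝ) : Prop where
  continuous_inv : Continuous R
  continuous_alpha : Continuous α
  continuous_beta : Continuous β
  mem : ∀ z, R z ∈ O
  right_inv : ∀ z, S (R z) = z
  left_inv : ∀ y ∈ O, R (S y) = y
  continuousOn : ContinuousOn S O
  beta_ne_zero : ∀ z, β z ≠ 0
  inv_add : ∀ z s, R (z + EuclideanSpace.single ⟨0, hn⟩ s) = R z + EuclideanSpace.single ⟨0, hn⟩ s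
  alpha_add : ∀ z s, α (z + EuclideanSpace.single ⟨0, hn⟩ s) = α z
  beta_add : ∀ z s, β (z + EuclideanSpace.single ⟨0, hn⟩ s) = β z
  inv_zero : ∀ z, R z ⟨0, hn⟩ = z ⟨0, hn⟩
  hasDerivWithinAt : ∀ (z : ℝ → EuclideanSpace ℝ (Fin n)) (u₁ u₂ : ℝ) (s : Set ℝ) (t : ℝ),
    (∀ i j : Fin n, (j : ℕ) = i + 1 → HasDerivWithinAt (fun τ => z τ i) (u₁ * z t j) s t) →
    (∀ i : Fin n, (i : ℕ) + 1 = n →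
      HasDerivWithinAt (fun τ => z τ i) (u₁ * α (z t) + u₂ * β (z t)) s t) →
    HasDerivWithinAt (fun τ => R (z τ)) (u₁ • h₁ (R (z t)) + u₂ • h₂ (R (z t))) s t

lemma lieIter_add_single {n : ℕ} (hn : 1 ≤ n)
    {h : EuclideanSpace ℝ (Fin n) → EuclideanSpace ℝ (Fin n)}
    (hh : ∀ y s, h (y + EuclideanSpace.single ⟨0, hn⟩ s) = h y)
    {φ : EuclideanSpace ℝ (Fin n) → ℝ}
    (hφ : ∀ y s, φ (y + EuclideanSpace.single ⟨0, hn⟩ s) = φ y + s) (i : ℕ)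
    (y : EuclideanSpace ℝ (Fin n)) (s : ℝ) :
    lieIter h φ i (y + EuclideanSpace.single ⟨0, hn⟩ s) =
      lieIter h φ i y + if i = 0 then s else 0 := by
  induction i generalizing y with
  | zero => simpa [lieIter] using hφ y s
  | succ i ih =>
    change fderiv ℝ (lieIter h φ i) _ _ = fderiv ℝ (lieIter h φ i) y (h y) + _
    rw [hh, ← fderiv_comp_add_right (f := lieIter h φ i), funext ih, fderiv_add_const]
    simp

lemma lieDeriv_lieIter_add_single {n : ℕ} (hn : 1 ≤ n)
    {h g : EuclideanSpace ℝ (Fin n) → EuclideanSpace ℝ (Fin n)}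
    (hh : ∀ y s, h (y + EuclideanSpace.single ⟨0, hn⟩ s) = h y)
    (hg : ∀ y s, g (y + EuclideanSpace.single ⟨0, hn⟩ s) = g y)
    {φ : EuclideanSpace ℝ (Fin n) → ℝ}
    (hφ : ∀ y s, φ (y + EuclideanSpace.single ⟨0, hn⟩ s) = φ y + s) (i : ℕ)
    (y : EuclideanSpace ℝ (Fin n)) (s : ℝ) :
    lieDeriv g (lieIter h φ i) (y + EuclideanSpace.single ⟨0, hn⟩ s) =
      lieDeriv g (lieIter h φ i) y := by
  change fderiv ℝ (lieIter h φ i) _ _ = fderiv ℝ (lieIter h φ i) y (g y)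
  rw [hg, ← fderiv_comp_add_right (f := lieIter h φ i),
    funext fun y => lieIter_add_single hn hh hφ i y s, fderiv_add_const]

theorem exists_isFlatInverse {n : ℕ} (hn : 1 ≤ n)
    (O : Set (EuclideanSpace ℝ (Fin n))) (hO : IsOpen O)
    (hOsplit : ∀ y z : EuclideanSpace ℝ (Fin n),
      (∀ i : Fin n, 0 < (i : ℕ) → y i = z i) → (y ∈ O ↔ z ∈ O))
    (h₁ h₂ : EuclideanSpace ℝ (Fin n) → EuclideanSpace ℝ (Fin n))
    (hh₁ : ContDiffOn ℝ (⊤ : ℕ∞) h₁ O) (hh₂ : ContDiffOn ℝ (⊤ : ℕ∞) h₂ O)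
    (hind₁ : ∀ y z : EuclideanSpace ℝ (Fin n),
      (∀ i : Fin n, 0 < (i : ℕ) → y i = z i) → h₁ y = h₁ z)
    (hind₂ : ∀ y z : EuclideanSpace ℝ (Fin n),
      (∀ i : Fin n, 0 < (i : ℕ) → y i = z i) → h₂ y = h₂ z)
    (y₁ : EuclideanSpace ℝ (Fin n) → ℝ) (hy₁ : ∀ y, y₁ y = y ⟨0, hn⟩)
    (hzero : ∀ i < n - 1, ∀ y ∈ O, lieDeriv h₂ (lieIter h₁ y₁ i) y = 0)
    (hnz : ∀ y ∈ O, lieDeriv h₂ (lieIter h₁ y₁ (n - 1)) y ≠ 0)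
    (S : EuclideanSpace ℝ (Fin n) → EuclideanSpace ℝ (Fin n))
    (hS : ∀ y (i : Fin n), S y i = lieIter h₁ y₁ i y)
    (hSbij : Set.BijOn S O Set.univ) :
    ∃ R α β, IsFlatInverse hn O h₁ h₂ S R α β := by
  have hoff : ∀ (y : EuclideanSpace ℝ (Fin n)) (s : ℝ) (i : Fin n), 0 < (i : ℕ) →
      (y + EuclideanSpace.single (⟨0, hn⟩ : Fin n) s) i = y i := by
    intro y s i hi
    have : i ≠ ⟨0, hn⟩ := fun h => by simp [h] at hi
    simp [this]
  have hs₁ : ∀ y s, h₁ (y + EuclideanSpace.single ⟨0, hn⟩ s) = h₁ y :=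
    fun y s => hind₁ _ _ (hoff y s)
  have hs₂ : ∀ y s, h₂ (y + EuclideanSpace.single ⟨0, hn⟩ s) = h₂ y :=
    fun y s => hind₂ _ _ (hoff y s)
  have hsO : ∀ y s, y + EuclideanSpace.single ⟨0, hn⟩ s ∈ O ↔ y ∈ O :=
    fun y s => hOsplit _ _ (hoff y s)
  have hsy : ∀ y s, y₁ (y + EuclideanSpace.single ⟨0, hn⟩ s) = y₁ y + s := by
    intro y s; simp [hy₁]
  have hsmooth : ContDiffOn ℝ (⊤ : ℕ∞) y₁ O := by
    have : y₁ = fun y => y ⟨0, hn⟩ := funext hy₁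
    rw [this]
    exact ContDiff.contDiffOn (by fun_prop)
  have hSsmooth : ContDiffOn ℝ (⊤ : ℕ∞) S O := by
    rw [contDiffOn_euclidean]
    intro i
    simp only [hS]
    exact lieIter_contDiffOn hO hh₁ hsmooth i
  have hSs : ∀ y s, S (y + EuclideanSpace.single ⟨0, hn⟩ s) =
      S y + EuclideanSpace.single ⟨0, hn⟩ s := by
    intro y s
    ext i
    simp only [hS, lieIter_add_single hn hs₁ hsy, PiLp.add_apply, PiLp.single_apply, Fin.ext_iff]
  let R := Function.invFunOn S O
  have hRmem : ∀ z, R z ∈ O := fun z =>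
    Function.invFunOn_mem (hSbij.surjOn (mem_univ z))
  have hSR : ∀ z, S (R z) = z := fun z => Function.invFunOn_eq (hSbij.surjOn (mem_univ z))
  have hRS : ∀ y ∈ O, R (S y) = y := fun y hy =>
    hSbij.injOn (hRmem _) hy (hSR _)
  have hS0 : ∀ y, S y ⟨0, hn⟩ = y ⟨0, hn⟩ := by intro y; rw [hS]; exact hy₁ y
  have hcoord : ∀ y ∈ O, ∀ v (i : Fin n),
      fderiv ℝ S y v i = fderiv ℝ (lieIter h₁ y₁ i) y v := by
    intro y hy v i
    have hd := (hSsmooth.contDiffAt (hO.mem_nhds hy)).differentiableAt (by simp)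
    have := (((EuclideanSpace.proj (𝕜 := ℝ) i).hasFDerivAt).comp y hd.hasFDerivAt).fderiv
    change fderiv ℝ (fun x => S x i) y = _ at this
    simp only [hS] at this
    rw [this]; rfl
  have hbij : ∀ y ∈ O, Function.Bijective (fderiv ℝ S y) := fun y hy =>
    fderiv_flatCoordinates_bijective hn hO hh₁ hh₂ hsmooth hzero hnz hy (hcoord y hy)
  have hRderiv : ∀ z, ∀ (f' : EuclideanSpace ℝ (Fin n) ≃L[ℝ] EuclideanSpace ℝ (Fin n)),
      (f' : EuclideanSpace ℝ (Fin n) →L[ℝ] EuclideanSpace ℝ (Fin n)) = fderiv ℝ S (R z) →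
      HasFDerivAt R (f'.symm : EuclideanSpace ℝ (Fin n) →L[ℝ] EuclideanSpace ℝ (Fin n)) z := by
    intro z f' hf'
    have hst : HasStrictFDerivAt S
        (f' : EuclideanSpace ℝ (Fin n) →L[ℝ] EuclideanSpace ℝ (Fin n)) (R z) := by
      rw [hf']
      exact (hSsmooth.contDiffAt (hO.mem_nhds (hRmem z))).hasStrictFDerivAt (by simp)
    have h1 := hst.to_localInverse.hasFDerivAt
    have h2 := hst.eventually_right_inverse
    have h3 := hst.localInverse_tendsto.eventually (hO.mem_nhds (hRmem z))
    rw [hSR] at h1 h2 h3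
    refine h1.congr_of_eventuallyEq ?_
    filter_upwards [h2, h3] with w hw2 hw3
    conv_lhs => rw [← hw2]
    exact hRS _ hw3
  have hRex : ∀ z, ∃ f' : EuclideanSpace ℝ (Fin n) ≃L[ℝ] EuclideanSpace ℝ (Fin n),
      (f' : EuclideanSpace ℝ (Fin n) →L[ℝ] EuclideanSpace ℝ (Fin n)) = fderiv ℝ S (R z) := by
    intro z
    refine ⟨(LinearEquiv.ofBijective (fderiv ℝ S (R z)).toLinearMap
      (hbij _ (hRmem z))).toContinuousLinearEquiv, ?_⟩
    ext v; rfl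
  have hRcont : Continuous R := by
    rw [continuous_iff_continuousAt]
    intro z
    obtain ⟨f', hf'⟩ := hRex z
    exact (hRderiv z f' hf').continuousAt
  have hRs : ∀ z s, R (z + EuclideanSpace.single ⟨0, hn⟩ s) =
      R z + EuclideanSpace.single ⟨0, hn⟩ s := by
    intro z s
    refine hSbij.injOn (hRmem _) ((hsO _ _).2 (hRmem _)) ?_
    rw [hSR, hSs, hSR]
  have hcomp : ∀ φ : EuclideanSpace ℝ (Fin n) → ℝ, ContDiffOn ℝ (⊤ : ℕ∞) φ O →
      Continuous fun z => φ (R z) := by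
    intro φ hφ
    exact hφ.continuousOn.comp_continuous hRcont hRmem
  refine ⟨R, fun z => lieIter h₁ y₁ n (R z), fun z => lieDeriv h₂ (lieIter h₁ y₁ (n - 1)) (R z),
    hRcont, hcomp _ (lieIter_contDiffOn hO hh₁ hsmooth n),
    hcomp _ (lieDeriv_contDiffOn hO hh₂ (lieIter_contDiffOn hO hh₁ hsmooth _)), hRmem, hSR, hRS,
    hSsmooth.continuousOn, fun z => hnz _ (hRmem z), hRs, fun z s => ?_, fun z s => ?_,
    fun z => ?_, ?_⟩
  · simp only [hRs, lieIter_add_single hn hs₁ hsy]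
    simp [show n ≠ 0 by omega]
  · simp only [hRs, lieDeriv_lieIter_add_single hn hs₁ hs₂ hsy]
  · rw [← hS0, hSR]
  · intro z u₁ u₂ s t hchain hlast
    obtain ⟨f', hf'⟩ := hRex (z t)
    have hz : HasDerivWithinAt z
        (fderiv ℝ S (R (z t)) (u₁ • h₁ (R (z t)) + u₂ • h₂ (R (z t)))) s t := by
      rw [hasDerivWithinAt_euclidean]
      intro i
      have hval : fderiv ℝ S (R (z t)) (u₁ • h₁ (R (z t)) + u₂ • h₂ (R (z t))) i =
          u₁ * lieIter h₁ y₁ (i + 1) (R (z t)) +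
          u₂ * lieDeriv h₂ (lieIter h₁ y₁ i) (R (z t)) := by
        rw [hcoord _ (hRmem _), map_add, map_smul, map_smul]; rfl
      rw [hval]
      by_cases hi : (i : ℕ) + 1 < n
      · have := hchain i ⟨i + 1, hi⟩ rfl
        rw [hzero i (by omega) _ (hRmem _), mul_zero, add_zero]
        convert this using 2
        conv_rhs => rw [← hSR (z t)]
        rw [hS]
      · have hi' : (i : ℕ) + 1 = n := by have := i.2; omega
        have := hlast i hi'
        have e : n - 1 = (i : ℕ) := by omega
        rw [e] at this
        rw [hi']
        exact this
    have := (hRderiv (z t) f' hf').comp_hasDerivWithinAt t hz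
    rw [← hf'] at this
    simpa using! this

/-- A bounded saturation of the identity of the plane. -/
noncomputable def sat (z : ℂ) : ℂ := ((2 * √(1 + ‖z‖ ^ 2))⁻¹ : ℝ) • z

lemma sat_zero : sat 0 = 0 := by simp [sat]

lemma one_le_sqrt_one_add_sq (x : ℝ) : 1 ≤ √(1 + x ^ 2) :=
  Real.one_le_sqrt.2 (by nlinarith [sq_nonneg x])

lemma le_sqrt_one_add_sq (x : ℝ) : x ≤ √(1 + x ^ 2) :=
  Real.le_sqrt_of_sq_le (by linarith)

lemma contDiff_sat : ContDiff ℝ (⊤ : ℕ∞) sat := by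
  have h1 : ContDiff ℝ (⊤ : ℕ∞) fun z : ℂ => 1 + ‖z‖ ^ 2 :=
    contDiff_const.add (contDiff_norm_sq ℝ)
  have h2 : ContDiff ℝ (⊤ : ℕ∞) fun z : ℂ => √(1 + ‖z‖ ^ 2) :=
    h1.sqrt fun z => by positivity
  refine ContDiff.smul (ContDiff.inv (contDiff_const.mul h2) fun z => ?_) contDiff_id
  have := one_le_sqrt_one_add_sq ‖z‖
  positivity

lemma norm_sat (z : ℂ) : ‖sat z‖ = ‖z‖ / (2 * √(1 + ‖z‖ ^ 2)) := by
  rw [sat, norm_smul, Real.norm_of_nonneg (by positivity)]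
  ring

lemma norm_sat_le (z : ℂ) : ‖sat z‖ ≤ 1 / 2 := by
  have h := one_le_sqrt_one_add_sq ‖z‖
  have h' := le_sqrt_one_add_sq ‖z‖
  rw [norm_sat, div_le_div_iff₀ (by linarith) (by norm_num)]
  linarith

lemma sat_mul (u z : ℂ) (hu : ‖u‖ = 1) : sat (z * u) = sat z * u := by
  simp [sat, hu, mul_assoc]

lemma sat_lipschitz : LipschitzWith 1 sat := by
  refine LipschitzWith.of_dist_le_mul fun a b => ?_
  rw [dist_eq_norm, dist_eq_norm, NNReal.coe_one, one_mul]
  set α := √(1 + ‖a‖ ^ 2) with hα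
  set β := √(1 + ‖b‖ ^ 2) with hβ
  have hα1 : 1 ≤ α := one_le_sqrt_one_add_sq _
  have hβ1 : 1 ≤ β := one_le_sqrt_one_add_sq _
  have haα : ‖a‖ ≤ α := le_sqrt_one_add_sq _
  have hbβ : ‖b‖ ≤ β := le_sqrt_one_add_sq _
  have hα2 : α ^ 2 = 1 + ‖a‖ ^ 2 := Real.sq_sqrt (by positivity)
  have hβ2 : β ^ 2 = 1 + ‖b‖ ^ 2 := Real.sq_sqrt (by positivity)
  have hd : |β - α| ≤ ‖a - b‖ := by
    have h1 : |‖b‖ - ‖a‖| ≤ ‖a - b‖ := by rw [abs_sub_comm]; exact abs_norm_sub_norm_le a b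
    refine le_trans ?_ h1
    have h2 : (β - α) * (β + α) = (‖b‖ - ‖a‖) * (‖b‖ + ‖a‖) := by nlinarith
    have h3 : |β - α| * (β + α) = |‖b‖ - ‖a‖| * (‖b‖ + ‖a‖) := by
      have := congrArg abs h2
      rwa [abs_mul, abs_mul, abs_of_pos (show 0 < β + α by linarith),
        abs_of_nonneg (show 0 ≤ ‖b‖ + ‖a‖ by positivity)] at this
    have h4 : |‖b‖ - ‖a‖| * (‖b‖ + ‖a‖) ≤ |‖b‖ - ‖a‖| * (β + α) :=
      mul_le_mul_of_nonneg_left (by linarith) (abs_nonneg _)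
    exact le_of_mul_le_mul_right (h3.trans_le h4) (by linarith)
  have e : sat a - sat b = ((2 * α)⁻¹ : ℝ) • (a - b) + ((β - α) / (2 * α * β) : ℝ) • b := by
    have : (β - α) / (2 * α * β) = (2 * α)⁻¹ - (2 * β)⁻¹ := by
      field_simp
    rw [this, sub_smul, smul_sub]
    simp only [sat, ← hα, ← hβ]
    abel
  rw [e]
  refine (norm_add_le _ _).trans ?_
  rw [norm_smul, norm_smul, Real.norm_of_nonneg (by positivity), Real.norm_eq_abs, abs_div,
    abs_of_pos (show 0 < 2 * α * β by positivity)]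
  have h5 : (2 * α)⁻¹ ≤ 1 / 2 := by
    rw [inv_le_comm₀ (by positivity) (by norm_num)]; linarith
  have h6 : |β - α| / (2 * α * β) * ‖b‖ ≤ 1 / 2 * ‖a - b‖ := by
    rw [div_mul_eq_mul_div, div_le_iff₀ (by positivity)]
    have : |β - α| * ‖b‖ ≤ ‖a - b‖ * β := mul_le_mul hd hbβ (norm_nonneg _) (norm_nonneg _)
    have : ‖a - b‖ * β ≤ ‖a - b‖ * β * α := le_mul_of_one_le_right (by positivity) hα1
    linarith
  nlinarith [norm_nonneg (a - b), mul_le_mul_of_nonneg_right h5 (norm_nonneg (a - b))]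

lemma one_sub_sat_re (z : ℂ) : 1 / 2 ≤ (1 - sat z).re := by
  have := (Complex.re_le_norm (sat z)).trans (norm_sat_le z)
  simp only [Complex.sub_re, Complex.one_re]
  linarith

/-- The speed ratio imposed by the guidance law. -/
noncomputable def speed (z : ℂ) : ℝ := ‖1 - sat z‖

/-- The heading correction imposed by the guidance law. -/
noncomputable def heading (z : ℂ) : ℝ := Complex.arg (1 - sat z)

lemma half_le_speed (z : ℂ) : 1 / 2 ≤ speed z :=
  (one_sub_sat_re z).trans (Complex.re_le_norm _)

lemma speed_pos (z : ℂ) : 0 < speed z := by linarith [half_le_speed z]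

lemma speed_le (z : ℂ) : speed z ≤ 3 / 2 := by
  have h1 := norm_sub_le (1 : ℂ) (sat z)
  have h2 := norm_sat_le z
  rw [norm_one] at h1
  unfold speed
  linarith

lemma speed_lipschitz (a b : ℂ) : |speed a - speed b| ≤ ‖a - b‖ := by
  refine (abs_norm_sub_norm_le _ _).trans ?_
  have := sat_lipschitz.dist_le_mul b a
  rw [dist_eq_norm, dist_eq_norm, NNReal.coe_one, one_mul, norm_sub_rev b a] at this
  simpa using this

lemma speed_zero : speed 0 = 1 := by simp [speed, sat_zero]

lemma heading_zero : heading 0 = 0 := by simp [heading, sat_zero]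

lemma speed_mul_exp_heading (z : ℂ) :
    (speed z : ℂ) * Complex.exp (heading z * Complex.I) = 1 - sat z :=
  Complex.norm_mul_exp_arg_mul_I _

lemma contDiff_one_sub_sat : ContDiff ℝ (⊤ : ℕ∞) fun z => 1 - sat z :=
  contDiff_const.sub contDiff_sat

lemma contDiff_speed : ContDiff ℝ (⊤ : ℕ∞) speed := by
  refine contDiff_one_sub_sat.norm ℝ fun z h => ?_
  have := one_sub_sat_re z
  rw [h] at this
  norm_num at this

lemma contDiff_heading : ContDiff ℝ (⊤ : ℕ∞) heading := by
  have h : ∀ z, heading z = (Complex.log (1 - sat z)).im := fun z => (Complex.log_im _).symm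
  rw [funext h]
  have h' : ContDiff ℝ (⊤ : ℕ∞) fun z => Complex.log (1 - sat z) := by
    refine contDiff_iff_contDiffAt.2 fun z => ?_
    have hz : 1 - sat z ∈ Complex.slitPlane := Or.inl (by linarith [one_sub_sat_re z])
    exact ((Complex.contDiffAt_log (n := (⊤ : ℕ∞)) hz).restrict_scalars ℝ).comp z
      contDiff_one_sub_sat.contDiffAt
  exact Complex.imCLM.contDiff.comp h'

/-- The velocity, per unit of own arc length, of the position error in the frame of the
reference; `k` is the curvature of the reference and `δ` the heading error. -/
noncomputable def errorField (z : ℂ) (k δ : ℝ) : ℂ :=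
  Complex.exp (δ * Complex.I) - ((speed z)⁻¹ : ℝ) - ((speed z)⁻¹ * k : ℝ) * Complex.I * z

/-- A finite-dimensional stage of the backstepping construction: a state space, the speed ratio,
the target for the next curvature derivative, and the velocity field of the state as a
function of the next pair of curvature derivatives. -/
structure Jet where
  E : Type
  [grp : NormedAddCommGroup E]
  [space : NormedSpace ℝ E]
  rate : E → ℝ
  target : E → ℝ
  field : E × ℝ × ℝ → E
  contDiff_rate : ContDiff ℝ (⊤ : ℕ∞) rate
  contDiff_target : ContDiff ℝ (⊤ : ℕ∞) target
  contDiff_field : ContDiff ℝ (⊤ : ℕ∞) field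

attribute [instance] Jet.grp Jet.space

lemma contDiff_inv_speed : ContDiff ℝ (⊤ : ℕ∞) fun z => (speed z)⁻¹ :=
  contDiff_speed.inv fun z => (speed_pos z).ne'

lemma contDiff_errorField :
    ContDiff ℝ (⊤ : ℕ∞) fun p : ℂ × ℝ × ℝ => errorField p.1 p.2.1 p.2.2 := by
  have h1 : ContDiff ℝ (⊤ : ℕ∞) fun p : ℂ × ℝ × ℝ => (speed p.1)⁻¹ :=
    contDiff_inv_speed.comp contDiff_fst
  have h2 : ContDiff ℝ (⊤ : ℕ∞) fun x : ℝ => (x : ℂ) := Complex.ofRealCLM.contDiff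
  have h3 : ContDiff ℝ (⊤ : ℕ∞) fun p : ℂ × ℝ × ℝ => ((p.2.2 : ℝ) : ℂ) :=
    h2.comp (contDiff_snd.comp contDiff_snd)
  unfold errorField
  refine ((h3.mul contDiff_const).cexp.sub (h2.comp h1)).sub (ContDiff.mul (ContDiff.mul
    (h2.comp (h1.mul (contDiff_fst.comp contDiff_snd))) contDiff_const) contDiff_fst)

/-- The first stage. -/
noncomputable def Jet.init : Jet where
  E := ℂ × ℝ × ℝ
  rate p := (speed p.1)⁻¹
  target p := fderiv ℝ heading p.1 (errorField p.1 p.2.1 p.2.2) + heading p.1 - p.2.2 +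
    (speed p.1)⁻¹ * p.2.1
  field p := (errorField p.1.1 p.1.2.1 p.1.2.2, (speed p.1.1)⁻¹ * p.2.1,
    p.2.2 - (speed p.1.1)⁻¹ * p.1.2.1)
  contDiff_rate := contDiff_inv_speed.comp contDiff_fst
  contDiff_target := by
    have h1 : ContDiff ℝ (⊤ : ℕ∞) (fderiv ℝ heading) := contDiff_heading.fderiv_right (by simp)
    have h2 := contDiff_inv_speed.comp (contDiff_fst (E := ℂ) (F := ℝ × ℝ))
    exact ((((h1.comp contDiff_fst).clm_apply contDiff_errorField).add
      (contDiff_heading.comp contDiff_fst)).sub (contDiff_snd.comp contDiff_snd)).add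
      (h2.mul (contDiff_fst.comp contDiff_snd))
  contDiff_field := by
    have h2 : ContDiff ℝ (⊤ : ℕ∞) fun p : (ℂ × ℝ × ℝ) × ℝ × ℝ => (speed p.1.1)⁻¹ :=
      contDiff_inv_speed.comp (contDiff_fst.comp contDiff_fst)
    exact (contDiff_errorField.comp contDiff_fst).prodMk
      ((h2.mul (contDiff_fst.comp contDiff_snd)).prodMk ((contDiff_snd.comp contDiff_snd).sub
        (h2.mul (contDiff_fst.comp (contDiff_snd.comp contDiff_fst)))))

/-- The next stage: the target is differentiated along the field, with a unit linear
correction. -/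
noncomputable def Jet.next (J : Jet) : Jet where
  E := J.E × ℝ × ℝ
  rate p := J.rate p.1
  target p := fderiv ℝ J.target p.1 (J.field p) + J.target p.1 - p.2.2
  field p := (J.field p.1, J.rate p.1.1 * p.2.1, p.2.2)
  contDiff_rate := J.contDiff_rate.comp contDiff_fst
  contDiff_target :=
    (((((J.contDiff_target.fderiv_right (by simp)).comp contDiff_fst).clm_apply
      J.contDiff_field).add (J.contDiff_target.comp contDiff_fst)).sub
      (contDiff_snd.comp contDiff_snd))
  contDiff_field :=
    (J.contDiff_field.comp contDiff_fst).prodMk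
      (((J.contDiff_rate.comp (contDiff_fst.comp contDiff_fst)).mul
        (contDiff_fst.comp contDiff_snd)).prodMk (contDiff_snd.comp contDiff_snd))

/-- The `k`-th stage. -/
noncomputable def jet : ℕ → Jet
  | 0 => Jet.init
  | (k + 1) => (jet k).next

/-- The point of the `k`-th stage with position error `z`, reference curvature derivatives `ω` and
heading error and own curvature derivatives `w`. -/
noncomputable def point : (k : ℕ) → ℂ → (ℕ → ℝ) → (ℕ → ℝ) → (jet k).E
  | 0, z, ω, w => ((z, ω 0, w 0) : ℂ × ℝ × ℝ)
  | (k + 1), z, ω, w => ((point k z ω w, ω (k + 1), w (k + 1)) : (jet k).E × ℝ × ℝ)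

lemma rate_point (k : ℕ) (z : ℂ) (ω w : ℕ → ℝ) : (jet k).rate (point k z ω w) = (speed z)⁻¹ := by
  induction k with
  | zero => rfl
  | succ k ih => exact ih

lemma continuous_point (k : ℕ) :
    Continuous fun p : ℂ × (ℕ → ℝ) × (ℕ → ℝ) => point k p.1 p.2.1 p.2.2 := by
  induction k with
  | zero =>
    change Continuous fun p : ℂ × (ℕ → ℝ) × (ℕ → ℝ) => (p.1, p.2.1 0, p.2.2 0)
    fun_prop
  | succ k ih =>
    exact ih.prodMk (Continuous.prodMk (f := fun p : ℂ × (ℕ → ℝ) × (ℕ → ℝ) => p.2.1 (k + 1))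
      (g := fun p => p.2.2 (k + 1)) (by fun_prop) (by fun_prop))

lemma hasDerivWithinAt_point {z : ℝ → ℂ} {ω w : ℕ → ℝ → ℝ} {s : Set ℝ} {t c : ℝ} (k : ℕ)
    (hz : HasDerivWithinAt z (c • errorField (z t) (ω 0 t) (w 0 t)) s t)
    (hω : ∀ i ≤ k, HasDerivWithinAt (ω i) (c * ((speed (z t))⁻¹ * ω (i + 1) t)) s t)
    (hw0 : HasDerivWithinAt (w 0) (c * (w 1 t - (speed (z t))⁻¹ * ω 0 t)) s t)
    (hw : ∀ i < k, HasDerivWithinAt (w (i + 1)) (c * w (i + 2) t) s t) :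
    HasDerivWithinAt (fun τ => point k (z τ) (fun i => ω i τ) (fun i => w i τ))
      (c • (jet k).field (point k (z t) (fun i => ω i t) (fun i => w i t),
        ω (k + 1) t, w (k + 1) t)) s t := by
  induction k with
  | zero => exact hz.prodMk ((hω 0 le_rfl).prodMk hw0)
  | succ k ih =>
    have h1 := ih (fun i hi => hω i (by omega)) (fun i hi => hw i (by omega))
    have h2 := hω (k + 1) le_rfl
    rw [← rate_point k (z t) (fun i => ω i t) (fun i => w i t)] at h2
    exact h1.prodMk (h2.prodMk (hw k (by omega)))

lemma hasDerivWithinAt_target {z : ℝ → ℂ} {ω w : ℕ → ℝ → ℝ} {s : Set ℝ} {t c : ℝ} (k : ℕ)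
    (hz : HasDerivWithinAt z (c • errorField (z t) (ω 0 t) (w 0 t)) s t)
    (hω : ∀ i ≤ k, HasDerivWithinAt (ω i) (c * ((speed (z t))⁻¹ * ω (i + 1) t)) s t)
    (hw0 : HasDerivWithinAt (w 0) (c * (w 1 t - (speed (z t))⁻¹ * ω 0 t)) s t)
    (hw : ∀ i < k, HasDerivWithinAt (w (i + 1)) (c * w (i + 2) t) s t) :
    HasDerivWithinAt (fun τ => (jet k).target (point k (z τ) (fun i => ω i τ) (fun i => w i τ)))
      (c * ((jet (k + 1)).target (point (k + 1) (z t) (fun i => ω i t) (fun i => w i t)) -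
        (jet k).target (point k (z t) (fun i => ω i t) (fun i => w i t)) + w (k + 1) t)) s t := by
  have h1 := hasDerivWithinAt_point k hz hω hw0 hw
  have h2 := ((jet k).contDiff_target.differentiable (by simp)
    (point k (z t) (fun i => ω i t) (fun i => w i t))).hasFDerivAt.comp_hasDerivWithinAt t h1
  have e : (jet (k + 1)).target (point (k + 1) (z t) (fun i => ω i t) (fun i => w i t)) =
      fderiv ℝ (jet k).target (point k (z t) (fun i => ω i t) (fun i => w i t))
        ((jet k).field (point k (z t) (fun i => ω i t) (fun i => w i t),
          ω (k + 1) t, w (k + 1) t)) +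
      (jet k).target (point k (z t) (fun i => ω i t) (fun i => w i t)) - w (k + 1) t := rfl
  rw [e]
  rw [map_smul, smul_eq_mul] at h2
  convert! h2 using 1
  ring

/-- The state of perfect tracking. -/
def trackingState (ω : ℕ → ℝ) : ℕ → ℝ
  | 0 => 0
  | (i + 1) => ω i

lemma errorField_zero (k : ℝ) : errorField 0 k 0 = 0 := by
  simp [errorField, speed_zero]

/-- On perfectly tracking states the targets are the reference values. -/
lemma target_trackingState (k : ℕ) (ω : ℕ → ℝ) :
    (jet k).target (point k 0 ω (trackingState ω)) = ω k := by
  induction k generalizing ω with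
  | zero =>
    change fderiv ℝ heading 0 (errorField 0 (ω 0) 0) + heading 0 - 0 + (speed 0)⁻¹ * ω 0 = ω 0
    rw [errorField_zero, speed_zero, heading_zero]
    simp
  | succ k ih =>
    have hline : ∀ a b : ℝ, HasDerivWithinAt (fun τ => a + τ * b) b univ 0 := fun a b => by
      have h := ((hasDerivAt_id (0 : ℝ)).mul_const b).const_add a
      rw [one_mul] at h
      exact h.hasDerivWithinAt
    have h := hasDerivWithinAt_target (z := fun _ => 0) (ω := fun i τ => ω i + τ * ω (i + 1))
      (w := fun i τ => trackingState (fun i => ω i + τ * ω (i + 1)) i) (s := univ) (t := 0)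
      (c := 1) k
      (by simpa [trackingState, errorField_zero] using hasDerivWithinAt_const (0 : ℝ) univ (0 : ℂ))
      (fun i _ => by simpa [speed_zero] using hline (ω i) (ω (i + 1)))
      (by simpa [speed_zero, trackingState] using hasDerivWithinAt_const (0 : ℝ) univ (0 : ℝ))
      (fun i _ => by simpa [trackingState] using hline (ω i) (ω (i + 1)))
    have h2 : HasDerivWithinAt (fun τ : ℝ => ω k + τ * ω (k + 1)) _ univ 0 :=
      h.congr (fun τ _ => (ih (fun i => ω i + τ * ω (i + 1))).symm)
        (ih (fun i => ω i + 0 * ω (i + 1))).symm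
    have h3 := (uniqueDiffWithinAt_univ (𝕜 := ℝ) (x := (0 : ℝ))).eq_deriv _
      h2 (hline (ω k) (ω (k + 1)))
    simp only [zero_mul, add_zero, one_mul, ih] at h3
    have e : trackingState ω (k + 1) = ω k := rfl
    rw [e] at h3
    linarith

/-- Functions on the half-line with `m` bounded derivatives, the last one continuous. -/
def BoundedDiff : ℕ → (ℝ → ℝ) → Prop
  | 0, f => (∃ C, ∀ t ∈ Ici (0 : ℝ), |f t| ≤ C) ∧ ContinuousOn f (Ici 0)
  | (m + 1), f => (∃ C, ∀ t ∈ Ici (0 : ℝ), |f t| ≤ C) ∧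
      ∃ f', (∀ t ∈ Ici (0 : ℝ), HasDerivWithinAt f (f' t) (Ici 0) t) ∧ BoundedDiff m f'

namespace BoundedDiff

lemma bounded {m : ℕ} {f : ℝ → ℝ} (hf : BoundedDiff m f) :
    ∃ C, ∀ t ∈ Ici (0 : ℝ), |f t| ≤ C := by
  cases m <;> exact hf.1

lemma continuousOn {m : ℕ} {f : ℝ → ℝ} (hf : BoundedDiff m f) : ContinuousOn f (Ici 0) := by
  cases m with
  | zero => exact hf.2
  | succ m =>
    obtain ⟨-, f', h, -⟩ := hf
    exact fun t ht => (h t ht).continuousWithinAt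

lemma zero {m : ℕ} {f : ℝ → ℝ} (hf : BoundedDiff m f) : BoundedDiff 0 f :=
  ⟨hf.bounded, hf.continuousOn⟩

lemma of_succ {m : ℕ} {f : ℝ → ℝ} (hf : BoundedDiff (m + 1) f) : BoundedDiff m f := by
  induction m generalizing f with
  | zero => exact hf.zero
  | succ m ih =>
    obtain ⟨h, f', h', hf'⟩ := hf
    exact ⟨h, f', h', ih hf'⟩

lemma add {m : ℕ} {f g : ℝ → ℝ} (hf : BoundedDiff m f) (hg : BoundedDiff m g) :
    BoundedDiff m (fun t => f t + g t) := by
  have hb : ∃ C, ∀ t ∈ Ici (0 : ℝ), |f t + g t| ≤ C := by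
    obtain ⟨C, hC⟩ := hf.bounded
    obtain ⟨D, hD⟩ := hg.bounded
    exact ⟨C + D, fun t ht => (abs_add_le _ _).trans (add_le_add (hC t ht) (hD t ht))⟩
  induction m generalizing f g with
  | zero => exact ⟨hb, hf.2.add hg.2⟩
  | succ m ih =>
    obtain ⟨-, f', h, hf'⟩ := hf
    obtain ⟨-, g', k, hg'⟩ := hg
    refine ⟨hb, fun t => f' t + g' t, fun t ht => (h t ht).add (k t ht), ih hf' hg' ?_⟩
    obtain ⟨C, hC⟩ := hf'.bounded
    obtain ⟨D, hD⟩ := hg'.bounded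
    exact ⟨C + D, fun t ht => (abs_add_le _ _).trans (add_le_add (hC t ht) (hD t ht))⟩

lemma abs_mul_bounded {f g : ℝ → ℝ} (hf : ∃ C, ∀ t ∈ Ici (0 : ℝ), |f t| ≤ C)
    (hg : ∃ C, ∀ t ∈ Ici (0 : ℝ), |g t| ≤ C) : ∃ C, ∀ t ∈ Ici (0 : ℝ), |f t * g t| ≤ C := by
  obtain ⟨C, hC⟩ := hf
  obtain ⟨D, hD⟩ := hg
  refine ⟨C * D, fun t ht => ?_⟩
  rw [abs_mul]
  exact mul_le_mul (hC t ht) (hD t ht) (abs_nonneg _) ((abs_nonneg _).trans (hC t ht))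

lemma mul {m : ℕ} {f g : ℝ → ℝ} (hf : BoundedDiff m f) (hg : BoundedDiff m g) :
    BoundedDiff m (fun t => f t * g t) := by
  have hb := abs_mul_bounded hf.bounded hg.bounded
  induction m generalizing f g with
  | zero => exact ⟨hb, hf.2.mul hg.2⟩
  | succ m ih =>
    have hf₁ := hf.of_succ
    have hg₁ := hg.of_succ
    obtain ⟨-, f', h, hf'⟩ := hf
    obtain ⟨-, g', k, hg'⟩ := hg
    exact ⟨hb, fun t => f' t * g t + f t * g' t, fun t ht => (h t ht).mul (k t ht),
      (ih hf' hg₁ (abs_mul_bounded hf'.bounded hg₁.bounded)).add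
        (ih hf₁ hg' (abs_mul_bounded hf₁.bounded hg'.bounded))⟩

lemma const (m : ℕ) (c : ℝ) : BoundedDiff m (fun _ => c) := by
  induction m generalizing c with
  | zero => exact ⟨⟨_, fun _ _ => le_rfl⟩, continuousOn_const⟩
  | succ m ih => exact ⟨⟨_, fun _ _ => le_rfl⟩, fun _ => 0, fun t _ => hasDerivWithinAt_const _ _ _,
      ih 0⟩

lemma neg {m : ℕ} {f : ℝ → ℝ} (hf : BoundedDiff m f) : BoundedDiff m (fun t => -f t) := by
  simpa using (const m (-1)).mul hf

lemma hasDerivWithinAt_inv_sqrt {a b : ℝ → ℝ} {a' b' : ℝ} {s : Set ℝ} {t : ℝ}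
    (ha : HasDerivWithinAt a a' s t) (hb : HasDerivWithinAt b b' s t)
    (h0 : 0 < a t ^ 2 + b t ^ 2) :
    HasDerivWithinAt (fun τ => (√(a τ ^ 2 + b τ ^ 2))⁻¹)
      (-((a t * a' + b t * b') * ((√(a t ^ 2 + b t ^ 2))⁻¹ * ((√(a t ^ 2 + b t ^ 2))⁻¹ *
        (√(a t ^ 2 + b t ^ 2))⁻¹)))) s t := by
  have h := (((ha.pow 2).add (hb.pow 2)).sqrt h0.ne').inv (Real.sqrt_pos.2 h0).ne'
  convert! h using 1
  have := (Real.sqrt_pos.2 h0).ne'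
  simp only [Pi.add_apply, Pi.pow_apply]
  field_simp
  ring

lemma inv_sqrt {m : ℕ} {a b : ℝ → ℝ} {c : ℝ} (hc : 0 < c) (ha : BoundedDiff m a)
    (hb : BoundedDiff m b) (h : ∀ t ∈ Ici (0 : ℝ), c ≤ √(a t ^ 2 + b t ^ 2)) :
    BoundedDiff m (fun t => (√(a t ^ 2 + b t ^ 2))⁻¹) := by
  have hbd : ∃ C, ∀ t ∈ Ici (0 : ℝ), |(√(a t ^ 2 + b t ^ 2))⁻¹| ≤ C := by
    refine ⟨c⁻¹, fun t ht => ?_⟩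
    rw [abs_of_nonneg (by positivity)]
    exact inv_anti₀ hc (h t ht)
  induction m with
  | zero =>
    exact ⟨hbd, ContinuousOn.inv₀ ((ha.2.pow 2).add (hb.2.pow 2)).sqrt fun t ht =>
      (hc.trans_le (h t ht)).ne'⟩
  | succ m ih =>
    have hg := ih ha.of_succ hb.of_succ
    have ha₁ := ha.of_succ
    have hb₁ := hb.of_succ
    obtain ⟨-, a', ha', ha''⟩ := ha
    obtain ⟨-, b', hb', hb''⟩ := hb
    exact ⟨hbd, _, fun t ht => hasDerivWithinAt_inv_sqrt (ha' t ht) (hb' t ht)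
      (Real.sqrt_pos.1 (hc.trans_le (h t ht))),
      (((ha₁.mul ha'').add (hb₁.mul hb'')).mul (hg.mul (hg.mul hg))).neg⟩

/-- Successive derivatives with respect to the time scale of rate `U`. -/
lemma exists_chain {m : ℕ} {f U : ℝ → ℝ} (hf : BoundedDiff m f)
    (hU : BoundedDiff m fun t => (U t)⁻¹) (hU0 : ∀ t ∈ Ici (0 : ℝ), U t ≠ 0) :
    ∃ ω : ℕ → ℝ → ℝ, ω 0 = f ∧ (∀ i, BoundedDiff 0 (ω i)) ∧
      ∀ i < m, ∀ t ∈ Ici (0 : ℝ), HasDerivWithinAt (ω i) (U t * ω (i + 1) t) (Ici 0) t := by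
  induction m generalizing f with
  | zero =>
    refine ⟨fun i => Nat.casesOn i f fun _ _ => 0, rfl, fun i => ?_, fun i hi => by omega⟩
    cases i with
    | zero => exact hf
    | succ i => exact const 0 0
  | succ m ih =>
    have hf₀ := hf.zero
    obtain ⟨-, f', h, hf'⟩ := hf
    obtain ⟨ω, h0, h1, h2⟩ := ih (hf'.mul hU.of_succ) hU.of_succ
    refine ⟨fun i => Nat.casesOn i f ω, rfl, fun i => ?_, fun i hi t ht => ?_⟩
    · cases i with
      | zero => exact hf₀
      | succ i => exact h1 i
    · cases i with
      | zero =>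
        have := hU0 t ht
        change HasDerivWithinAt f (U t * ω 0 t) (Ici 0) t
        rw [h0]
        convert! h t ht using 1
        field_simp
      | succ i => exact h2 i (by omega) t ht

end BoundedDiff

lemma exists_primitive {k : ℝ → ℝ} (hk : ContinuousOn k (Ici 0)) (c : ℝ) :
    ∃ W : ℝ → ℝ, W 0 = c ∧ ∀ t ∈ Ici (0 : ℝ), HasDerivWithinAt W (k t) (Ici 0) t := by
  have h : Continuous fun t => k (max t 0) :=
    hk.comp_continuous (by fun_prop) fun t => mem_Ici.2 (le_max_right _ _)
  refine ⟨fun t => c + ∫ τ in (0 : ℝ)..t, k (max τ 0), by simp, fun t ht => ?_⟩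
  have h1 := (h.integral_hasStrictDerivAt 0 t).hasDerivAt.hasDerivWithinAt (s := Ici 0)
  have h2 := h1.const_add c
  simpa [max_eq_left (mem_Ici.1 ht)] using h2

lemma eq_of_hasDerivWithinAt_zero {p : ℝ → ℝ}
    (hp : ∀ t ∈ Ici (0 : ℝ), HasDerivWithinAt p 0 (Ici 0) t) (t : ℝ) (ht : 0 ≤ t) : p t = p 0 :=
  constant_of_has_deriv_right_zero
    (fun τ hτ => (hp τ hτ.1).continuousWithinAt.mono Icc_subset_Ici_self)
    (fun τ hτ => (hp τ hτ.1).mono (Ici_subset_Ici.2 hτ.1)) t ⟨ht, le_rfl⟩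

/-- A rotating unit vector is given by the primitive of its angular velocity. -/
lemma eq_cos_sin {a b k W : ℝ → ℝ}
    (ha : ∀ t ∈ Ici (0 : ℝ), HasDerivWithinAt a (-(k t * b t)) (Ici 0) t)
    (hb : ∀ t ∈ Ici (0 : ℝ), HasDerivWithinAt b (k t * a t) (Ici 0) t)
    (hW : ∀ t ∈ Ici (0 : ℝ), HasDerivWithinAt W (k t) (Ici 0) t)
    (ha0 : a 0 = Real.cos (W 0)) (hb0 : b 0 = Real.sin (W 0)) (t : ℝ) (ht : 0 ≤ t) :
    a t = Real.cos (W t) ∧ b t = Real.sin (W t) := by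
  have hp : ∀ t ∈ Ici (0 : ℝ),
      HasDerivWithinAt (fun t => a t * Real.cos (W t) + b t * Real.sin (W t)) 0 (Ici 0) t := by
    intro t ht
    convert! ((ha t ht).mul (hW t ht).cos).add ((hb t ht).mul (hW t ht).sin) using 1
    ring
  have hq : ∀ t ∈ Ici (0 : ℝ),
      HasDerivWithinAt (fun t => b t * Real.cos (W t) - a t * Real.sin (W t)) 0 (Ici 0) t := by
    intro t ht
    convert! ((hb t ht).mul (hW t ht).cos).sub ((ha t ht).mul (hW t ht).sin) using 1
    ring
  have h1 := eq_of_hasDerivWithinAt_zero hp t ht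
  have h2 := eq_of_hasDerivWithinAt_zero hq t ht
  simp only [ha0, hb0] at h1 h2
  have h3 := Real.sin_sq_add_cos_sq (W 0)
  have h4 := Real.sin_sq_add_cos_sq (W t)
  constructor
  · linear_combination Real.cos (W t) * h1 - Real.sin (W t) * h2 - a t * h4 +
      Real.cos (W t) * h3
  · linear_combination Real.sin (W t) * h1 + Real.cos (W t) * h2 - b t * h4 +
      Real.sin (W t) * h3

/-- Heading, speed and iterated curvatures of a regular planar curve. -/
structure IsReference (m : ℕ) (U W : ℝ → ℝ) (ω : ℕ → ℝ → ℝ) : Prop where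
  continuousOn_speed : ContinuousOn U (Ici 0)
  exists_le : ∃ c > 0, ∀ t ∈ Ici (0 : ℝ), c ≤ U t
  exists_ge : ∃ C, ∀ t ∈ Ici (0 : ℝ), U t ≤ C
  heading : ∀ t ∈ Ici (0 : ℝ), HasDerivWithinAt W (U t * ω 0 t) (Ici 0) t
  bounded : ∀ i, ∃ C, ∀ t ∈ Ici (0 : ℝ), |ω i t| ≤ C
  continuousOn : ∀ i, ContinuousOn (ω i) (Ici 0)
  curvature : ∀ i < m, ∀ t ∈ Ici (0 : ℝ),
    HasDerivWithinAt (ω i) (U t * ω (i + 1) t) (Ici 0) t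

theorem exists_isReference {m : ℕ} {a b : ℝ → ℝ} (ha : BoundedDiff (m + 1) a)
    (hb : BoundedDiff (m + 1) b) {c : ℝ} (hc : 0 < c)
    (h : ∀ t ∈ Ici (0 : ℝ), c ≤ √(a t ^ 2 + b t ^ 2)) :
    ∃ U W ω, IsReference m U W ω ∧
      ∀ t ∈ Ici (0 : ℝ), a t = U t * Real.cos (W t) ∧ b t = U t * Real.sin (W t) := by
  set U : ℝ → ℝ := fun t => √(a t ^ 2 + b t ^ 2) with hU
  have hUpos : ∀ t ∈ Ici (0 : ℝ), 0 < U t := fun t ht => hc.trans_le (h t ht)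
  have hUsq : ∀ t, U t ^ 2 = a t ^ 2 + b t ^ 2 := fun t => Real.sq_sqrt (by positivity)
  have hg : BoundedDiff (m + 1) fun t => (U t)⁻¹ := BoundedDiff.inv_sqrt hc ha hb h
  have hg₁ := hg.of_succ
  have ha₁ := ha.of_succ
  have hb₁ := hb.of_succ
  obtain ⟨⟨A, hA⟩, a', ha', ha''⟩ := id ha
  obtain ⟨⟨B, hB⟩, b', hb', hb''⟩ := id hb
  obtain ⟨ω, hω0, hω, hchain⟩ := BoundedDiff.exists_chain (U := U)
    (((ha₁.mul hb'').add (hb₁.mul ha'').neg).mul (hg₁.mul (hg₁.mul hg₁))) hg₁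
    fun t ht => (hUpos t ht).ne'
  have hUcont : ContinuousOn U (Ici 0) :=
    ((ha.continuousOn.pow 2).add (hb.continuousOn.pow 2)).sqrt
  obtain ⟨W, hW0, hW⟩ := exists_primitive (hUcont.mul (hω 0).continuousOn)
    (Complex.arg (a 0 + b 0 * Complex.I))
  have hnorm : ‖(a 0 + b 0 * Complex.I : ℂ)‖ = U 0 := Complex.norm_add_mul_I _ _
  have hne : (a 0 + b 0 * Complex.I : ℂ) ≠ 0 := by
    rw [← norm_pos_iff, hnorm]; exact hUpos 0 self_mem_Ici
  refine ⟨U, W, ω, ⟨hUcont, ⟨c, hc, h⟩, ⟨A + B, fun t ht => ?_⟩, hW, fun i => (hω i).bounded,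
    fun i => (hω i).continuousOn, hchain⟩, fun t ht => ?_⟩
  · have h1 := hA t ht
    have h2 := hB t ht
    refine Real.sqrt_le_iff.2 ⟨by linarith [abs_nonneg (a t), abs_nonneg (b t)], ?_⟩
    rw [← sq_abs (a t), ← sq_abs (b t)]
    nlinarith [abs_nonneg (a t), abs_nonneg (b t), mul_nonneg (abs_nonneg (a t)) (abs_nonneg (b t))]
  · have hd : ∀ t ∈ Ici (0 : ℝ), HasDerivWithinAt (fun t => (U t)⁻¹)
        (-((a t * a' t + b t * b' t) * ((U t)⁻¹ * ((U t)⁻¹ * (U t)⁻¹)))) (Ici 0) t :=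
      fun t ht => BoundedDiff.hasDerivWithinAt_inv_sqrt (ha' t ht) (hb' t ht)
        (Real.sqrt_pos.1 (hUpos t ht))
    have key := eq_cos_sin (a := fun t => a t * (U t)⁻¹) (b := fun t => b t * (U t)⁻¹)
      (k := fun t => U t * ω 0 t) (W := W)
      (fun t ht => by
        convert! (ha' t ht).mul (hd t ht) using 1
        have := (hUpos t ht).ne'
        rw [hω0]
        field_simp
        linear_combination (-a' t) * hUsq t)
      (fun t ht => by
        convert! (hb' t ht).mul (hd t ht) using 1
        have := (hUpos t ht).ne'
        rw [hω0]
        field_simp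
        linear_combination (-b' t) * hUsq t)
      hW (by simp [hW0, Complex.cos_arg hne, hnorm, div_eq_mul_inv])
      (by simp [hW0, Complex.sin_arg, hnorm, div_eq_mul_inv]) t ht
    have := (hUpos t ht).ne'
    rw [← key.1, ← key.2]
    constructor <;> field_simp

/-- Global solvability for bounded, globally Lipschitz time-dependent vector fields. -/
theorem exists_forall_hasDerivWithinAt_Ici {E : Type*} [NormedAddCommGroup E] [NormedSpace ℝ E]
    [CompleteSpace E] {f : ℝ → E → E} {K M : ℝ≥0}
    (hlip : ∀ t ∈ Ici (0 : ℝ), LipschitzWith K (f t))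
    (hcont : ∀ x, ContinuousOn (fun t => f t x) (Ici 0))
    (hbound : ∀ t ∈ Ici (0 : ℝ), ∀ x, ‖f t x‖ ≤ M) (x₀ : E) :
    ∃ γ : ℝ → E, γ 0 = x₀ ∧
      ∀ t ∈ Ici (0 : ℝ), HasDerivWithinAt γ (f t (γ t)) (Ici 0) t := by
  have hex : ∀ N : ℕ, ∃ γ : ℝ → E, γ 0 = x₀ ∧
      ∀ t ∈ Icc (0 : ℝ) N, HasDerivWithinAt γ (f t (γ t)) (Icc 0 N) t := by
    intro N
    have hN : (0 : ℝ) ≤ N := N.cast_nonneg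
    have hPL : IsPicardLindelof f (⟨0, le_rfl, hN⟩ : Icc (0 : ℝ) N) x₀ (M * N) 0 M K :=
      { lipschitzOnWith := fun t ht => (hlip t ht.1).lipschitzOnWith
        continuousOn := fun x _ => (hcont x).mono Icc_subset_Ici_self
        norm_le := fun t ht x _ => hbound t ht.1 x
        mul_max_le := by simp }
    exact hPL.exists_eq_forall_mem_Icc_hasDerivWithinAt₀
  choose γ hγ0 hγ using hex
  have heq : ∀ (N N' : ℕ) (t : ℝ), 0 ≤ t → t ≤ N → t ≤ N' → γ N t = γ N' t := by
    intro N N' t h0 h1 h2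
    have aux : ∀ N : ℕ, t ≤ N → ContinuousOn (γ N) (Icc 0 t) ∧
        ∀ τ ∈ Ico (0 : ℝ) t, HasDerivWithinAt (γ N) (f (max τ 0) (γ N τ)) (Ici τ) τ := by
      intro N hN
      refine ⟨fun τ hτ => ((hγ N τ ⟨hτ.1, hτ.2.trans hN⟩).continuousWithinAt).mono
        (Icc_subset_Icc_right hN), fun τ hτ => ?_⟩
      rw [max_eq_left hτ.1]
      refine (hγ N τ ⟨hτ.1, hτ.2.le.trans hN⟩).mono_of_mem_nhdsWithin ?_
      filter_upwards [self_mem_nhdsWithin, mem_nhdsWithin_of_mem_nhds (Iio_mem_nhds hτ.2)]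
        with σ hσ hσ' using ⟨hτ.1.trans hσ, (le_of_lt hσ').trans hN⟩
    exact ODE_solution_unique (v := fun t => f (max t 0)) (fun t => hlip _ (mem_Ici.2 (le_max_right _ _)))
      (aux N h1).1 (aux N h1).2 (aux N' h2).1 (aux N' h2).2 (by rw [hγ0, hγ0])
      ⟨h0, le_rfl⟩
  have hval : ∀ (N : ℕ) (t : ℝ), 0 ≤ t → t ≤ N → γ ⌈t⌉₊ t = γ N t :=
    fun N t h0 h1 => heq _ _ t h0 (Nat.le_ceil t) h1
  refine ⟨fun t => γ ⌈t⌉₊ t, by simp [hγ0], fun t ht => ?_⟩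
  have h1 : t < (⌈t⌉₊ + 1 : ℕ) := by push_cast; linarith [Nat.le_ceil t]
  have h2 := (hγ (⌈t⌉₊ + 1) t ⟨ht, h1.le⟩).congr (fun τ hτ => hval _ τ hτ.1 hτ.2)
    (hval _ t ht h1.le)
  rw [← hval _ t ht h1.le] at h2
  refine h2.mono_of_mem_nhdsWithin ?_
  filter_upwards [self_mem_nhdsWithin, mem_nhdsWithin_of_mem_nhds (Iio_mem_nhds h1)]
    with σ hσ hσ' using ⟨hσ, le_of_lt hσ'⟩

lemma exists_bound_of_tendsto {E : Type*} [NormedAddCommGroup E] {f : ℝ → E} {l : E}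
    (hf : ContinuousOn f (Ici 0)) (hl : Tendsto f atTop (𝓝 l)) :
    ∃ C, ∀ t ∈ Ici (0 : ℝ), ‖f t‖ ≤ C := by
  obtain ⟨T, hT⟩ := eventually_atTop.1 (hl.norm.eventually (gt_mem_nhds (lt_add_one ‖l‖)))
  obtain ⟨C, hC⟩ := isCompact_Icc.exists_bound_of_continuousOn
    (hf.mono fun t (ht : t ∈ Icc 0 T) => ht.1)
  refine ⟨max C (‖l‖ + 1), fun t ht => ?_⟩
  rcases le_total t T with h | h
  · exact (hC t ⟨ht, h⟩).trans (le_max_left _ _)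
  · exact (hT t h).le.trans (le_max_right _ _)

open Polynomial in
/-- A finite chain of exponentially decaying functions with prescribed initial values. -/
lemma exists_decaying_chain (n : ℕ) (c : ℕ → ℝ) :
    ∃ g : ℕ → ℝ → ℝ, (∀ k s, HasDerivAt (g k) (-g k s + g (k + 1) s) s) ∧
      (∀ k < n, g k 0 = c k) ∧ (∀ k, n ≤ k → ∀ s, g k s = 0) ∧
      ∀ k, ∃ C, ∀ s ∈ Ici (0 : ℝ), |g k s| ≤ C * Real.exp (-(s / 2)) := by
  set p : ℝ[X] := ∑ j ∈ Finset.range n, C (c j / j.factorial) * X ^ j with hp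
  have hcoeff : ∀ k, p.coeff k = if k < n then c k / k.factorial else 0 := by
    intro k
    simp [hp, Polynomial.coeff_X_pow]
  refine ⟨fun k s => Real.exp (-s) * (derivative^[k] p).eval s, fun k s => ?_, fun k hk => ?_,
    fun k hk s => ?_, fun k => ?_⟩
  · have h1 := ((hasDerivAt_id s).neg.exp).mul ((derivative^[k] p).hasDerivAt s)
    convert! h1 using 1
    simp [Function.iterate_succ_apply']
  · have h1 : (derivative^[k] p).eval 0 = c k := by
      rw [← Polynomial.coeff_zero_eq_eval_zero, Polynomial.coeff_iterate_derivative, zero_add,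
        hcoeff, if_pos hk, Nat.descFactorial_self, nsmul_eq_mul]
      field_simp
    simp [h1]
  · have h1 : derivative^[k] p = 0 := by
      ext i
      rw [Polynomial.coeff_iterate_derivative, hcoeff, if_neg (by omega)]
      simp
    simp [h1]
  · set q := (derivative^[k] p).comp (C 2 * X) with hq
    have h1 := q.tendsto_div_exp_atTop.comp
      (tendsto_id.atTop_div_const (show (0 : ℝ) < 2 by norm_num))
    obtain ⟨D, hD⟩ := exists_bound_of_tendsto (Continuous.continuousOn (by
      unfold Function.comp
      exact (q.continuous.comp (by fun_prop)).div (Real.continuous_exp.comp (by fun_prop))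
        fun x => (Real.exp_pos _).ne')) h1
    refine ⟨D, fun s hs => ?_⟩
    have h2 := hD s hs
    have h3 : q.eval (s / 2) = (derivative^[k] p).eval s := by
      rw [hq]; simp [Polynomial.eval_comp, mul_div_cancel₀]
    simp only [Function.comp, id, h3, Real.norm_eq_abs, abs_div, Real.abs_exp] at h2
    rw [div_le_iff₀ (Real.exp_pos _)] at h2
    rw [abs_mul, Real.abs_exp]
    calc Real.exp (-s) * |(derivative^[k] p).eval s|
        ≤ Real.exp (-s) * (D * Real.exp (s / 2)) := by gcongr
      _ = D * Real.exp (-(s / 2)) := by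
        rw [mul_left_comm, ← Real.exp_add]; congr 2; ring

lemma le_exp_of_deriv_le {V V' : ℝ → ℝ} {k κ B : ℝ} (hk : k < κ) (hB : 0 ≤ B)
    (hV : ∀ t ∈ Ici (0 : ℝ), HasDerivWithinAt V (V' t) (Ici 0) t)
    (hle : ∀ t ∈ Ici (0 : ℝ), V' t ≤ -(k * V t) + B * Real.exp (-(κ * t))) (t : ℝ) (ht : 0 ≤ t) :
    V t ≤ (V 0 + B / (κ - k)) * Real.exp (-(k * t)) := by
  have hd : ∀ t ∈ Ici (0 : ℝ), HasDerivWithinAt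
      (fun t => V t * Real.exp (k * t) + B / (κ - k) * Real.exp (-((κ - k) * t)))
      (V' t * Real.exp (k * t) + V t * (Real.exp (k * t) * k) +
        B / (κ - k) * (Real.exp (-((κ - k) * t)) * (-(κ - k)))) (Ici 0) t := by
    intro t ht
    have h1 : HasDerivAt (fun t : ℝ => k * t) k t := by
      simpa using (hasDerivAt_id t).const_mul k
    have h2 : HasDerivAt (fun t : ℝ => -((κ - k) * t)) (-(κ - k)) t := by
      simpa using! ((hasDerivAt_id t).const_mul (κ - k)).neg
    exact ((hV t ht).mul h1.exp.hasDerivWithinAt).add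
      (h2.exp.const_mul (B / (κ - k))).hasDerivWithinAt
  have hanti := antitoneOn_of_deriv_nonpos (convex_Ici (0 : ℝ))
    (fun t ht => (hd t ht).continuousWithinAt)
    (fun t ht => ((hd t (interior_subset ht)).differentiableWithinAt).mono interior_subset)
    (fun t ht => by
      rw [interior_Ici] at ht
      have h0 : t ∈ Ici (0 : ℝ) := mem_Ici.2 (le_of_lt ht)
      rw [((hd t h0).hasDerivAt (Ici_mem_nhds ht)).deriv]
      have h1 := mul_le_mul_of_nonneg_right (hle t h0) (Real.exp_pos (k * t)).le
      have h2 : Real.exp (-(κ * t)) * Real.exp (k * t) = Real.exp (-((κ - k) * t)) := by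
        rw [← Real.exp_add]; ring_nf
      have h3 : B / (κ - k) * (Real.exp (-((κ - k) * t)) * (-(κ - k))) =
          -(B * Real.exp (-((κ - k) * t))) := by
        have : κ - k ≠ 0 := (sub_pos.2 hk).ne'
        field_simp
      rw [h3, ← h2]
      linarith)
  have h := hanti self_mem_Ici (mem_Ici.2 ht) ht
  simp only [mul_zero, Real.exp_zero, mul_one, neg_zero] at h
  have h2 : 0 ≤ B / (κ - k) * Real.exp (-((κ - k) * t)) :=
    mul_nonneg (div_nonneg hB (sub_pos.2 hk).le) (Real.exp_pos _).le
  rw [Real.exp_neg, ← div_eq_mul_inv, le_div_iff₀ (Real.exp_pos _)]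
  linarith

lemma tendsto_comp_sub_comp {E F : Type*} [NormedAddCommGroup E] [NormedAddCommGroup F]
    {f : E → F} (hf : Continuous f) {K : Set E} (hK : IsCompact K) {l : Filter ℝ} {a b : ℝ → E}
    (hb : ∀ᶠ t in l, b t ∈ K) (hab : Tendsto (fun t => a t - b t) l (𝓝 0)) :
    Tendsto (fun t => f (a t) - f (b t)) l (𝓝 0) := by
  rw [Metric.tendsto_nhds]
  intro δ hδ
  have h := hK.uniformContinuousAt_of_continuousAt f (fun x _ => hf.continuousAt)
    (Metric.dist_mem_uniformity hδ)
  obtain ⟨ρ, hρ, hρ'⟩ := Metric.mem_uniformity_dist.1 h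
  filter_upwards [hb, Metric.tendsto_nhds.1 hab ρ hρ] with t h1 h2
  have h3 := hρ' (a := b t) (b := a t) (by simpa [dist_eq_norm, norm_sub_rev] using h2) h1
  simpa [dist_eq_norm, norm_sub_rev] using h3

/-- The state of the `k`-th stage in terms of the deviations `γ` from the targets. -/
noncomputable def feedbackPoint : (k : ℕ) → ℂ → (ℕ → ℝ) → (ℕ → ℝ) → (jet k).E
  | 0, z, ω, γ => ((z, ω 0, heading z + γ 0) : ℂ × ℝ × ℝ)
  | (k + 1), z, ω, γ => ((feedbackPoint k z ω γ, ω (k + 1),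
      (jet k).target (feedbackPoint k z ω γ) + γ (k + 1)) : (jet k).E × ℝ × ℝ)

/-- The heading error and curvature derivatives with deviations `γ` from the targets. -/
noncomputable def feedbackState (z : ℂ) (ω γ : ℕ → ℝ) : ℕ → ℝ
  | 0 => heading z + γ 0
  | (k + 1) => (jet k).target (feedbackPoint k z ω γ) + γ (k + 1)

lemma point_feedbackState (k : ℕ) (z : ℂ) (ω γ : ℕ → ℝ) :
    point k z ω (feedbackState z ω γ) = feedbackPoint k z ω γ := by
  induction k with
  | zero => rfl
  | succ k ih => exact Prod.ext ih rfl

/-- The deviations of a state from the targets. -/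
noncomputable def deviation (z : ℂ) (ω w : ℕ → ℝ) : ℕ → ℝ
  | 0 => w 0 - heading z
  | (k + 1) => w (k + 1) - (jet k).target (point k z ω w)

lemma feedbackPoint_deviation (k : ℕ) (z : ℂ) (ω w γ : ℕ → ℝ)
    (h : ∀ i ≤ k, γ i = deviation z ω w i) : feedbackPoint k z ω γ = point k z ω w := by
  induction k with
  | zero =>
    refine Prod.ext rfl (Prod.ext rfl ?_)
    change heading z + γ 0 = w 0
    rw [h 0 le_rfl, deviation]; ring
  | succ k ih =>
    have ih' := ih fun i hi => h i (by omega)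
    refine Prod.ext ih' (Prod.ext rfl ?_)
    change (jet k).target (feedbackPoint k z ω γ) + γ (k + 1) = w (k + 1)
    rw [h _ le_rfl, ih', deviation]; ring

lemma feedbackState_deviation (k : ℕ) (z : ℂ) (ω w γ : ℕ → ℝ)
    (h : ∀ i ≤ k, γ i = deviation z ω w i) : feedbackState z ω γ k = w k := by
  cases k with
  | zero => rw [feedbackState, h 0 le_rfl, deviation]; ring
  | succ k =>
    rw [feedbackState, h _ le_rfl, feedbackPoint_deviation k z ω w γ fun i hi => h i (by omega),
      deviation]
    ring

lemma continuous_trackingState : Continuous trackingState := by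
  refine continuous_pi fun i => ?_
  cases i with
  | zero => exact continuous_const
  | succ i => exact continuous_apply i

lemma tendsto_triple_sub {A : Type*} [NormedAddCommGroup A] {l : Filter ℝ} {a b : ℝ → A}
    {x y x' y' : ℝ → ℝ} (h : Tendsto (fun t => a t - b t) l (𝓝 0))
    (hx : Tendsto (fun t => x t - x' t) l (𝓝 0)) (hy : Tendsto (fun t => y t - y' t) l (𝓝 0)) :
    Tendsto (fun t => ((a t, x t, y t) : A × ℝ × ℝ) - (b t, x' t, y' t)) l (𝓝 0) :=
  h.prodMk_nhds (hx.prodMk_nhds hy)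

lemma tendsto_feedbackPoint {η : ℝ → ℂ} {ω γ : ℕ → ℝ → ℝ}
    (hω : ∀ i, ∃ C, ∀ t ∈ Ici (0 : ℝ), |ω i t| ≤ C) (hη : Tendsto η atTop (𝓝 0))
    (hγ : ∀ i, Tendsto (γ i) atTop (𝓝 0)) (k : ℕ) :
    Tendsto (fun t => feedbackPoint k (η t) (fun i => ω i t) (fun i => γ i t) -
      point k 0 (fun i => ω i t) (trackingState fun i => ω i t)) atTop (𝓝 0) ∧
    Tendsto (fun t => (jet k).target (feedbackPoint k (η t) (fun i => ω i t) (fun i => γ i t)) -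
      ω k t) atTop (𝓝 0) := by
  have key : ∀ k, Tendsto (fun t => feedbackPoint k (η t) (fun i => ω i t) (fun i => γ i t) -
      point k 0 (fun i => ω i t) (trackingState fun i => ω i t)) atTop (𝓝 0) →
      Tendsto (fun t => (jet k).target (feedbackPoint k (η t) (fun i => ω i t) (fun i => γ i t)) -
        ω k t) atTop (𝓝 0) := by
    intro k hk
    choose C hC using hω
    have hcompact : IsCompact ((fun ω : ℕ → ℝ => point k 0 ω (trackingState ω)) ''
        univ.pi fun i => Icc (-C i) (C i)) :=
      (isCompact_univ_pi fun i => isCompact_Icc).image ((continuous_point k).comp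
        (continuous_const.prodMk (continuous_id.prodMk continuous_trackingState)))
    have h := tendsto_comp_sub_comp (jet k).contDiff_target.continuous hcompact
      (by
        filter_upwards [eventually_ge_atTop 0] with t ht
        exact ⟨fun i => ω i t, fun i _ => abs_le.1 (hC i t ht), rfl⟩) hk
    simpa only [target_trackingState] using h
  suffices h : Tendsto (fun t => feedbackPoint k (η t) (fun i => ω i t) (fun i => γ i t) -
      point k 0 (fun i => ω i t) (trackingState fun i => ω i t)) atTop (𝓝 0) from ⟨h, key k h⟩
  induction k with
  | zero =>
    have h1 := (contDiff_heading.continuous.tendsto' 0 0 heading_zero).comp hη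
    refine tendsto_triple_sub (by simpa using hη)
      (tendsto_const_nhds.congr fun t => (sub_self _).symm) ?_
    have h2 := h1.add (hγ 0)
    rw [add_zero] at h2
    exact h2.congr fun t => (sub_zero _).symm
  | succ k ih =>
    refine tendsto_triple_sub ih (tendsto_const_nhds.congr fun t => (sub_self _).symm) ?_
    have h2 := (key k ih).add (hγ (k + 1))
    rw [add_zero] at h2
    exact h2.congr fun t => sub_add_eq_add_sub _ _ _

lemma norm_exp_mul_I_sub_le (a b : ℝ) :
    ‖Complex.exp (a * Complex.I) - Complex.exp (b * Complex.I)‖ ≤ |a - b| := by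
  have h : Complex.exp (a * Complex.I) - Complex.exp (b * Complex.I) =
      Complex.exp (b * Complex.I) * (Complex.exp (Complex.I * (a - b : ℝ)) - 1) := by
    rw [mul_sub, ← Complex.exp_add]
    congr 2
    · push_cast; ring
    · ring
  rw [h, norm_mul, Complex.norm_exp_ofReal_mul_I, one_mul]
  exact Real.norm_exp_I_mul_ofReal_sub_one_le

lemma norm_exp_sub_sat_le (a : ℝ) (z : ℂ) : ‖Complex.exp (a * Complex.I) - sat z‖ ≤ 3 / 2 := by
  have h1 := norm_sub_le (Complex.exp (a * Complex.I)) (sat z)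
  have h2 := norm_sat_le z
  rw [Complex.norm_exp_ofReal_mul_I] at h1
  linarith

/-- Velocity of the position error when the heading deviates by `δ` from the guidance law. -/
noncomputable def guidanceField (θ δ : ℝ) (z : ℂ) : ℂ :=
  Complex.exp (δ * Complex.I) * (Complex.exp (θ * Complex.I) - sat z) -
    Complex.exp (θ * Complex.I)

lemma norm_guidanceField_le (θ δ : ℝ) (z : ℂ) : ‖guidanceField θ δ z‖ ≤ 5 / 2 := by
  refine (norm_sub_le _ _).trans ?_
  rw [norm_mul, Complex.norm_exp_ofReal_mul_I, Complex.norm_exp_ofReal_mul_I]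
  linarith [norm_exp_sub_sat_le θ z]

lemma norm_guidanceField_sub_le (θ δ δ' : ℝ) (z z' : ℂ) :
    ‖guidanceField θ δ z - guidanceField θ δ' z'‖ ≤ 3 / 2 * |δ - δ'| + ‖z - z'‖ := by
  have e : guidanceField θ δ z - guidanceField θ δ' z' =
      (Complex.exp (δ * Complex.I) - Complex.exp (δ' * Complex.I)) *
        (Complex.exp (θ * Complex.I) - sat z) -
      Complex.exp (δ' * Complex.I) * (sat z - sat z') := by
    unfold guidanceField; ring
  rw [e]
  refine (norm_sub_le _ _).trans ?_
  rw [norm_mul, norm_mul, Complex.norm_exp_ofReal_mul_I, one_mul, mul_comm]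
  have h := sat_lipschitz.dist_le_mul z z'
  rw [dist_eq_norm, dist_eq_norm, NNReal.coe_one, one_mul] at h
  exact add_le_add (mul_le_mul (norm_exp_sub_sat_le θ z) (norm_exp_mul_I_sub_le δ δ')
    (norm_nonneg _) (by norm_num)) h

lemma exists_guidance {m : ℕ} {U W : ℝ → ℝ} {ω : ℕ → ℝ → ℝ} (h : IsReference m U W ω)
    {g g' : ℝ → ℝ} (hg : ∀ s, HasDerivAt g (g' s) s) {L : ℝ}
    (hL : ∀ s ∈ Ici (0 : ℝ), |g' s| ≤ L) (e₀ : ℂ) :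
    ∃ (e : ℝ → ℂ) (s : ℝ → ℝ), e 0 = e₀ ∧ s 0 = 0 ∧
      (∀ t ∈ Ici (0 : ℝ), 0 ≤ s t) ∧
      (∀ t ∈ Ici (0 : ℝ),
        HasDerivWithinAt e (U t • guidanceField (W t) (g (s t)) (e t)) (Ici 0) t) ∧
      ∀ t ∈ Ici (0 : ℝ), HasDerivWithinAt s
        (U t * speed (e t * Complex.exp (-(W t * Complex.I)))) (Ici 0) t := by
  obtain ⟨c, hc, hcU⟩ := h.exists_le
  obtain ⟨C, hCU⟩ := h.exists_ge
  have hU0 : ∀ t ∈ Ici (0 : ℝ), 0 ≤ U t := fun t ht => hc.le.trans (hcU t ht)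
  have hC0 : 0 ≤ C := (hU0 0 self_mem_Ici).trans (hCU 0 self_mem_Ici)
  have hL0 : 0 ≤ L := (abs_nonneg _).trans (hL 0 self_mem_Ici)
  have hWc : ContinuousOn W (Ici 0) := fun t ht => (h.heading t ht).continuousWithinAt
  have hexp : ∀ t, ‖Complex.exp (-(W t * Complex.I))‖ = 1 := fun t => by
    have := Complex.norm_exp_ofReal_mul_I (-W t)
    rwa [Complex.ofReal_neg, neg_mul] at this
  have hgL : ∀ a b, |g (max a 0) - g (max b 0)| ≤ L * |a - b| := fun a b => by
    have h1 := Convex.norm_image_sub_le_of_norm_hasDerivWithin_le (f := g) (f' := g')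
      (s := Ici (0 : ℝ)) (fun s _ => (hg s).hasDerivWithinAt) hL (convex_Ici 0)
      (mem_Ici.2 (le_max_right b 0)) (mem_Ici.2 (le_max_right a 0))
    exact h1.trans (mul_le_mul_of_nonneg_left (abs_max_sub_max_le_abs a b 0) hL0)
  set f : ℝ → ℂ × ℝ → ℂ × ℝ := fun t p =>
    (U t • guidanceField (W t) (g (max p.2 0)) p.1,
      U t * speed (p.1 * Complex.exp (-(W t * Complex.I)))) with hf
  have hlip : ∀ t ∈ Ici (0 : ℝ), LipschitzWith (C * (3 / 2 * L + 1)).toNNReal (f t) := by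
    intro t ht
    refine LipschitzWith.of_dist_le_mul fun p q => ?_
    rw [Real.coe_toNNReal _ (by positivity), dist_eq_norm, dist_eq_norm]
    have h1 : ‖p.1 - q.1‖ ≤ ‖p - q‖ := norm_fst_le (p - q)
    have h2 : |p.2 - q.2| ≤ ‖p - q‖ := norm_snd_le (p - q)
    refine norm_prod_le_iff.2 ⟨?_, ?_⟩
    · change ‖U t • _ - U t • _‖ ≤ _
      rw [← smul_sub, norm_smul, Real.norm_of_nonneg (hU0 t ht), mul_assoc]
      refine mul_le_mul (hCU t ht) ?_ (norm_nonneg _) hC0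
      have h3 := norm_guidanceField_sub_le (W t) (g (max p.2 0)) (g (max q.2 0)) p.1 q.1
      have h4 := hgL p.2 q.2
      have h5 := mul_le_mul_of_nonneg_left h2 hL0
      linarith
    · change ‖U t * _ - U t * _‖ ≤ _
      rw [← mul_sub, norm_mul, Real.norm_of_nonneg (hU0 t ht), mul_assoc]
      refine mul_le_mul (hCU t ht) ?_ (norm_nonneg _) hC0
      refine (speed_lipschitz _ _).trans ?_
      rw [← sub_mul, norm_mul, hexp, mul_one]
      nlinarith [norm_nonneg (p - q), mul_nonneg hL0 (norm_nonneg (p - q))]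
  have hbound : ∀ t ∈ Ici (0 : ℝ), ∀ p, ‖f t p‖ ≤ ((C * (5 / 2)).toNNReal : ℝ) := by
    intro t ht p
    rw [Real.coe_toNNReal _ (by positivity)]
    refine norm_prod_le_iff.2 ⟨?_, ?_⟩
    · change ‖U t • _‖ ≤ _
      rw [norm_smul, Real.norm_of_nonneg (hU0 t ht)]
      exact mul_le_mul (hCU t ht) (norm_guidanceField_le _ _ _) (norm_nonneg _) hC0
    · change ‖U t * _‖ ≤ _
      rw [norm_mul, Real.norm_of_nonneg (hU0 t ht), Real.norm_of_nonneg (speed_pos _).le]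
      exact mul_le_mul (hCU t ht) ((speed_le _).trans (by norm_num)) (speed_pos _).le hC0
  have hcont : ∀ p, ContinuousOn (fun t => f t p) (Ici 0) := by
    intro p
    have h1 : ContinuousOn (fun t => (W t : ℂ)) (Ici 0) :=
      Complex.continuous_ofReal.comp_continuousOn hWc
    have h2 : ContinuousOn (fun t => Complex.exp (W t * Complex.I)) (Ici 0) :=
      (h1.mul continuousOn_const).cexp
    have h3 : ContinuousOn (fun t => Complex.exp (-(W t * Complex.I))) (Ici 0) :=
      (h1.mul continuousOn_const).neg.cexp
    exact (h.continuousOn_speed.smul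
      ((continuousOn_const.mul (h2.sub continuousOn_const)).sub h2)).prodMk
      (h.continuousOn_speed.mul (contDiff_speed.continuous.comp_continuousOn
        (continuousOn_const.mul h3)))
  obtain ⟨γ, hγ0, hγ⟩ := exists_forall_hasDerivWithinAt_Ici hlip hcont hbound (e₀, 0)
  have he : ∀ t ∈ Ici (0 : ℝ), HasDerivWithinAt (fun t => (γ t).1)
      (U t • guidanceField (W t) (g (max (γ t).2 0)) (γ t).1) (Ici 0) t := fun t ht => (hγ t ht).fst
  have hs : ∀ t ∈ Ici (0 : ℝ), HasDerivWithinAt (fun t => (γ t).2)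
      (U t * speed ((γ t).1 * Complex.exp (-(W t * Complex.I)))) (Ici 0) t :=
    fun t ht => (hγ t ht).snd
  have hs0 : ∀ t ∈ Ici (0 : ℝ), 0 ≤ (γ t).2 := by
    intro t ht
    have := le_exp_of_deriv_le (V := fun t => -(γ t).2) zero_lt_one le_rfl
      (fun t ht => (hs t ht).neg) (fun t ht => by
        have := mul_nonneg (hU0 t ht) (speed_pos ((γ t).1 * Complex.exp (-(W t * Complex.I)))).le
        simpa using this) t ht
    simpa [hγ0] using this
  refine ⟨fun t => (γ t).1, fun t => (γ t).2, by simp [hγ0], by simp [hγ0], hs0, fun t ht => ?_, hs⟩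
  have := he t ht
  rwa [max_eq_left (hs0 t ht)] at this

lemma tendsto_guidance {U θ δ : ℝ → ℝ} {e : ℝ → ℂ} {c C D κ : ℝ} (hc : 0 < c) (hκ : 0 < κ)
    (hcU : ∀ t ∈ Ici (0 : ℝ), c ≤ U t) (hCU : ∀ t ∈ Ici (0 : ℝ), U t ≤ C)
    (hδ : ∀ t ∈ Ici (0 : ℝ), |δ t| ≤ D * Real.exp (-(κ * t)))
    (he : ∀ t ∈ Ici (0 : ℝ),
      HasDerivWithinAt e (U t • guidanceField (θ t) (δ t) (e t)) (Ici 0) t) :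
    Tendsto e atTop (𝓝 0) := by
  have hC : 0 < C := hc.trans_le ((hcU 0 self_mem_Ici).trans (hCU 0 self_mem_Ici))
  have hD : 0 ≤ D := by simpa using (abs_nonneg _).trans (hδ 0 self_mem_Ici)
  set ν : ℝ → ℝ := fun t => √(1 + ‖e t‖ ^ 2) with hν
  have hν1 : ∀ t, 1 ≤ ν t := fun t => one_le_sqrt_one_add_sq _
  have heν : ∀ t, ‖e t‖ ≤ ν t := fun t => le_sqrt_one_add_sq _
  set q : ℝ → ℝ := fun t => inner ℝ (e t) (guidanceField (θ t) (δ t) (e t)) with hq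
  have hqle : ∀ t ∈ Ici (0 : ℝ),
      q t ≤ -(‖e t‖ ^ 2 / (2 * ν t)) + 3 / 2 * D * ‖e t‖ * Real.exp (-(κ * t)) := by
    intro t ht
    have h1 : guidanceField (θ t) (δ t) (e t) = -(((2 * ν t)⁻¹ : ℝ) • e t) +
        (Complex.exp (δ t * Complex.I) - Complex.exp ((0 : ℝ) * Complex.I)) *
          (Complex.exp (θ t * Complex.I) - sat (e t)) := by
      change _ = -sat (e t) + _
      unfold guidanceField
      simp only [Complex.ofReal_zero, zero_mul, Complex.exp_zero]
      ring
    rw [hq]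
    simp only [h1, inner_add_right, inner_neg_right, inner_smul_right,
      real_inner_self_eq_norm_sq]
    refine add_le_add (by rw [div_eq_inv_mul]) ((real_inner_le_norm _ _).trans ?_)
    rw [norm_mul]
    have h2 := (norm_exp_mul_I_sub_le (δ t) 0).trans (by simpa using hδ t ht)
    have h3 := mul_le_mul h2 (norm_exp_sub_sat_le (θ t) (e t)) (norm_nonneg _)
      (mul_nonneg hD (Real.exp_pos _).le)
    have h4 := mul_le_mul_of_nonneg_left h3 (norm_nonneg (e t))
    linarith
  have hV : ∀ t ∈ Ici (0 : ℝ),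
      HasDerivWithinAt (fun t => ‖e t‖ ^ 2) (2 * (U t * q t)) (Ici 0) t := by
    intro t ht
    have := (he t ht).norm_sq
    rwa [inner_smul_right] at this
  have hνd : ∀ t ∈ Ici (0 : ℝ), HasDerivWithinAt ν (2 * (U t * q t) / (2 * ν t)) (Ici 0) t :=
    fun t ht => ((hV t ht).const_add 1).sqrt (by positivity)
  obtain ⟨M, hM1, hM⟩ : ∃ M ≥ 1, ∀ t ∈ Ici (0 : ℝ), ν t ≤ M := by
    have h1 := le_exp_of_deriv_le (B := C * (3 / 2 * D)) hκ (by positivity) hνd (fun t ht => by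
      have h0 := hν1 t
      have h2 : q t ≤ 3 / 2 * D * ν t * Real.exp (-(κ * t)) := by
        have h3 : 0 ≤ ‖e t‖ ^ 2 / (2 * ν t) := by positivity
        have h4 : 3 / 2 * D * ‖e t‖ * Real.exp (-(κ * t)) ≤
            3 / 2 * D * ν t * Real.exp (-(κ * t)) := by gcongr; exact heν t
        linarith [hqle t ht]
      rw [zero_mul, neg_zero, zero_add, mul_div_mul_left _ _ two_ne_zero,
        div_le_iff₀ (by linarith)]
      calc U t * q t ≤ U t * (3 / 2 * D * ν t * Real.exp (-(κ * t))) :=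
            mul_le_mul_of_nonneg_left h2 (hc.le.trans (hcU t ht))
        _ ≤ C * (3 / 2 * D * ν t * Real.exp (-(κ * t))) :=
            mul_le_mul_of_nonneg_right (hCU t ht) (by positivity)
        _ = _ := by ring)
    refine ⟨max 1 (ν 0 + C * (3 / 2 * D) / (κ - 0)), le_max_left _ _,
      fun t ht => ((h1 t ht).trans ?_).trans (le_max_right _ _)⟩
    rw [zero_mul, neg_zero, Real.exp_zero, mul_one]
  set k := min (c / M) (κ / 2) with hk
  have hk0 : 0 < k := lt_min (by positivity) (by positivity)
  have hkκ : k < κ := (min_le_right _ _).trans_lt (by linarith)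
  have h1 := le_exp_of_deriv_le (B := 3 * C * D * M) hkκ (by positivity) hV (fun t ht => by
    have hU0 := hc.le.trans (hcU t ht)
    have hν0 : 0 < ν t := zero_lt_one.trans_le (hν1 t)
    have h2 : k * ‖e t‖ ^ 2 ≤ 2 * (U t * (‖e t‖ ^ 2 / (2 * ν t))) := by
      have h3 : k ≤ U t / ν t := (min_le_left _ _).trans
        (div_le_div₀ hU0 (hcU t ht) hν0 (hM t ht))
      calc k * ‖e t‖ ^ 2 ≤ U t / ν t * ‖e t‖ ^ 2 := by gcongr
        _ = _ := by field_simp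
    have h4 : U t * (3 / 2 * D * ‖e t‖ * Real.exp (-(κ * t))) ≤
        C * (3 / 2 * D * M * Real.exp (-(κ * t))) := by
      gcongr
      · exact hCU t ht
      · exact (heν t).trans (hM t ht)
    have h5 := mul_le_mul_of_nonneg_left (hqle t ht) hU0
    linarith)
  have h2 : Tendsto (fun t => ‖e t‖ ^ 2) atTop (𝓝 0) := by
    refine squeeze_zero' (Eventually.of_forall fun t => by positivity)
      ((eventually_ge_atTop 0).mono h1) ?_
    have h3 := Real.tendsto_exp_neg_atTop_nhds_zero.comp (tendsto_id.const_mul_atTop hk0)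
    simpa [Function.comp_def] using h3.const_mul (‖e 0‖ ^ 2 + 3 * C * D * M / (κ - k))
  have h3 := h2.sqrt
  rw [Real.sqrt_zero] at h3
  rw [tendsto_zero_iff_norm_tendsto_zero]
  exact h3.congr fun t => Real.sqrt_sq (norm_nonneg _)

/-- The position error relative to the reference heading. -/
noncomputable def bodyFrame (e : ℂ) (θ : ℝ) : ℂ := e * Complex.exp (-(θ * Complex.I))

lemma norm_exp_neg_mul_I (θ : ℝ) : ‖Complex.exp (-(θ * Complex.I))‖ = 1 := by
  have := Complex.norm_exp_ofReal_mul_I (-θ)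
  rwa [Complex.ofReal_neg, neg_mul] at this

lemma norm_bodyFrame (e : ℂ) (θ : ℝ) : ‖bodyFrame e θ‖ = ‖e‖ := by
  rw [bodyFrame, norm_mul, norm_exp_neg_mul_I, mul_one]

lemma guidanceField_eq (θ δ : ℝ) (e : ℂ) :
    guidanceField θ δ e = (speed (bodyFrame e θ) : ℂ) *
      Complex.exp ((θ + (heading (bodyFrame e θ) + δ) : ℝ) * Complex.I) -
      Complex.exp (θ * Complex.I) := by
  have h1 : Complex.exp (θ * Complex.I) * Complex.exp (-(θ * Complex.I)) = 1 := by
    rw [← Complex.exp_add, add_neg_cancel, Complex.exp_zero]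
  have h2 := speed_mul_exp_heading (bodyFrame e θ)
  have h3 : sat (bodyFrame e θ) = sat e * Complex.exp (-(θ * Complex.I)) :=
    sat_mul _ _ (norm_exp_neg_mul_I θ)
  have h4 : Complex.exp ((θ + (heading (bodyFrame e θ) + δ) : ℝ) * Complex.I) =
      Complex.exp (θ * Complex.I) * Complex.exp (heading (bodyFrame e θ) * Complex.I) *
        Complex.exp (δ * Complex.I) := by
    rw [← Complex.exp_add, ← Complex.exp_add]; push_cast; ring_nf
  rw [h4, guidanceField]
  linear_combination (-Complex.exp (θ * Complex.I) * Complex.exp (δ * Complex.I)) * (h2 - h3) +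
    (Complex.exp (δ * Complex.I) * sat e) * h1

/-- The body-frame position error follows `errorField`. -/
lemma hasDerivWithinAt_bodyFrame {e : ℝ → ℂ} {W : ℝ → ℝ} {U κ δ t : ℝ} {s : Set ℝ}
    (hW : HasDerivWithinAt W (U * κ) s t)
    (he : HasDerivWithinAt e (U • ((speed (bodyFrame (e t) (W t)) : ℂ) *
      Complex.exp ((W t + δ : ℝ) * Complex.I) - Complex.exp (W t * Complex.I))) s t) :
    HasDerivWithinAt (fun τ => bodyFrame (e τ) (W τ))
      ((U * speed (bodyFrame (e t) (W t))) • errorField (bodyFrame (e t) (W t)) κ δ) s t := by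
  have h := he.mul ((hW.ofReal_comp.mul_const Complex.I).neg.cexp)
  refine h.congr_deriv ?_
  have h1 : Complex.exp (W t * Complex.I) * Complex.exp (-(W t * Complex.I)) = 1 := by
    rw [← Complex.exp_add, add_neg_cancel, Complex.exp_zero]
  have h4 : Complex.exp ((W t + δ : ℝ) * Complex.I) =
      Complex.exp (W t * Complex.I) * Complex.exp (δ * Complex.I) := by
    rw [← Complex.exp_add]; push_cast; ring_nf
  have hr : ((speed (bodyFrame (e t) (W t)) : ℝ) : ℂ) *
      ((speed (bodyFrame (e t) (W t)) : ℝ) : ℂ)⁻¹ = 1 :=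
    mul_inv_cancel₀ (Complex.ofReal_ne_zero.2 (speed_pos _).ne')
  have hη : bodyFrame (e t) (W t) = e t * Complex.exp (-(W t * Complex.I)) := rfl
  rw [h4, errorField]
  simp only [Complex.real_smul]
  push_cast
  generalize ((speed (bodyFrame (e t) (W t)) : ℝ) : ℂ) = r at *
  rw [hη]
  linear_combination (U * (r * Complex.exp (δ * Complex.I) - 1)) * h1 +
    (U * (1 + κ * Complex.I * (e t * Complex.exp (-(W t * Complex.I))))) * hr

lemma abs_comp_le_exp {s : ℝ → ℝ} {g : ℝ → ℝ} {a C : ℝ} (ha : 0 < a)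
    (hs : ∀ t ∈ Ici (0 : ℝ), a * t ≤ s t)
    (hg : ∀ s ∈ Ici (0 : ℝ), |g s| ≤ C * Real.exp (-(s / 2))) (t : ℝ) (ht : t ∈ Ici (0 : ℝ)) :
    |g (s t)| ≤ C * Real.exp (-(a / 2 * t)) := by
  have hC : 0 ≤ C := by simpa using (abs_nonneg _).trans (hg 0 self_mem_Ici)
  have h1 := hs t ht
  refine (hg _ (mem_Ici.2 ((mul_nonneg ha.le ht).trans h1))).trans ?_
  gcongr
  linarith

lemma tendsto_zero_of_abs_le_exp {g : ℝ → ℝ} {a C : ℝ} (ha : 0 < a)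
    (hg : ∀ t ∈ Ici (0 : ℝ), |g t| ≤ C * Real.exp (-(a * t))) : Tendsto g atTop (𝓝 0) := by
  refine squeeze_zero_norm' ((eventually_ge_atTop 0).mono hg) ?_
  have h3 := Real.tendsto_exp_neg_atTop_nhds_zero.comp (tendsto_id.const_mul_atTop ha)
  simpa [Function.comp_def] using h3.const_mul C

lemma hasDerivWithinAt_heading {z : ℝ → ℂ} {z' : ℂ} {s : Set ℝ} {t : ℝ}
    (hz : HasDerivWithinAt z z' s t) :
    HasDerivWithinAt (fun τ => heading (z τ)) (fderiv ℝ heading (z t) z') s t :=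
  ((contDiff_heading.differentiable (by simp) (z t)).hasFDerivAt).comp_hasDerivWithinAt t hz

theorem exists_closedLoop {m : ℕ} {U W : ℝ → ℝ} {ω : ℕ → ℝ → ℝ} (h : IsReference m U W ω)
    (e₀ : ℂ) (w₀ : ℕ → ℝ) :
    ∃ (e : ℝ → ℂ) (w : ℕ → ℝ → ℝ), e 0 = e₀ ∧ (∀ i ≤ m, w i 0 = w₀ i) ∧
      (∀ t ∈ Ici (0 : ℝ), HasDerivWithinAt e
        (U t • ((speed (bodyFrame (e t) (W t)) : ℂ) * Complex.exp ((W t + w 0 t : ℝ) * Complex.I) -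
          Complex.exp (W t * Complex.I))) (Ici 0) t) ∧
      (∀ t ∈ Ici (0 : ℝ), HasDerivWithinAt (w 0)
        (U t * speed (bodyFrame (e t) (W t)) * w 1 t - U t * ω 0 t) (Ici 0) t) ∧
      (∀ i < m, ∀ t ∈ Ici (0 : ℝ), HasDerivWithinAt (w (i + 1))
        (U t * speed (bodyFrame (e t) (W t)) * w (i + 2) t) (Ici 0) t) ∧
      (∀ t, w (m + 1) t = (jet m).target
        (point m (bodyFrame (e t) (W t)) (fun i => ω i t) fun i => w i t)) ∧
      Tendsto e atTop (𝓝 0) ∧ Tendsto (w 0) atTop (𝓝 0) ∧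
      ∀ i, Tendsto (fun t => w (i + 1) t - ω i t) atTop (𝓝 0) := by
  obtain ⟨g, hg, hg0, hgm, hgd⟩ := exists_decaying_chain (m + 1)
    (deviation (bodyFrame e₀ (W 0)) (fun i => ω i 0) w₀)
  choose D hD using hgd
  have hD0 : ∀ k, 0 ≤ D k := fun k => by
    simpa using (abs_nonneg _).trans (hD k 0 self_mem_Ici)
  have hgD : ∀ k, ∀ s ∈ Ici (0 : ℝ), |g k s| ≤ D k := fun k s hs => by
    refine (hD k s hs).trans (mul_le_of_le_one_right (hD0 k) (Real.exp_le_one_iff.2 ?_))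
    have : (0 : ℝ) ≤ s := hs
    linarith
  obtain ⟨e, s, he0, hs0, hspos, he, hs⟩ := exists_guidance h (hg 0) (L := D 0 + D 1)
    (fun s hs => (abs_add_le _ _).trans
      (add_le_add (by rw [abs_neg]; exact hgD 0 s hs) (hgD 1 s hs))) e₀
  set η : ℝ → ℂ := fun t => bodyFrame (e t) (W t) with hη
  set w : ℕ → ℝ → ℝ := fun i t => feedbackState (η t) (fun i => ω i t) (fun i => g i (s t)) i
    with hw
  obtain ⟨c, hc, hcU⟩ := h.exists_le
  obtain ⟨C, hCU⟩ := h.exists_ge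
  have hpoint : ∀ k t, point k (η t) (fun i => ω i t) (fun i => w i t) =
      feedbackPoint k (η t) (fun i => ω i t) fun i => g i (s t) :=
    fun k t => point_feedbackState k _ _ _
  have hw0 : ∀ t, w 0 t = heading (η t) + g 0 (s t) := fun t => rfl
  have hwk : ∀ k t, w (k + 1) t =
      (jet k).target (point k (η t) (fun i => ω i t) fun i => w i t) + g (k + 1) (s t) :=
    fun k t => by rw [hpoint]; rfl
  have he' : ∀ t ∈ Ici (0 : ℝ), HasDerivWithinAt e
      (U t • ((speed (η t) : ℂ) * Complex.exp ((W t + w 0 t : ℝ) * Complex.I) -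
          Complex.exp (W t * Complex.I))) (Ici 0) t := fun t ht => by
    have := he t ht
    rwa [guidanceField_eq] at this
  have hη' : ∀ t ∈ Ici (0 : ℝ), HasDerivWithinAt η
      ((U t * speed (η t)) • errorField (η t) (ω 0 t) (w 0 t)) (Ici 0) t :=
    fun t ht => hasDerivWithinAt_bodyFrame (h.heading t ht) (he' t ht)
  have hgs : ∀ k, ∀ t ∈ Ici (0 : ℝ), HasDerivWithinAt (fun t => g k (s t))
      ((-g k (s t) + g (k + 1) (s t)) * (U t * speed (η t))) (Ici 0) t :=
    fun k t ht => (hg k (s t)).comp_hasDerivWithinAt t (hs t ht)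
  have hspeed : ∀ t, speed (η t) * (speed (η t))⁻¹ = 1 :=
    fun t => mul_inv_cancel₀ (speed_pos _).ne'
  have hw0' : ∀ t ∈ Ici (0 : ℝ), HasDerivWithinAt (w 0)
      (U t * speed (η t) * (w 1 t - (speed (η t))⁻¹ * ω 0 t)) (Ici 0) t := by
    intro t ht
    refine ((hasDerivWithinAt_heading (hη' t ht)).add (hgs 0 t ht)).congr_deriv ?_
    have h1 : w 1 t = fderiv ℝ heading (η t) (errorField (η t) (ω 0 t) (w 0 t)) + heading (η t) -
        w 0 t + (speed (η t))⁻¹ * ω 0 t + g 1 (s t) := hwk 0 t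
    rw [h1, hw0, map_smul, smul_eq_mul]
    ring
  have hω' : ∀ i < m, ∀ t ∈ Ici (0 : ℝ), HasDerivWithinAt (ω i)
      (U t * speed (η t) * ((speed (η t))⁻¹ * ω (i + 1) t)) (Ici 0) t := fun i hi t ht => by
    refine (h.curvature i hi t ht).congr_deriv ?_
    linear_combination (-(U t * ω (i + 1) t)) * hspeed t
  have hwk' : ∀ k < m, ∀ t ∈ Ici (0 : ℝ), HasDerivWithinAt (w (k + 1))
      (U t * speed (η t) * w (k + 2) t) (Ici 0) t := by
    intro k
    induction k using Nat.strong_induction_on with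
    | _ k ih =>
      intro hk t ht
      have h1 := hasDerivWithinAt_target (z := η) (ω := ω) (w := w) k (hη' t ht)
        (fun i hi => hω' i (by omega) t ht) (hw0' t ht) (fun i hi => ih i hi (by omega) t ht)
      have h2 := (h1.add (hgs (k + 1) t ht)).congr_of_mem (fun τ _ => hwk k τ) ht
      refine h2.congr_deriv ?_
      rw [hwk (k + 1), hwk k]
      ring
  have hsle : ∀ t ∈ Ici (0 : ℝ), c / 2 * t ≤ s t := by
    intro t ht
    have h1 := le_exp_of_deriv_le (V := fun t => c / 2 * t - s t)
      (V' := fun t => c / 2 * 1 - U t * speed (η t)) zero_lt_one le_rfl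
      (fun t ht => (((hasDerivAt_id t).const_mul (c / 2)).hasDerivWithinAt).sub (hs t ht))
      (fun t ht => by
        have h1 := mul_le_mul (hcU t ht) (half_le_speed (η t)) (by norm_num)
          (hc.le.trans (hcU t ht))
        simp only [zero_mul, neg_zero, add_zero]
        linarith) t ht
    simp only [hs0, mul_zero, sub_zero, zero_mul, zero_div, add_zero] at h1
    linarith
  have hgt : ∀ k, ∀ t ∈ Ici (0 : ℝ), |g k (s t)| ≤ D k * Real.exp (-(c / 2 / 2 * t)) :=
    fun k => abs_comp_le_exp (half_pos hc) hsle (hD k)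
  have hγ : ∀ k, Tendsto (fun t => g k (s t)) atTop (𝓝 0) := fun k =>
    tendsto_zero_of_abs_le_exp (half_pos (half_pos hc)) (hgt k)
  have helim : Tendsto e atTop (𝓝 0) :=
    tendsto_guidance hc (half_pos (half_pos hc)) hcU hCU (hgt 0) he
  have hηlim : Tendsto η atTop (𝓝 0) := by
    rw [tendsto_zero_iff_norm_tendsto_zero] at helim ⊢
    exact helim.congr fun t => (norm_bodyFrame _ _).symm
  have hη0 : η 0 = bodyFrame e₀ (W 0) := by rw [hη]; simp only [he0]
  refine ⟨e, w, he0, fun i hi => ?_, he', fun t ht => ?_, hwk', fun t => ?_, helim, ?_, fun i => ?_⟩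
  · simp only [hw, hη0, hs0]
    exact feedbackState_deviation i _ _ _ _ fun j hj => hg0 j (by omega)
  · refine (hw0' t ht).congr_deriv ?_
    linear_combination (-(U t * ω 0 t)) * hspeed t
  · rw [hwk, hgm (m + 1) le_rfl, add_zero]
  · have h1 := (contDiff_heading.continuous.tendsto' 0 0 heading_zero).comp hηlim
    have h2 := h1.add (hγ 0)
    rw [add_zero] at h2
    exact h2
  · have h1 := ((tendsto_feedbackPoint h.bounded hηlim hγ i).2).add (hγ (i + 1))
    rw [add_zero] at h1
    refine h1.congr fun t => ?_
    rw [hwk, hpoint]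
    ring

lemma point_congr (k : ℕ) (z : ℂ) {ω ω' w w' : ℕ → ℝ} (hω : ∀ i ≤ k, ω i = ω' i)
    (hw : ∀ i ≤ k, w i = w' i) : point k z ω w = point k z ω' w' := by
  induction k with
  | zero => exact Prod.ext rfl (Prod.ext (hω 0 le_rfl) (hw 0 le_rfl))
  | succ k ih =>
    exact Prod.ext (ih (fun i hi => hω i (by omega)) fun i hi => hw i (by omega))
      (Prod.ext (hω _ le_rfl) (hw _ le_rfl))

/-- The flat state with scaled coordinates `w`. -/
noncomputable def flatState (n : ℕ) (ε : ℝ) (w : ℕ → ℝ) : EuclideanSpace ℝ (Fin n) :=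
  WithLp.toLp 2 fun i => ε ^ (i : ℕ) * w i

/-- The scaled coordinates of a flat state. -/
noncomputable def flatCoords (n : ℕ) (ε : ℝ) (z : EuclideanSpace ℝ (Fin n)) (i : ℕ) : ℝ :=
  if h : i < n then ε ^ i * z ⟨i, h⟩ else 0

/-- The sequence `w` with heading increased by `θ`. -/
def addHeading (θ : ℝ) (w : ℕ → ℝ) (i : ℕ) : ℝ := w i + if i = 0 then θ else 0

lemma continuous_flatState (n : ℕ) (ε : ℝ) : Continuous (flatState n ε) :=
  (PiLp.continuous_toLp 2 _).comp
    (continuous_pi fun i => continuous_const.mul (continuous_apply (i : ℕ)))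

lemma continuous_flatCoords (n : ℕ) :
    Continuous fun p : ℝ × EuclideanSpace ℝ (Fin n) => flatCoords n p.1 p.2 := by
  refine continuous_pi fun i => ?_
  unfold flatCoords
  split_ifs <;> fun_prop

lemma flatState_sub (n : ℕ) (ε : ℝ) (w w' : ℕ → ℝ) :
    flatState n ε w - flatState n ε w' = flatState n ε fun i => w i - w' i := by
  ext i
  simp [flatState, mul_sub]

lemma flatState_addHeading {n : ℕ} (hn : 1 ≤ n) (ε θ : ℝ) (w : ℕ → ℝ) :
    flatState n ε (addHeading θ w) = flatState n ε w + EuclideanSpace.single ⟨0, hn⟩ θ := by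
  ext i
  by_cases hi : i = ⟨0, hn⟩
  · simp [flatState, addHeading, hi]
  · have : (i : ℕ) ≠ 0 := fun h => hi (Fin.ext h)
    simp [flatState, addHeading, hi, this]

lemma flatCoords_flatState {n : ℕ} {ε : ℝ} (hε : ε * ε = 1) (w : ℕ → ℝ) {i : ℕ} (hi : i < n) :
    flatCoords n ε (flatState n ε w) i = w i := by
  have h : ε ^ i * ε ^ i = 1 := by rw [← mul_pow, hε, one_pow]
  simp only [flatCoords, hi, dif_pos, flatState]
  rw [← mul_assoc, h, one_mul]

lemma flatState_flatCoords {n : ℕ} {ε : ℝ} (hε : ε * ε = 1) (z : EuclideanSpace ℝ (Fin n)) :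
    flatState n ε (flatCoords n ε z) = z := by
  ext i
  have h : ε ^ (i : ℕ) * ε ^ (i : ℕ) = 1 := by rw [← mul_pow, hε, one_pow]
  simp only [flatCoords, i.2, dif_pos, flatState]
  rw [← mul_assoc, h, one_mul]

lemma flatState_congr {n : ℕ} {ε : ℝ} {w w' : ℕ → ℝ} (h : ∀ i < n, w i = w' i) :
    flatState n ε w = flatState n ε w' := by
  ext i
  simp [flatState, h i i.2]

lemma tendsto_flatState_sub {n : ℕ} (ε : ℝ) {w w' : ℕ → ℝ → ℝ}
    (h : ∀ i, Tendsto (fun t => w i t - w' i t) atTop (𝓝 0)) :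
    Tendsto (fun t => flatState n ε (fun i => w i t) - flatState n ε fun i => w' i t)
      atTop (𝓝 0) := by
  simp only [flatState_sub]
  refine ((continuous_flatState n ε).tendsto' 0 0 ?_).comp (tendsto_pi_nhds.2 h)
  ext i
  simp [flatState]

/-- The input steering the last flat coordinate with normalized rate `v` at speed `c`. -/
noncomputable def flatInput {n : ℕ} (α β : EuclideanSpace ℝ (Fin n) → ℝ) (ε c v : ℝ)
    (z : EuclideanSpace ℝ (Fin n)) : ℝ × ℝ :=
  (ε * c, (ε ^ (n - 1) * (c * v) - ε * c * α z) / β z)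

namespace IsFlatInverse

variable {n : ℕ} {hn : 1 ≤ n} {O : Set (EuclideanSpace ℝ (Fin n))}
  {h₁ h₂ S R : EuclideanSpace ℝ (Fin n) → EuclideanSpace ℝ (Fin n)}
  {α β : EuclideanSpace ℝ (Fin n) → ℝ}

lemma flatInput_addHeading (hR : IsFlatInverse hn O h₁ h₂ S R α β) (ε c v θ : ℝ) (w : ℕ → ℝ) :
    flatInput α β ε c v (flatState n ε (addHeading θ w)) =
      flatInput α β ε c v (flatState n ε w) := by
  rw [flatInput, flatInput, flatState_addHeading hn, hR.alpha_add, hR.beta_add]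

lemma continuous_flatInput (hR : IsFlatInverse hn O h₁ h₂ S R α β) :
    Continuous fun p : ℝ × ℝ × ℝ × EuclideanSpace ℝ (Fin n) =>
      flatInput α β p.1 p.2.1 p.2.2.1 p.2.2.2 := by
  have hα := hR.continuous_alpha
  have hβ := hR.continuous_beta
  unfold flatInput
  refine (by fun_prop : Continuous _).prodMk
    (Continuous.div (by fun_prop) (by fun_prop) fun p => hR.beta_ne_zero _)

lemma inv_flatState (hR : IsFlatInverse hn O h₁ h₂ S R α β) (ε θ : ℝ) (w : ℕ → ℝ) :
    R (flatState n ε (addHeading θ w)) ⟨0, hn⟩ = θ + w 0 := by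
  rw [hR.inv_zero]
  simp [flatState, addHeading, add_comm]

lemma hasDerivWithinAt_flatState (hR : IsFlatInverse hn O h₁ h₂ S R α β) {ε : ℝ}
    (hε : ε * ε = 1) {v : ℕ → ℝ → ℝ} {c : ℝ} {s : Set ℝ} {t : ℝ}
    (hv : ∀ i < n, HasDerivWithinAt (v i) (c * v (i + 1) t) s t) :
    HasDerivWithinAt (fun τ => R (flatState n ε fun i => v i τ))
      ((flatInput α β ε c (v n t) (flatState n ε fun i => v i t)).1 •
          h₁ (R (flatState n ε fun i => v i t)) +
        (flatInput α β ε c (v n t) (flatState n ε fun i => v i t)).2 •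
          h₂ (R (flatState n ε fun i => v i t))) s t := by
  refine hR.hasDerivWithinAt (fun τ => flatState n ε fun i => v i τ) _ _ s t
    (fun i j hij => ?_) fun i hi => ?_
  · refine ((hv i i.2).const_mul (ε ^ (i : ℕ))).congr_deriv ?_
    simp only [flatInput, flatState, hij]
    rw [pow_succ]
    linear_combination (-(ε ^ (i : ℕ) * c * v (i + 1) t)) * hε
  · refine ((hv i i.2).const_mul (ε ^ (i : ℕ))).congr_deriv ?_
    have h1 : (i : ℕ) = n - 1 := by omega
    have h2 := hR.beta_ne_zero (flatState n ε fun i => v i t)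
    simp only [flatInput]
    rw [div_mul_cancel₀ _ h2, hi, h1]
    ring

end IsFlatInverse

/-- A planar vector as a complex number. -/
noncomputable def toComplex (x : EuclideanSpace ℝ (Fin 2)) : ℂ := x 0 + x 1 * Complex.I

/-- A complex number as a planar vector. -/
noncomputable def ofComplex (z : ℂ) : EuclideanSpace ℝ (Fin 2) := !₂[z.re, z.im]

lemma toComplex_ofComplex (z : ℂ) : toComplex (ofComplex z) = z := by
  simp [toComplex, ofComplex]

lemma ofComplex_toComplex (x : EuclideanSpace ℝ (Fin 2)) : ofComplex (toComplex x) = x := by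
  ext i
  fin_cases i <;> simp [toComplex, ofComplex]

lemma toComplex_smul (a : ℝ) (x : EuclideanSpace ℝ (Fin 2)) :
    toComplex (a • x) = a • toComplex x := by
  simp [toComplex]; ring

lemma continuous_toComplex : Continuous toComplex := by
  unfold toComplex
  fun_prop

lemma continuous_ofComplex : Continuous ofComplex :=
  (PiLp.continuous_toLp 2 _).comp (continuous_pi fun i => by
    fin_cases i
    · exact Complex.continuous_re
    · exact Complex.continuous_im)

/-- The reference curvature derivatives determined by the reference state and input. -/
noncomputable def referenceCurvature {n : ℕ} (α β : EuclideanSpace ℝ (Fin n) → ℝ) (ε : ℝ)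
    (zD : EuclideanSpace ℝ (Fin n)) (a b : ℝ) (i : ℕ) : ℝ :=
  if i + 1 < n then flatCoords n ε zD (i + 1)
  else ε ^ (n - 1) * (a * α zD + b * β zD) / |a|

/-- The feedback law in flat coordinates. -/
noncomputable def flatFeedback {n : ℕ} (hn : 1 ≤ n) (α β : EuclideanSpace ℝ (Fin n) → ℝ)
    (ε : ℝ) (e : ℂ) (z zD : EuclideanSpace ℝ (Fin n)) (a b : ℝ) : ℝ × ℝ :=
  flatInput α β ε (|a| * speed (bodyFrame e (zD ⟨0, hn⟩)))
    ((jet (n - 1)).target (point (n - 1) (bodyFrame e (zD ⟨0, hn⟩))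
      (referenceCurvature α β ε zD a b)
      (flatCoords n ε (z - EuclideanSpace.single ⟨0, hn⟩ (zD ⟨0, hn⟩))))) z

/-- The feedback law in the original coordinates. -/
noncomputable def stateFeedback {n : ℕ} (hn : 1 ≤ n)
    (S : EuclideanSpace ℝ (Fin n) → EuclideanSpace ℝ (Fin n))
    (α β : EuclideanSpace ℝ (Fin n) → ℝ)
    (q : (EuclideanSpace ℝ (Fin 2) × EuclideanSpace ℝ (Fin n)) ×
      (EuclideanSpace ℝ (Fin 2) × EuclideanSpace ℝ (Fin n)) × (ℝ × ℝ)) : ℝ × ℝ :=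
  flatFeedback hn α β (q.2.2.1 / |q.2.2.1|) (toComplex ((q.2.2.1 / |q.2.2.1|) • (q.1.1 - q.2.1.1)))
    (S q.1.2) (S q.2.1.2) q.2.2.1 q.2.2.2

namespace IsFlatInverse

variable {n : ℕ} {hn : 1 ≤ n} {O : Set (EuclideanSpace ℝ (Fin n))}
  {h₁ h₂ S R : EuclideanSpace ℝ (Fin n) → EuclideanSpace ℝ (Fin n)}
  {α β : EuclideanSpace ℝ (Fin n) → ℝ}

lemma continuousOn_flatFeedback (hR : IsFlatInverse hn O h₁ h₂ S R α β) :
    ContinuousOn (fun p : ℝ × ℂ × EuclideanSpace ℝ (Fin n) × EuclideanSpace ℝ (Fin n) × ℝ × ℝ =>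
      flatFeedback hn α β p.1 p.2.1 p.2.2.1 p.2.2.2.1 p.2.2.2.2.1 p.2.2.2.2.2)
      {p | p.2.2.2.2.1 ≠ 0} := by
  have hα := hR.continuous_alpha
  have hβ := hR.continuous_beta
  have h1 : Continuous fun p : ℝ × ℂ × EuclideanSpace ℝ (Fin n) × EuclideanSpace ℝ (Fin n) ×
      ℝ × ℝ => bodyFrame p.2.1 (p.2.2.2.1 ⟨0, hn⟩) := by
    unfold bodyFrame
    fun_prop
  have h2 : ContinuousOn (fun p : ℝ × ℂ × EuclideanSpace ℝ (Fin n) × EuclideanSpace ℝ (Fin n) ×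
      ℝ × ℝ => referenceCurvature α β p.1 p.2.2.2.1 p.2.2.2.2.1 p.2.2.2.2.2)
      {p | p.2.2.2.2.1 ≠ 0} := by
    refine continuousOn_pi.2 fun i => ?_
    unfold referenceCurvature
    split_ifs
    · exact ((continuous_apply (i + 1)).comp ((continuous_flatCoords n).comp
        (by fun_prop : Continuous fun p : ℝ × ℂ × EuclideanSpace ℝ (Fin n) ×
          EuclideanSpace ℝ (Fin n) × ℝ × ℝ => (p.1, p.2.2.2.1)))).continuousOn
    · exact ContinuousOn.div (by fun_prop) (by fun_prop) fun p hp => abs_ne_zero.2 hp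
  have h3 : Continuous fun p : ℝ × ℂ × EuclideanSpace ℝ (Fin n) × EuclideanSpace ℝ (Fin n) ×
      ℝ × ℝ => flatCoords n p.1
        (p.2.2.1 - EuclideanSpace.single ⟨0, hn⟩ (p.2.2.2.1 ⟨0, hn⟩)) := by
    have h4 : Continuous fun r : ℝ =>
        (EuclideanSpace.single ⟨0, hn⟩ r : EuclideanSpace ℝ (Fin n)) := by
      refine (PiLp.continuous_toLp 2 _).comp (continuous_pi fun i => ?_)
      by_cases hi : i = ⟨0, hn⟩
      · subst hi; simpa using continuous_id'
      · simpa [Pi.single_apply, hi] using continuous_const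
    have h5 : Continuous fun p : ℝ × ℂ × EuclideanSpace ℝ (Fin n) × EuclideanSpace ℝ (Fin n) ×
        ℝ × ℝ => p.2.2.2.1 ⟨0, hn⟩ := by fun_prop
    exact (continuous_flatCoords n).comp
      (continuous_fst.prodMk (continuous_snd.snd.fst.sub (h4.comp h5)))
  exact hR.continuous_flatInput.comp_continuousOn (continuousOn_fst.prodMk
    (((by fun_prop : Continuous _).mul (contDiff_speed.continuous.comp h1)).continuousOn.prodMk
      (((jet (n - 1)).contDiff_target.continuous.comp_continuousOn
        ((continuous_point (n - 1)).comp_continuousOn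
          (h1.continuousOn.prodMk (h2.prodMk h3.continuousOn)))).prodMk
        (by fun_prop))))

lemma continuousOn_stateFeedback (hR : IsFlatInverse hn O h₁ h₂ S R α β) :
    ContinuousOn (stateFeedback hn S α β) {q | q.1.2 ∈ O ∧ q.2.1.2 ∈ O ∧ q.2.2.1 ≠ 0} := by
  have h1 : ContinuousOn (fun q : (EuclideanSpace ℝ (Fin 2) × EuclideanSpace ℝ (Fin n)) ×
      (EuclideanSpace ℝ (Fin 2) × EuclideanSpace ℝ (Fin n)) × (ℝ × ℝ) => q.2.2.1 / |q.2.2.1|)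
      {q | q.1.2 ∈ O ∧ q.2.1.2 ∈ O ∧ q.2.2.1 ≠ 0} :=
    ContinuousOn.div (by fun_prop) (by fun_prop) fun q hq => abs_ne_zero.2 hq.2.2
  refine hR.continuousOn_flatFeedback.comp (h1.prodMk
    ((continuous_toComplex.comp_continuousOn (h1.smul (by fun_prop))).prodMk
      ((hR.continuousOn.comp (by fun_prop) fun q hq => hq.1).prodMk
        ((hR.continuousOn.comp (by fun_prop) fun q hq => hq.2.1).prodMk (by fun_prop)))))
    fun q hq => hq.2.2

lemma flatFeedback_flatState (hR : IsFlatInverse hn O h₁ h₂ S R α β) {ε U θ : ℝ}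
    (hε : ε = 1 ∨ ε = -1) (hU : 0 < U) (e : ℂ) (ω w : ℕ → ℝ) :
    flatFeedback hn α β ε e (flatState n ε (addHeading θ w))
      (flatState n ε (addHeading θ (trackingState ω)))
      (flatInput α β ε U (ω (n - 1)) (flatState n ε (addHeading θ (trackingState ω)))).1
      (flatInput α β ε U (ω (n - 1)) (flatState n ε (addHeading θ (trackingState ω)))).2 =
    flatInput α β ε (U * speed (bodyFrame e θ))
      ((jet (n - 1)).target (point (n - 1) (bodyFrame e θ) ω w))
      (flatState n ε (addHeading θ w)) := by
  have hεε : ε * ε = 1 := by rcases hε with rfl | rfl <;> norm_num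
  have habs : |ε * U| = U := by
    rw [abs_mul, abs_of_pos hU]; rcases hε with rfl | rfl <;> simp
  have hθ : flatState n ε (addHeading θ (trackingState ω)) ⟨0, hn⟩ = θ := by
    simp [flatState, addHeading, trackingState]
  have hpow : ε ^ (n - 1) * ε ^ (n - 1) = 1 := by rw [← mul_pow, hεε, one_pow]
  unfold flatFeedback
  rw [hθ, flatState_addHeading hn ε θ w, add_sub_cancel_right]
  congr 1
  · simp [flatInput, habs]
  · congr 1
    refine point_congr _ _ (fun i hi => ?_) fun i hi => flatCoords_flatState hεε w (by omega)
    unfold referenceCurvature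
    split_ifs with h
    · rw [flatCoords_flatState hεε _ h]
      simp [addHeading, trackingState]
    · have h1 : i = n - 1 := by omega
      have h2 := hR.beta_ne_zero (flatState n ε (addHeading θ (trackingState ω)))
      simp only [flatInput, habs]
      rw [div_mul_cancel₀ _ h2, add_sub_cancel, h1, ← mul_assoc, hpow, one_mul,
        mul_div_cancel_left₀ _ hU.ne']

lemma stateFeedback_flatState (hR : IsFlatInverse hn O h₁ h₂ S R α β) {ε U θ : ℝ}
    (hε : ε = 1 ∨ ε = -1) (hU : 0 < U) (e : ℂ) (xD : EuclideanSpace ℝ (Fin 2)) (ω w : ℕ → ℝ) :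
    stateFeedback hn S α β ((xD + ε • ofComplex e, R (flatState n ε (addHeading θ w))),
      (xD, R (flatState n ε (addHeading θ (trackingState ω)))),
      flatInput α β ε U (ω (n - 1)) (flatState n ε (addHeading θ (trackingState ω)))) =
    flatInput α β ε (U * speed (bodyFrame e θ))
      ((jet (n - 1)).target (point (n - 1) (bodyFrame e θ) ω w))
      (flatState n ε (addHeading θ w)) := by
  have hεε : ε * ε = 1 := by rcases hε with rfl | rfl <;> norm_num
  rw [← hR.flatFeedback_flatState hε hU]
  have hsign : (flatInput α β ε U (ω (n - 1))
      (flatState n ε (addHeading θ (trackingState ω)))).1 / |(flatInput α β ε U (ω (n - 1))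
      (flatState n ε (addHeading θ (trackingState ω)))).1| = ε := by
    simp only [flatInput]
    rw [abs_mul, abs_of_pos hU, mul_div_mul_right _ _ hU.ne']
    rcases hε with rfl | rfl <;> simp
  unfold stateFeedback
  simp only [hsign, hR.right_inv, add_sub_cancel_left, smul_smul, hεε, one_smul,
    toComplex_ofComplex]

end IsFlatInverse

lemma boundedDiff_coordinate {n : ℕ} {x : ℕ → ℝ → EuclideanSpace ℝ (Fin 2)}
    (hx : ∀ k < n + 1, ∀ t ∈ Ici (0 : ℝ), HasDerivWithinAt (x k) (x (k + 1) t) (Ici 0) t)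
    (hc : ContinuousOn (x (n + 1)) (Ici 0))
    (hb : ∀ k, 1 ≤ k → k ≤ n + 1 → ∃ C, ∀ t ∈ Ici (0 : ℝ), ‖x k t‖ ≤ C)
    (ε : ℝ) (i : Fin 2) (j : ℕ) :
    ∀ k, 1 ≤ k → k + j = n + 1 → BoundedDiff j fun t => ε * x k t i := by
  have hb' : ∀ k, 1 ≤ k → k ≤ n + 1 → ∃ C, ∀ t ∈ Ici (0 : ℝ), |ε * x k t i| ≤ C := by
    intro k h1 h2
    obtain ⟨C, hC⟩ := hb k h1 h2
    refine ⟨|ε| * C, fun t ht => ?_⟩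
    rw [abs_mul]
    exact mul_le_mul_of_nonneg_left ((PiLp.norm_apply_le (x k t) i).trans (hC t ht)) (abs_nonneg _)
  induction j with
  | zero =>
    intro k h1 h2
    obtain rfl : k = n + 1 := by omega
    exact ⟨hb' _ h1 le_rfl, continuousOn_const.mul
      ((EuclideanSpace.proj (𝕜 := ℝ) i).continuous.comp_continuousOn hc)⟩
  | succ j ih =>
    intro k h1 h2
    exact ⟨hb' k h1 (by omega), fun t => ε * x (k + 1) t i, fun t ht =>
      (hasDerivWithinAt_euclidean.1 (hx k (by omega) t ht) i).const_mul ε,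
      ih (k + 1) (by omega) (by omega)⟩

namespace IsReference

variable {m : ℕ} {U W : ℝ → ℝ} {ω : ℕ → ℝ → ℝ}

lemma exists_isCompact (h : IsReference m U W ω) (n : ℕ) (ε : ℝ) :
    ∃ K : Set (ℝ × ℝ × EuclideanSpace ℝ (Fin n)), IsCompact K ∧ ∀ t ∈ Ici (0 : ℝ),
      (U t, ω m t, flatState n ε (trackingState fun i => ω i t)) ∈ K := by
  obtain ⟨c, hc, hcU⟩ := h.exists_le
  obtain ⟨C, hCU⟩ := h.exists_ge
  choose D hD using h.bounded
  refine ⟨Icc c C ×ˢ Icc (-D m) (D m) ×ˢ ((fun ω => flatState n ε (trackingState ω)) ''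
    univ.pi fun i => Icc (-D i) (D i)), isCompact_Icc.prod (isCompact_Icc.prod
      ((isCompact_univ_pi fun i => isCompact_Icc).image
        ((continuous_flatState n ε).comp continuous_trackingState))), fun t ht => ?_⟩
  exact ⟨⟨hcU t ht, hCU t ht⟩, abs_le.1 (hD m t ht),
    fun i => ω i t, fun i _ => abs_le.1 (hD i t ht), rfl⟩

lemma continuousOn_flat (h : IsReference m U W ω) (n : ℕ) (ε : ℝ) :
    ContinuousOn (fun t => (U t, ω m t, flatState n ε (trackingState fun i => ω i t))) (Ici 0) :=
  h.continuousOn_speed.prodMk ((h.continuousOn m).prodMk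
    (((continuous_flatState n ε).comp continuous_trackingState).comp_continuousOn
      (continuousOn_pi.2 h.continuousOn)))

lemma tendsto_comp_sub (h : IsReference m U W ω) {n : ℕ} {ε : ℝ} {F : Type*}
    [NormedAddCommGroup F] {f : ℝ × ℝ × EuclideanSpace ℝ (Fin n) → F} (hf : Continuous f)
    {r v : ℝ → ℝ} {w : ℕ → ℝ → ℝ} (hr : Tendsto r atTop (𝓝 1))
    (hv : Tendsto (fun t => v t - ω m t) atTop (𝓝 0)) (hw0 : Tendsto (w 0) atTop (𝓝 0))
    (hw : ∀ i, Tendsto (fun t => w (i + 1) t - ω i t) atTop (𝓝 0)) :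
    Tendsto (fun t => f (U t * r t, v t, flatState n ε fun i => w i t) -
      f (U t, ω m t, flatState n ε (trackingState fun i => ω i t))) atTop (𝓝 0) := by
  obtain ⟨K, hK, hmem⟩ := h.exists_isCompact n ε
  obtain ⟨c, hc, hcU⟩ := h.exists_le
  obtain ⟨C, hCU⟩ := h.exists_ge
  refine tendsto_comp_sub_comp hf hK ((eventually_ge_atTop 0).mono hmem) ?_
  have h1 : Tendsto (fun t => U t * r t - U t) atTop (𝓝 0) := by
    have h2 : Tendsto (fun t => r t - 1) atTop (𝓝 0) := by simpa using hr.sub_const 1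
    have h3 : IsBoundedUnder (· ≤ ·) atTop (norm ∘ U) :=
      isBoundedUnder_of_eventually_le (a := C) ((eventually_ge_atTop 0).mono fun t ht => by
        rw [Function.comp_apply, Real.norm_of_nonneg (hc.le.trans (hcU t ht))]
        exact hCU t ht)
    refine (h2.zero_mul_isBoundedUnder_le h3).congr fun t => ?_
    ring
  have h2 := tendsto_flatState_sub (n := n) ε (w := w)
    (w' := fun i t => trackingState (fun i => ω i t) i) (fun i => by
      cases i with
      | zero => simpa [trackingState] using hw0
      | succ i => exact hw i)
  exact h1.prodMk_nhds (hv.prodMk_nhds h2)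

end IsReference

/-- Main theorem (Theorem 3 of the paper): the kinematic wheeled system admits a
continuous memoryless feedback `Φ` stabilizing, on `ℝ² × O`, the trajectory produced
by the maneuvering construction, for every strongly admissible planar reference
trajectory, with bounded input. -/
theorem stmt12 {n : ℕ} (hn : 1 ≤ n)
    (O : Set (EuclideanSpace ℝ (Fin n))) (hO : IsOpen O)
    -- `O = ℝ × Ǒ`: membership in `O` does not depend on the first coordinate
    (hOsplit : ∀ y z : EuclideanSpace ℝ (Fin n),
      (∀ i : Fin n, 0 < (i : ℕ) → y i = z i) → (y ∈ O ↔ z ∈ O))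
    (h₁ h₂ : EuclideanSpace ℝ (Fin n) → EuclideanSpace ℝ (Fin n))
    (hh₁ : ContDiffOn ℝ (⊤ : ℕ∞) h₁ O) (hh₂ : ContDiffOn ℝ (⊤ : ℕ∞) h₂ O)
    -- `h₁, h₂` do not depend on the first coordinate `y₁`
    (hind₁ : ∀ y z : EuclideanSpace ℝ (Fin n),
      (∀ i : Fin n, 0 < (i : ℕ) → y i = z i) → h₁ y = h₁ z)
    (hind₂ : ∀ y z : EuclideanSpace ℝ (Fin n),
      (∀ i : Fin n, 0 < (i : ℕ) → y i = z i) → h₂ y = h₂ z)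
    -- `y₁` is the first coordinate function
    (y₁ : EuclideanSpace ℝ (Fin n) → ℝ) (hy₁ : ∀ y, y₁ y = y ⟨0, hn⟩)
    -- relative-degree conditions on `O`
    (hzero : ∀ i < n - 1, ∀ y ∈ O, lieDeriv h₂ (lieIter h₁ y₁ i) y = 0)
    (hnz : ∀ y ∈ O, lieDeriv h₂ (lieIter h₁ y₁ (n - 1)) y ≠ 0)
    -- `S = (y₁, L_{h₁} y₁, …, L_{h₁}^{n-1} y₁)` maps `O` bijectively onto `ℝⁿ`
    (S : EuclideanSpace ℝ (Fin n) → EuclideanSpace ℝ (Fin n))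
    (hS : ∀ y (i : Fin n), S y i = lieIter h₁ y₁ i y)
    (hSbij : Set.BijOn S O Set.univ) :
    ∃ Φ : (EuclideanSpace ℝ (Fin 2) × EuclideanSpace ℝ (Fin n)) ×
        (EuclideanSpace ℝ (Fin 2) × EuclideanSpace ℝ (Fin n)) × (ℝ × ℝ) → ℝ × ℝ,
      ContinuousOn Φ {q | q.1.2 ∈ O ∧ q.2.1.2 ∈ O ∧ q.2.2.1 ≠ 0} ∧
      -- for every strongly admissible trajectory `xD 0`, given with its derivatives
      -- `xD k = dᵏ(xD 0)/dtᵏ`, `k = 1, …, n+1`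
      ∀ xD : ℕ → ℝ → EuclideanSpace ℝ (Fin 2),
        (∀ k < n + 1, ∀ t ∈ Ici (0:ℝ), HasDerivWithinAt (xD k) (xD (k + 1) t) (Ici 0) t) →
        ContinuousOn (xD (n + 1)) (Ici 0) →
        (∀ k, 1 ≤ k → k ≤ n + 1 → ∃ C, ∀ t ∈ Ici (0:ℝ), ‖xD k t‖ ≤ C) →
        (∃ c > 0, ∀ t ∈ Ici (0:ℝ), c ≤ ‖xD 1 t‖) →
        ∀ ε : ℝ, (ε = 1 ∨ ε = -1) →
        -- the maneuvering construction produces `yD`, `uD`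
        ∃ yD : ℝ → EuclideanSpace ℝ (Fin n), ∃ uD : ℝ → ℝ × ℝ,
          (∀ t ∈ Ici (0:ℝ), yD t ∈ O) ∧
          ContinuousOn uD (Ici 0) ∧
          (∃ C, ∀ t ∈ Ici (0:ℝ), ‖uD t‖ ≤ C) ∧
          (∀ t ∈ Ici (0:ℝ), 0 < ε * (uD t).1) ∧
          (∀ t ∈ Ici (0:ℝ),
            xD 1 t 0 = (uD t).1 * Real.cos (yD t ⟨0, hn⟩) ∧
            xD 1 t 1 = (uD t).1 * Real.sin (yD t ⟨0, hn⟩)) ∧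
          (∀ t ∈ Ici (0:ℝ),
            HasDerivWithinAt yD ((uD t).1 • h₁ (yD t) + (uD t).2 • h₂ (yD t)) (Ici 0) t) ∧
          -- for every initial state in `ℝ² × O` the closed-loop solution exists,
          -- remains in `ℝ² × O`, has bounded input, and tracks the reference
          (∀ (x0 : EuclideanSpace ℝ (Fin 2)) (y0 : EuclideanSpace ℝ (Fin n)), y0 ∈ O →
            ∃ x : ℝ → EuclideanSpace ℝ (Fin 2), ∃ y : ℝ → EuclideanSpace ℝ (Fin n),
            ∃ u : ℝ → ℝ × ℝ,
              x 0 = x0 ∧ y 0 = y0 ∧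
              (∀ t ∈ Ici (0:ℝ), y t ∈ O) ∧
              (∀ t ∈ Ici (0:ℝ), u t = Φ ((x t, y t), (xD 0 t, yD t), uD t)) ∧
              (∀ t ∈ Ici (0:ℝ),
                HasDerivWithinAt (fun τ => x τ 0)
                  ((u t).1 * Real.cos (y t ⟨0, hn⟩)) (Ici 0) t ∧
                HasDerivWithinAt (fun τ => x τ 1)
                  ((u t).1 * Real.sin (y t ⟨0, hn⟩)) (Ici 0) t) ∧
              (∀ t ∈ Ici (0:ℝ),
                HasDerivWithinAt y ((u t).1 • h₁ (y t) + (u t).2 • h₂ (y t)) (Ici 0) t) ∧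
              (∃ C, ∀ t ∈ Ici (0:ℝ), ‖u t‖ ≤ C) ∧
              Tendsto (fun t => x t - xD 0 t) atTop (nhds 0) ∧
              (∀ i : Fin n, Tendsto (fun t => y t i - yD t i) atTop (nhds 0)) ∧
              Tendsto (fun t => u t - uD t) atTop (nhds 0)) := by
  obtain ⟨R, α, β, hR⟩ := exists_isFlatInverse hn O hO hOsplit h₁ h₂ hh₁ hh₂ hind₁ hind₂ y₁ hy₁
    hzero hnz S hS hSbij
  refine ⟨stateFeedback hn S α β, hR.continuousOn_stateFeedback,
    fun xD hxD hxDc hxDb ⟨c, hc, hcx⟩ ε hε => ?_⟩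
  have hεε : ε * ε = 1 := by rcases hε with rfl | rfl <;> norm_num
  have hn1 : n - 1 + 1 = n := Nat.sub_add_cancel hn
  obtain ⟨U, W, ω, h, hUW⟩ := exists_isReference (m := n - 1)
    (boundedDiff_coordinate hxD hxDc hxDb ε 0 (n - 1 + 1) 1 le_rfl (by omega))
    (boundedDiff_coordinate hxD hxDc hxDb ε 1 (n - 1 + 1) 1 le_rfl (by omega)) hc
    (fun t ht => by
      have h1 := hcx t ht
      rw [EuclideanSpace.norm_eq, Fin.sum_univ_two, Real.norm_eq_abs, Real.norm_eq_abs, sq_abs,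
        sq_abs] at h1
      rwa [mul_pow, mul_pow, pow_two ε, hεε, one_mul, one_mul])
  have hU : ∀ t ∈ Ici (0 : ℝ), 0 < U t := by
    obtain ⟨c, hc, hcU⟩ := h.exists_le
    exact fun t ht => hc.trans_le (hcU t ht)
  set zD : ℝ → EuclideanSpace ℝ (Fin n) := fun t =>
    flatState n ε (addHeading (W t) (trackingState fun i => ω i t)) with hzD
  set uD : ℝ → ℝ × ℝ := fun t => flatInput α β ε (U t) (ω (n - 1) t) (zD t) with huD
  have hyD0 : ∀ t, R (zD t) ⟨0, hn⟩ = W t := fun t => by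
    rw [hzD, hR.inv_flatState]
    exact add_zero _
  have huD' : ∀ t, uD t = flatInput α β ε (U t) (ω (n - 1) t)
      (flatState n ε (trackingState fun i => ω i t)) := fun t => hR.flatInput_addHeading _ _ _ _ _
  have hf : Continuous fun p : ℝ × ℝ × EuclideanSpace ℝ (Fin n) =>
      flatInput α β ε p.1 p.2.1 p.2.2 :=
    hR.continuous_flatInput.comp (continuous_const.prodMk continuous_id)
  have huDc : ContinuousOn uD (Ici 0) :=
    (hf.comp_continuousOn (h.continuousOn_flat n ε)).congr fun t _ => huD' t
  have huDb : ∃ C, ∀ t ∈ Ici (0 : ℝ), ‖uD t‖ ≤ C := by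
    obtain ⟨K, hK, hmem⟩ := h.exists_isCompact n ε
    obtain ⟨C, hC⟩ := hK.exists_bound_of_continuousOn hf.continuousOn
    exact ⟨C, fun t ht => by rw [huD']; exact hC _ (hmem t ht)⟩
  have hyD : ∀ t ∈ Ici (0 : ℝ), HasDerivWithinAt (fun t => R (zD t))
      ((uD t).1 • h₁ (R (zD t)) + (uD t).2 • h₂ (R (zD t))) (Ici 0) t := by
    intro t ht
    have h1 := hR.hasDerivWithinAt_flatState hεε
      (v := fun i t => addHeading (W t) (trackingState fun i => ω i t) i) (c := U t)
      (s := Ici 0) (t := t) (fun i hi => by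
        cases i with
        | zero => simpa [addHeading, trackingState] using h.heading t ht
        | succ i => simpa [addHeading, trackingState] using h.curvature i (by omega) t ht)
    have h2 : addHeading (W t) (trackingState fun i => ω i t) n = ω (n - 1) t := by
      rw [← hn1]; simp [addHeading, trackingState]
    rw [h2] at h1
    exact h1
  have hxD1 : ∀ t ∈ Ici (0 : ℝ), xD 1 t 0 = ε * U t * Real.cos (W t) ∧
      xD 1 t 1 = ε * U t * Real.sin (W t) := fun t ht => by
    obtain ⟨h1, h2⟩ := hUW t ht
    exact ⟨by linear_combination ε * h1 - xD 1 t 0 * hεε,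
      by linear_combination ε * h2 - xD 1 t 1 * hεε⟩
  refine ⟨fun t => R (zD t), uD, fun t _ => hR.mem _, huDc, huDb, fun t ht => ?_, fun t ht => ?_,
    hyD, fun x0 y0 hy0 => ?_⟩
  · change 0 < ε * (ε * U t)
    rw [← mul_assoc, hεε, one_mul]
    exact hU t ht
  · simp only [hyD0]
    exact hxD1 t ht
  obtain ⟨e, w, he0, hw0, he, hw0', hw', hwn, helim, hw0lim, hwlim⟩ := exists_closedLoop h
    (ε • toComplex (x0 - xD 0 0))
    (flatCoords n ε (S y0 - EuclideanSpace.single ⟨0, hn⟩ (W 0)))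
  rw [hn1] at hwn
  set z : ℝ → EuclideanSpace ℝ (Fin n) := fun t =>
    flatState n ε (addHeading (W t) fun i => w i t) with hz
  set x : ℝ → EuclideanSpace ℝ (Fin 2) := fun t => xD 0 t + ε • ofComplex (e t) with hx
  set r : ℝ → ℝ := fun t => speed (bodyFrame (e t) (W t)) with hr
  set u : ℝ → ℝ × ℝ := fun t => flatInput α β ε (U t * r t) (w n t) (z t) with hu
  have hy0' : ∀ t, R (z t) ⟨0, hn⟩ = W t + w 0 t := fun t => hR.inv_flatState _ _ _
  have hy : ∀ t ∈ Ici (0 : ℝ), HasDerivWithinAt (fun t => R (z t))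
      ((u t).1 • h₁ (R (z t)) + (u t).2 • h₂ (R (z t))) (Ici 0) t := by
    intro t ht
    have h1 := hR.hasDerivWithinAt_flatState hεε
      (v := fun i t => addHeading (W t) (fun i => w i t) i) (c := U t * r t)
      (s := Ici 0) (t := t) (fun i hi => by
        cases i with
        | zero =>
          simp only [addHeading, if_true, zero_add, one_ne_zero, if_false, add_zero]
          exact ((hw0' t ht).add (h.heading t ht)).congr_deriv (by ring)
        | succ i => simpa [addHeading] using hw' i (by omega) t ht)
    have h2 : addHeading (W t) (fun i => w i t) n = w n t := by
      simp [addHeading, Nat.one_le_iff_ne_zero.1 hn]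
    rw [h2] at h1
    exact h1
  have hxd : ∀ t ∈ Ici (0 : ℝ),
      HasDerivWithinAt (fun τ => x τ 0) ((u t).1 * Real.cos (R (z t) ⟨0, hn⟩)) (Ici 0) t ∧
      HasDerivWithinAt (fun τ => x τ 1) ((u t).1 * Real.sin (R (z t) ⟨0, hn⟩)) (Ici 0) t := by
    intro t ht
    have h1 := hasDerivWithinAt_euclidean.1 (hxD 0 (by omega) t ht)
    have h2 : HasDerivWithinAt (fun τ => (e τ).re) _ (Ici 0) t :=
      Complex.reCLM.hasFDerivAt.comp_hasDerivWithinAt t (he t ht)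
    have h3 : HasDerivWithinAt (fun τ => (e τ).im) _ (Ici 0) t :=
      Complex.imCLM.hasFDerivAt.comp_hasDerivWithinAt t (he t ht)
    have h4 := hxD1 t ht
    rw [hy0']
    constructor
    · refine ((h1 0).add (h2.const_mul ε)).congr_deriv ?_
      simp [h4.1, Complex.exp_ofReal_mul_I_re, hu, flatInput, -Complex.ofReal_add]
      ring
    · refine ((h1 1).add (h3.const_mul ε)).congr_deriv ?_
      simp [h4.2, Complex.exp_ofReal_mul_I_im, hu, flatInput, -Complex.ofReal_add]
      ring
  have hΦ : ∀ t ∈ Ici (0 : ℝ),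
      u t = stateFeedback hn S α β ((x t, R (z t)), (xD 0 t, R (zD t)), uD t) := fun t ht => by
    have h1 := hR.stateFeedback_flatState hε (hU t ht) (θ := W t) (e t) (xD 0 t)
      (fun i => ω i t) fun i => w i t
    rw [← hwn] at h1
    exact h1.symm
  have hηlim : Tendsto (fun t => bodyFrame (e t) (W t)) atTop (𝓝 0) := by
    rw [tendsto_zero_iff_norm_tendsto_zero] at helim ⊢
    exact helim.congr fun t => (norm_bodyFrame _ _).symm
  have hrlim : Tendsto r atTop (𝓝 1) :=
    (contDiff_speed.continuous.tendsto' 0 1 speed_zero).comp hηlim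
  have hvlim : Tendsto (fun t => w n t - ω (n - 1) t) atTop (𝓝 0) := by
    simpa only [hn1] using hwlim (n - 1)
  have hulim : Tendsto (fun t => u t - uD t) atTop (𝓝 0) := by
    refine (h.tendsto_comp_sub (n := n) (ε := ε) hf hrlim hvlim hw0lim hwlim).congr fun t => ?_
    rw [huD' t]
    congr 1
    exact (hR.flatInput_addHeading ε (U t * r t) (w n t) (W t) fun i => w i t).symm
  have hxc : ContinuousOn x (Ici 0) :=
    ContinuousOn.add (fun t ht => (hxD 0 (by omega) t ht).continuousWithinAt)
      ((continuous_ofComplex.const_smul ε).comp_continuousOn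
        fun t ht => (he t ht).continuousWithinAt)
  have huc : ContinuousOn u (Ici 0) :=
    (hR.continuousOn_stateFeedback.comp
      ((hxc.prodMk fun t ht => (hy t ht).continuousWithinAt).prodMk
        (ContinuousOn.prodMk (ContinuousOn.prodMk
          (fun t ht => (hxD 0 (by omega) t ht).continuousWithinAt)
          fun t ht => (hyD t ht).continuousWithinAt) huDc))
      fun t ht => ⟨hR.mem _, hR.mem _, by
        change ε * U t ≠ 0
        exact mul_ne_zero (left_ne_zero_of_mul_eq_one hεε) (hU t ht).ne'⟩).congr hΦ
  refine ⟨x, fun t => R (z t), u, ?_, ?_, fun t _ => hR.mem _, hΦ, hxd, hy, ?_, ?_, fun i => ?_,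
    hulim⟩
  · simp only [hx, he0]
    rw [← toComplex_smul, ofComplex_toComplex, smul_smul, hεε, one_smul, add_sub_cancel]
  · have h1 : z 0 = S y0 := by
      simp only [hz]
      rw [flatState_addHeading hn, flatState_congr fun i hi => hw0 i (by omega),
        flatState_flatCoords hεε, sub_add_cancel]
    simp only [h1]
    exact hR.left_inv y0 hy0
  · obtain ⟨C, hC⟩ := exists_bound_of_tendsto (huc.sub huDc) hulim
    obtain ⟨D, hD⟩ := huDb
    refine ⟨C + D, fun t ht => ?_⟩
    have h1 := norm_add_le (u t - uD t) (uD t)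
    rw [sub_add_cancel] at h1
    exact h1.trans (add_le_add (hC t ht) (hD t ht))
  · have h1 : Tendsto (fun t => ε • ofComplex (e t)) atTop (𝓝 (ε • ofComplex 0)) :=
      ((continuous_ofComplex.tendsto 0).comp helim).const_smul ε
    have h2 : ofComplex 0 = 0 := by
      ext i
      fin_cases i <;> simp [ofComplex]
    rw [h2, smul_zero] at h1
    refine h1.congr fun t => ?_
    simp only [hx, add_sub_cancel_left]
  · have h1 := h.tendsto_comp_sub (n := n) (ε := ε) (f := fun p => R p.2.2)
      (hR.continuous_inv.comp continuous_snd.snd) hrlim hvlim hw0lim hwlim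
    have h2 := (EuclideanSpace.proj (𝕜 := ℝ) i).continuous.tendsto' 0 0 (map_zero _) |>.comp h1
    refine h2.congr fun t => ?_
    simp only [hz, hzD, flatState_addHeading hn, hR.inv_add]
    simp
end
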